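/- arXiv:1801.07152 — 3 statements merged into one kernel-verified Lean document; each statement's English description precedes it below -/
import Mathlib

section
/- Let {X(h)}_{h∈ℤ^d} be a real-valued strictly stationary random field on a probability space. Assume: (i) Σ_{m≥1} m^{d−1} α_{kl}(m) < ∞ for all integers k, l ≥ 1 with k + l ≤ 4; (ii) m^d · α_{1∞}(m) → 0 as m → ∞; (iii) for some δ > 0, E[|X(0)|^{2+δ}] < ∞ and Σ_{m≥1} m^{d−1} (α_{11}(m))^{δ/(2+δ)} < ∞. Let (Λ_n)_{n∈ℕ} be a sequence of finite subsets of ℤ^d increasing to ℤ^d (Λ_n ⊆ Λ_{n+1}, ⋃_n Λ_n = ℤ^d) such that |∂Λ_n|/|Λ_n| → 0 as n → ∞. Then Σ_{h∈ℤ^d} |Cov(X(0), X(h))| < ∞, and if σ² := Σ_{h∈ℤ^d} Cov(X(0), X(h)) > 0, then |Λ_n|^{−1/2} Σ_{h∈Λ_n} (X(h) − E[X(h)]) converges in distribution to the normal law N(0, σ²) as n → ∞. -/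
open MeasureTheory ProbabilityTheory Filter Topology
open scoped ENNReal NNReal

noncomputable section

/-- Covariance of two real random variables. -/
def cov {Ω : Type*} [MeasurableSpace Ω] (P : Measure Ω) (X Y : Ω → ℝ) : ℝ :=
  ∫ ω, X ω * Y ω ∂P - (∫ ω, X ω ∂P) * (∫ ω, Y ω ∂P)

/-- The sup-distance `max_i |h₁(i) − h₂(i)|` between two lattice points of `ℤ^d`. -/
def latDist {d : ℕ} (h₁ h₂ : Fin d → ℤ) : ℕ :=
  Finset.univ.sup fun i => (h₁ i - h₂ i).natAbs

/-- The σ-field generated by the random variables `{X h : h ∈ S}`. -/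
def sigmaGen {Ω : Type*} {ι : Type*} (X : ι → Ω → ℝ) (S : Set ι) : MeasurableSpace Ω :=
  ⨆ h ∈ S, MeasurableSpace.comap (X h) (inferInstance : MeasurableSpace ℝ)

/-- The α-mixing coefficient between two sub-σ-fields:
`α(F₁,F₂) = sup{|P(A∩B) − P(A)P(B)| : A ∈ F₁, B ∈ F₂}`. -/
def alphaMix {Ω : Type*} [MeasurableSpace Ω] (P : Measure Ω)
    (F₁ F₂ : MeasurableSpace Ω) : ℝ :=
  sSup {r | ∃ A B : Set Ω, MeasurableSet[F₁] A ∧ MeasurableSet[F₂] B ∧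
    r = |(P (A ∩ B)).toReal - (P A).toReal * (P B).toReal|}

/-- The mixing coefficient `α_{kl}(m)`: the supremum of the α-mixing coefficients between
the σ-fields of `X` on `S₁` and `S₂`, over all subsets `S₁, S₂ ⊆ ℤ^d` with `|S₁| ≤ k`,
`|S₂| ≤ l` and `d(S₁,S₂) ≥ m` (no cardinality constraint when `k` or `l` is `∞`). -/
def alphaKL {d : ℕ} {Ω : Type*} [MeasurableSpace Ω] (P : Measure Ω)
    (X : (Fin d → ℤ) → Ω → ℝ) (k l : ℕ∞) (m : ℕ) : ℝ :=
  sSup {r | ∃ S₁ S₂ : Set (Fin d → ℤ), S₁.encard ≤ k ∧ S₂.encard ≤ l ∧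
    (∀ h₁ ∈ S₁, ∀ h₂ ∈ S₂, m ≤ latDist h₁ h₂) ∧
    r = alphaMix P (sigmaGen X S₁) (sigmaGen X S₂)}

/-- The boundary `∂Λ` of a set of lattice points: the points of `Λ` at sup-distance `1`
from the complement of `Λ`. -/
def latBoundary {d : ℕ} (Λ : Set (Fin d → ℤ)) : Set (Fin d → ℤ) :=
  {h₁ | h₁ ∈ Λ ∧ ∃ h₂, h₂ ∉ Λ ∧ latDist h₁ h₂ = 1}

/-- Convergence in distribution of a sequence of real random variables to a limit law,
tested against bounded continuous functions. -/
def TendstoInDistribution {Ω : Type*} [MeasurableSpace Ω] (P : Measure Ω)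
    (S : ℕ → Ω → ℝ) (μ : Measure ℝ) : Prop :=
  ∀ f : BoundedContinuousFunction ℝ ℝ,
    Tendsto (fun n => ∫ ω, f (S n ω) ∂P) atTop (𝓝 (∫ x, f x ∂μ))

section Mixing

variable {Ω : Type*} {F G F₁ F₂ G₁ G₂ : MeasurableSpace Ω} [mΩ : MeasurableSpace Ω] {P : Measure Ω}

theorem integral_abs_eq_of_measurableSet {W : Ω → ℝ} (hW : Integrable W P)
    (hA : MeasurableSet {ω | 0 ≤ W ω}) :
    ∫ ω, |W ω| ∂P = ∫ ω in {ω | 0 ≤ W ω}, W ω ∂P - ∫ ω in {ω | 0 ≤ W ω}ᶜ, W ω ∂P := by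
  rw [← integral_add_compl hA hW.abs, sub_eq_add_neg, ← integral_neg]
  congr 1
  · exact setIntegral_congr_fun hA fun ω hω => abs_of_nonneg hω
  · exact setIntegral_congr_fun hA.compl fun ω hω => abs_of_neg (not_le.1 hω)

theorem alphaMix_nonneg : 0 ≤ alphaMix P F₁ F₂ := by
  refine Real.sSup_nonneg ?_
  rintro r ⟨A, B, -, -, rfl⟩
  exact abs_nonneg _

variable [IsProbabilityMeasure P]

/-- The covariance of `V` with a bounded `F`-measurable variable is controlled by its covariances
with the indicators of events of `F`. -/
theorem abs_cov_le_of_setIntegral (hF : F ≤ mΩ) {U V : Ω → ℝ} {C b : ℝ}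
    (hU : StronglyMeasurable[F] U) (hUC : ∀ ω, |U ω| ≤ C) (hV : Integrable V P)
    (hb : ∀ A, MeasurableSet[F] A → |∫ ω in A, V ω ∂P - P.real A * ∫ ω, V ω ∂P| ≤ b) :
    |cov P U V| ≤ 2 * C * b := by
  set c := ∫ ω, V ω ∂P with hc
  have hC : 0 ≤ C := by
    obtain ⟨ω⟩ := P.nonempty_of_neZero
    exact (abs_nonneg _).trans (hUC ω)
  have hUm : AEStronglyMeasurable U P := (hU.mono hF).aestronglyMeasurable
  have hUi : Integrable U P := Integrable.of_bound hUm C (.of_forall hUC)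
  have hVc : Integrable (fun ω => V ω - c) P := hV.sub (integrable_const _)
  have hUV : Integrable (fun ω => U ω * (V ω - c)) P := hVc.bdd_mul hUm (.of_forall hUC)
  have hUV' : Integrable (fun ω => U ω * V ω) P := hV.bdd_mul hUm (.of_forall hUC)
  set W := P[fun ω => V ω - c|F] with hW
  have hWi : Integrable W P := integrable_condExp
  have h1 : cov P U V = ∫ ω, U ω * W ω ∂P := by
    have h2 : ∫ ω, U ω * (V ω - c) ∂P = cov P U V := by
      simp only [mul_sub, cov]
      rw [integral_sub hUV' (hUi.mul_const _), integral_mul_const]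
    rw [← h2, ← integral_condExp hF]
    exact integral_congr_ae (condExp_mul_of_stronglyMeasurable_left hU hUV hVc)
  have hset : ∀ A, MeasurableSet[F] A → |∫ ω in A, W ω ∂P| ≤ b := fun A hA => by
    rw [hW, setIntegral_condExp hF hVc hA, integral_sub hV.integrableOn (integrable_const _)]
    simpa using hb A hA
  have hA : MeasurableSet[F] {ω | 0 ≤ W ω} :=
    stronglyMeasurable_const.measurableSet_le (stronglyMeasurable_condExp (m := F))
  calc |cov P U V| ≤ ∫ ω, |U ω * W ω| ∂P := by rw [h1]; exact abs_integral_le_integral_abs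
    _ ≤ ∫ ω, C * |W ω| ∂P := by
        refine integral_mono_of_nonneg (.of_forall fun _ => abs_nonneg _)
          (hWi.abs.const_mul C) (.of_forall fun ω => ?_)
        simp only [abs_mul]
        exact mul_le_mul_of_nonneg_right (hUC ω) (abs_nonneg _)
    _ = C * (∫ ω in {ω | 0 ≤ W ω}, W ω ∂P - ∫ ω in {ω | 0 ≤ W ω}ᶜ, W ω ∂P) := by
        rw [integral_const_mul, integral_abs_eq_of_measurableSet hWi (hF _ hA)]
    _ ≤ 2 * C * b := by
        have h3 := abs_le.1 (hset _ hA)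
        have h4 := abs_le.1 (hset _ hA.compl)
        nlinarith [h3.1, h3.2, h4.1, h4.2]

theorem abs_measure_inter_sub_le_one (A B : Set Ω) :
    |(P (A ∩ B)).toReal - (P A).toReal * (P B).toReal| ≤ 1 := by
  have h1 : P.real (A ∩ B) ≤ 1 := measureReal_le_one
  have h2 : P.real A ≤ 1 := measureReal_le_one
  have h3 : P.real B ≤ 1 := measureReal_le_one
  have h4 : 0 ≤ P.real (A ∩ B) := measureReal_nonneg
  have h5 : 0 ≤ P.real A := measureReal_nonneg
  have h6 : 0 ≤ P.real B := measureReal_nonneg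
  simp only [Measure.real] at *
  rw [abs_le]
  constructor <;> nlinarith

theorem bddAbove_alphaMix :
    BddAbove {r | ∃ A B : Set Ω, MeasurableSet[F₁] A ∧ MeasurableSet[F₂] B ∧
      r = |(P (A ∩ B)).toReal - (P A).toReal * (P B).toReal|} := by
  refine ⟨1, ?_⟩
  rintro r ⟨A, B, -, -, rfl⟩
  exact abs_measure_inter_sub_le_one A B

theorem alphaMix_le_one : alphaMix P F₁ F₂ ≤ 1 := by
  refine Real.sSup_le ?_ zero_le_one
  rintro r ⟨A, B, -, -, rfl⟩
  exact abs_measure_inter_sub_le_one A B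

theorem alphaMix_mono (h₁ : F₁ ≤ G₁) (h₂ : F₂ ≤ G₂) :
    alphaMix P F₁ F₂ ≤ alphaMix P G₁ G₂ := by
  refine Real.sSup_le ?_ (alphaMix_nonneg)
  rintro r ⟨A, B, hA, hB, rfl⟩
  exact le_csSup (bddAbove_alphaMix) ⟨A, B, h₁ _ hA, h₂ _ hB, rfl⟩

/-- Covariance inequality for bounded random variables. -/
theorem abs_cov_le_alphaMix (hF : F ≤ mΩ) (hG : G ≤ mΩ)
    {U V : Ω → ℝ} {C D : ℝ} (hU : Measurable[F] U) (hV : Measurable[G] V)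
    (hUC : ∀ ω, |U ω| ≤ C) (hVD : ∀ ω, |V ω| ≤ D) :
    |cov P U V| ≤ 4 * C * D * alphaMix P F G := by
  have hVi : Integrable V P :=
    Integrable.of_bound (hV.mono hG le_rfl).aestronglyMeasurable D (.of_forall hVD)
  have key : ∀ A, MeasurableSet[F] A →
      |∫ ω in A, V ω ∂P - P.real A * ∫ ω, V ω ∂P| ≤ 2 * D * alphaMix P F G := by
    intro A hA
    have h0 : ∫ ω in A, V ω ∂P - P.real A * ∫ ω, V ω ∂P = cov P V (A.indicator 1) := by
      have : ∀ ω, V ω * A.indicator (1 : Ω → ℝ) ω = A.indicator V ω := fun ω => by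
        by_cases h : ω ∈ A <;> simp [h]
      simp only [cov, this]
      rw [integral_indicator (hF _ hA), integral_indicator_one (hF _ hA), mul_comm]
    rw [h0]
    refine abs_cov_le_of_setIntegral hG (Measurable.stronglyMeasurable (mα := G) hV) hVD
      ((integrable_const (1 : ℝ)).indicator (hF _ hA)) fun B hB => ?_
    rw [setIntegral_indicator (hF _ hA), integral_indicator_one (hF _ hA)]
    simp only [Pi.one_apply, integral_const, MeasurableSet.univ, measureReal_restrict_apply,
      Set.univ_inter, smul_eq_mul, mul_one]
    refine le_csSup (bddAbove_alphaMix) ⟨A, B, hA, hB, ?_⟩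
    simp only [Measure.real, Set.inter_comm, mul_comm]
  calc |cov P U V| ≤ 2 * C * (2 * D * alphaMix P F G) :=
        abs_cov_le_of_setIntegral hF (Measurable.stronglyMeasurable (mα := F) hU) hUC
          hVi key
    _ = _ := by ring

end Mixing

section Field

theorem measurable_sigmaGen {Ω ι : Type*} (X : ι → Ω → ℝ) {S : Set ι} {h : ι} (hh : h ∈ S) :
    Measurable[sigmaGen X S] (X h) :=
  measurable_iff_comap_le.2 (le_iSup₂_of_le h hh le_rfl)

theorem sigmaGen_comp_le {Ω ι : Type*} (X : ι → Ω → ℝ) {g : ℝ → ℝ} (hg : Measurable g) (S : Set ι) :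
    sigmaGen (fun h ω => g (X h ω)) S ≤ sigmaGen X S :=
  iSup₂_le fun _ hh =>
    measurable_iff_comap_le.1 (hg.comp (measurable_sigmaGen X hh))

variable {d : ℕ} {Ω : Type*} [mΩ : MeasurableSpace Ω] {P : Measure Ω}

theorem sigmaGen_le {ι : Type*} {X : ι → Ω → ℝ} (hX : ∀ h, Measurable (X h)) (S : Set ι) :
    sigmaGen X S ≤ mΩ :=
  iSup₂_le fun h _ => (hX h).comap_le

theorem alphaKL_nonneg (X : (Fin d → ℤ) → Ω → ℝ) (k l : ℕ∞) (m : ℕ) : 0 ≤ alphaKL P X k l m := by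
  refine Real.sSup_nonneg ?_
  rintro r ⟨S₁, S₂, -, -, -, rfl⟩
  exact alphaMix_nonneg

variable [IsProbabilityMeasure P]

theorem alphaMix_le_alphaKL (X : (Fin d → ℤ) → Ω → ℝ) {k l : ℕ∞} {m : ℕ} {S₁ S₂ : Set (Fin d → ℤ)}
    (h₁ : S₁.encard ≤ k) (h₂ : S₂.encard ≤ l) (h : ∀ h₁ ∈ S₁, ∀ h₂ ∈ S₂, m ≤ latDist h₁ h₂) :
    alphaMix P (sigmaGen X S₁) (sigmaGen X S₂) ≤ alphaKL P X k l m := by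
  refine le_csSup ⟨1, ?_⟩ ⟨S₁, S₂, h₁, h₂, h, rfl⟩
  rintro r ⟨S₁, S₂, -, -, -, rfl⟩
  exact alphaMix_le_one

theorem alphaKL_comp_le (X : (Fin d → ℤ) → Ω → ℝ) {g : ℝ → ℝ} (hg : Measurable g)
    (k l : ℕ∞) (m : ℕ) :
    alphaKL P (fun h ω => g (X h ω)) k l m ≤ alphaKL P X k l m := by
  refine Real.sSup_le ?_ (alphaKL_nonneg _ _ _ _)
  rintro r ⟨S₁, S₂, h₁, h₂, h, rfl⟩
  exact (alphaMix_mono (sigmaGen_comp_le X hg _) (sigmaGen_comp_le X hg _)).trans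
    (alphaMix_le_alphaKL X h₁ h₂ h)

theorem abs_cov_le_alphaKL {X : (Fin d → ℤ) → Ω → ℝ} (hX : ∀ h, Measurable (X h))
    {k l : ℕ∞} {m : ℕ} {S₁ S₂ : Set (Fin d → ℤ)}
    (h₁ : S₁.encard ≤ k) (h₂ : S₂.encard ≤ l) (h : ∀ h₁ ∈ S₁, ∀ h₂ ∈ S₂, m ≤ latDist h₁ h₂)
    {U V : Ω → ℝ} {C D : ℝ} (hU : Measurable[sigmaGen X S₁] U) (hV : Measurable[sigmaGen X S₂] V)
    (hUC : ∀ ω, |U ω| ≤ C) (hVD : ∀ ω, |V ω| ≤ D) :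
    |cov P U V| ≤ 4 * C * D * alphaKL P X k l m := by
  obtain ⟨ω⟩ := P.nonempty_of_neZero
  have hC : 0 ≤ C := (abs_nonneg _).trans (hUC ω)
  have hD : 0 ≤ D := (abs_nonneg _).trans (hVD ω)
  refine (abs_cov_le_alphaMix (sigmaGen_le hX _) (sigmaGen_le hX _) hU hV hUC hVD).trans ?_
  exact mul_le_mul_of_nonneg_left (alphaMix_le_alphaKL X h₁ h₂ h) (by positivity)

end Field

section Truncation

/-- The truncation of a real number at level `M`. -/
def trunc (M x : ℝ) : ℝ := if |x| ≤ M then x else 0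

theorem measurable_trunc (M : ℝ) : Measurable (trunc M) :=
  Measurable.ite (measurableSet_le measurable_id.abs measurable_const) measurable_id
    measurable_const

theorem abs_trunc_le {M : ℝ} (hM : 0 ≤ M) (x : ℝ) : |trunc M x| ≤ M := by
  unfold trunc
  split_ifs with h
  · exact h
  · simpa using hM

theorem abs_trunc_le_abs (M x : ℝ) : |trunc M x| ≤ |x| := by
  unfold trunc
  split_ifs with h
  · exact le_rfl
  · simp

theorem abs_sub_trunc_le_abs (M x : ℝ) : |x - trunc M x| ≤ |x| := by
  unfold trunc
  split_ifs with h <;> simp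

theorem trunc_of_le {M x : ℝ} (h : |x| ≤ M) : trunc M x = x := if_pos h

theorem sq_le_rpow_mul_rpow {p M z : ℝ} (hp : 2 ≤ p) (hM : 0 < M) (h : M ≤ z) :
    z ^ 2 ≤ M ^ (2 - p) * z ^ p := by
  have hz : 0 < z := hM.trans_le h
  calc z ^ 2 = z ^ (2 - p) * z ^ p := by
        rw [← Real.rpow_add hz, sub_add_cancel, Real.rpow_two]
    _ ≤ M ^ (2 - p) * z ^ p :=
        mul_le_mul_of_nonneg_right (Real.rpow_le_rpow_of_nonpos hM h (by linarith))
          (Real.rpow_nonneg hz.le _)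

theorem abs_mul_sub_trunc_mul_trunc_le {p M : ℝ} (hp : 2 ≤ p) (hM : 0 < M) (x y : ℝ) :
    |x * y - trunc M x * trunc M y| ≤ M ^ (2 - p) * (|x| ^ p + |y| ^ p) := by
  have hx := Real.rpow_nonneg (abs_nonneg x) p
  have hy := Real.rpow_nonneg (abs_nonneg y) p
  have hMp := Real.rpow_nonneg hM.le (2 - p)
  by_cases h : |x| ≤ M ∧ |y| ≤ M
  · rw [trunc_of_le h.1, trunc_of_le h.2]
    simp only [sub_self, abs_zero]
    positivity
  · have h1 : |x * y - trunc M x * trunc M y| ≤ |x| * |y| := by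
      rw [← abs_mul]
      unfold trunc
      split_ifs <;> simp [mul_nonneg]
    refine h1.trans ?_
    rcases le_total |x| |y| with hxy | hxy
    · have hyM : M ≤ |y| := by
        by_contra hc
        exact h ⟨hxy.trans (not_le.1 hc).le, (not_le.1 hc).le⟩
      have := sq_le_rpow_mul_rpow hp hM hyM
      nlinarith [abs_nonneg x, abs_nonneg y, mul_nonneg hMp hx]
    · have hyM : M ≤ |x| := by
        by_contra hc
        exact h ⟨(not_le.1 hc).le, hxy.trans (not_le.1 hc).le⟩
      have := sq_le_rpow_mul_rpow hp hM hyM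
      nlinarith [abs_nonneg x, abs_nonneg y, mul_nonneg hMp hy]

variable {Ω : Type*} [MeasurableSpace Ω] {Q : Measure Ω} [IsProbabilityMeasure Q]

theorem integrable_mul_of_rpow {p : ℝ} (hp : 2 ≤ p) {U V : Ω → ℝ} (hU : Measurable U)
    (hV : Measurable V) (hUp : Integrable (fun ω => |U ω| ^ p) Q)
    (hVp : Integrable (fun ω => |V ω| ^ p) Q) : Integrable (fun ω => U ω * V ω) Q := by
  refine Integrable.mono' ((integrable_const (1 : ℝ)).add (hUp.add hVp))
    (hU.mul hV).aestronglyMeasurable (.of_forall fun ω => ?_)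
  have h := abs_mul_sub_trunc_mul_trunc_le hp one_pos (U ω) (V ω)
  have h1 : |trunc 1 (U ω) * trunc 1 (V ω)| ≤ 1 := by
    rw [abs_mul]
    exact mul_le_one₀ (abs_trunc_le zero_le_one _) (abs_nonneg _) (abs_trunc_le zero_le_one _)
  rw [Real.one_rpow, one_mul] at h
  simp only [Real.norm_eq_abs, Pi.add_apply]
  have h2 := abs_sub_abs_le_abs_sub (U ω * V ω) (trunc 1 (U ω) * trunc 1 (V ω))
  linarith

theorem integrable_of_rpow {p : ℝ} (hp : 2 ≤ p) {U : Ω → ℝ} (hU : Measurable U)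
    (hUp : Integrable (fun ω => |U ω| ^ p) Q) : Integrable U Q := by
  simpa using integrable_mul_of_rpow (Q := Q) (V := fun _ => 1) hp hU measurable_const hUp
    (by simp)

theorem abs_integral_mul_sub_trunc_le {p M : ℝ} (hp : 2 ≤ p) (hM : 0 < M) {U V : Ω → ℝ}
    (hU : Measurable U) (hV : Measurable V) (hUp : Integrable (fun ω => |U ω| ^ p) Q)
    (hVp : Integrable (fun ω => |V ω| ^ p) Q) :
    |∫ ω, U ω * V ω ∂Q - ∫ ω, trunc M (U ω) * trunc M (V ω) ∂Q| ≤
      M ^ (2 - p) * (∫ ω, |U ω| ^ p ∂Q + ∫ ω, |V ω| ^ p ∂Q) := by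
  have hi : Integrable (fun ω => trunc M (U ω) * trunc M (V ω)) Q := by
    refine Integrable.of_bound (((measurable_trunc M).comp hU).mul
      ((measurable_trunc M).comp hV)).aestronglyMeasurable (M * M) (.of_forall fun ω => ?_)
    rw [norm_mul]
    exact mul_le_mul (abs_trunc_le hM.le _) (abs_trunc_le hM.le _) (norm_nonneg _) hM.le
  rw [← integral_sub (integrable_mul_of_rpow hp hU hV hUp hVp) hi, ← integral_add hUp hVp,
    ← integral_const_mul]
  refine abs_integral_le_integral_abs.trans (integral_mono_of_nonneg
    (.of_forall fun _ => abs_nonneg _) ((hUp.add hVp).const_mul _) (.of_forall fun ω => ?_))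
  exact abs_mul_sub_trunc_mul_trunc_le hp hM _ _

theorem abs_cov_sub_cov_trunc_le {p M K : ℝ} (hp : 2 ≤ p) (hM : 0 < M) {U V : Ω → ℝ}
    (hU : Measurable U) (hV : Measurable V) (hUp : Integrable (fun ω => |U ω| ^ p) Q)
    (hVp : Integrable (fun ω => |V ω| ^ p) Q) (hUK : ∫ ω, |U ω| ^ p ∂Q ≤ K)
    (hVK : ∫ ω, |V ω| ^ p ∂Q ≤ K) :
    |cov Q U V - cov Q (fun ω => trunc M (U ω)) (fun ω => trunc M (V ω))| ≤
      4 * K * M ^ (2 - p) := by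
  have h1 := abs_integral_mul_sub_trunc_le hp hM hU hV hUp hVp
  have h2 := abs_integral_mul_sub_trunc_le (Q := Q.prod Q) (U := fun z => U z.1)
    (V := fun z => V z.2) hp hM (hU.comp measurable_fst) (hV.comp measurable_snd)
    (hUp.comp_fst Q) (hVp.comp_snd Q)
  have h3 : ∫ z, |U z.1| ^ p ∂(Q.prod Q) = ∫ ω, |U ω| ^ p ∂Q := by
    simpa using integral_fun_fst (μ := Q) (ν := Q) (fun ω => |U ω| ^ p)
  have h4 : ∫ z, |V z.2| ^ p ∂(Q.prod Q) = ∫ ω, |V ω| ^ p ∂Q := by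
    simpa using integral_fun_snd (μ := Q) (ν := Q) (fun ω => |V ω| ^ p)
  rw [integral_prod_mul U V, integral_prod_mul (fun ω => trunc M (U ω)) (fun ω => trunc M (V ω)),
    h3, h4] at h2
  have hMp := Real.rpow_nonneg hM.le (2 - p)
  have h5 : M ^ (2 - p) * (∫ ω, |U ω| ^ p ∂Q + ∫ ω, |V ω| ^ p ∂Q) ≤ M ^ (2 - p) * (K + K) :=
    mul_le_mul_of_nonneg_left (add_le_add hUK hVK) hMp
  rw [abs_le] at *
  unfold cov
  constructor <;> linarith [h1.1, h1.2, h2.1, h2.2]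

/-- Davydov's covariance inequality, derived from the covariance inequality for the truncated
variables. -/
theorem abs_cov_le_rpow {δ K a : ℝ} (hδ : 0 < δ) (ha : 0 ≤ a) {U V : Ω → ℝ}
    (hU : Measurable U) (hV : Measurable V) (hUp : Integrable (fun ω => |U ω| ^ (2 + δ)) Q)
    (hVp : Integrable (fun ω => |V ω| ^ (2 + δ)) Q) (hUK : ∫ ω, |U ω| ^ (2 + δ) ∂Q ≤ K)
    (hVK : ∫ ω, |V ω| ^ (2 + δ) ∂Q ≤ K)
    (hb : ∀ M, 0 < M →
      |cov Q (fun ω => trunc M (U ω)) (fun ω => trunc M (V ω))| ≤ 4 * M * M * a) :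
    |cov Q U V| ≤ 4 * (1 + K) * a ^ (δ / (2 + δ)) := by
  have hM : ∀ M, 0 < M → |cov Q U V| ≤ 4 * M * M * a + 4 * K * M ^ (-δ) := fun M hM => by
    have h1 := abs_cov_sub_cov_trunc_le (by linarith) hM hU hV hUp hVp hUK hVK
    rw [show (2 : ℝ) - (2 + δ) = -δ by ring] at h1
    have h2 := abs_sub_abs_le_abs_sub (cov Q U V)
      (cov Q (fun ω => trunc M (U ω)) (fun ω => trunc M (V ω)))
    linarith [hb M hM]
  have hδ' : 0 < δ / (2 + δ) := by positivity
  rcases ha.eq_or_lt with rfl | ha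
  · rw [Real.zero_rpow hδ'.ne', mul_zero]
    have h : Tendsto (fun M : ℝ => 4 * M * M * 0 + 4 * K * M ^ (-δ)) atTop (𝓝 0) := by
      simpa using (tendsto_rpow_neg_atTop hδ).const_mul (4 * K)
    exact ge_of_tendsto h ((eventually_gt_atTop 0).mono hM)
  · have h := hM (a ^ (-(1 / (2 + δ)))) (Real.rpow_pos_of_pos ha _)
    have e1 : a ^ (-(1 / (2 + δ))) * a ^ (-(1 / (2 + δ))) * a = a ^ (δ / (2 + δ)) := by
      conv_lhs => rw [← Real.rpow_add ha]; enter [2]; rw [← Real.rpow_one a]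
      rw [← Real.rpow_add ha]
      congr 1
      field_simp
      ring
    have e2 : (a ^ (-(1 / (2 + δ)))) ^ (-δ) = a ^ (δ / (2 + δ)) := by
      rw [← Real.rpow_mul ha.le]
      congr 1
      field_simp
    rw [e2] at h
    nlinarith

end Truncation

section Lattice

variable {d : ℕ}

theorem latDist_le_iff {h j : Fin d → ℤ} {m : ℕ} :
    latDist h j ≤ m ↔ ∀ i, (h i - j i).natAbs ≤ m := by
  simp [latDist]

theorem latDist_comm (h j : Fin d → ℤ) : latDist h j = latDist j h := by
  simp only [latDist]
  congr 1
  funext i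
  rw [← Int.natAbs_neg, neg_sub]

theorem latDist_eq_latDist_zero (h j : Fin d → ℤ) : latDist h j = latDist 0 (j - h) := by
  simp only [latDist, Pi.zero_apply, Pi.sub_apply]
  congr 1
  funext i
  congr 1
  ring

/-- The sup-ball of radius `m` around a lattice point. -/
def latBall (m : ℕ) (h : Fin d → ℤ) : Finset (Fin d → ℤ) :=
  Finset.Icc (fun i => h i - m) (fun i => h i + m)

theorem mem_latBall {m : ℕ} {h j : Fin d → ℤ} : j ∈ latBall m h ↔ latDist h j ≤ m := by
  simp only [latBall, Finset.mem_Icc, Pi.le_def, latDist_le_iff, ← forall_and]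
  exact forall_congr' fun i => by omega

theorem mem_latBall_comm {m : ℕ} {h j : Fin d → ℤ} : j ∈ latBall m h ↔ h ∈ latBall m j := by
  rw [mem_latBall, mem_latBall, latDist_comm]

theorem card_latBall (m : ℕ) (h : Fin d → ℤ) : (latBall m h).card = (2 * m + 1) ^ d := by
  rw [latBall, Pi.card_Icc]
  simp only [Int.card_Icc]
  rw [Finset.prod_congr rfl fun i _ => show (h i + m + 1 - (h i - m)).toNat = 2 * m + 1 by omega]
  simp

theorem ncard_latDist_eq_le (r : ℕ) :
    {h : Fin d → ℤ | latDist 0 h = r + 1}.ncard ≤ d * (2 * (2 * (r + 1) + 1) ^ (d - 1)) := by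
  classical
  set T : Fin d → Finset (Fin d → ℤ) := fun i => Fintype.piFinset fun j =>
    if j = i then {((r + 1 : ℕ) : ℤ), -((r + 1 : ℕ) : ℤ)}
    else Finset.Icc (-((r + 1 : ℕ) : ℤ)) ((r + 1 : ℕ) : ℤ) with hT
  have hcard : ∀ i, (T i).card ≤ 2 * (2 * (r + 1) + 1) ^ (d - 1) := by
    intro i
    rw [hT, Fintype.card_piFinset, ← Finset.mul_prod_erase _ _ (Finset.mem_univ i), if_pos rfl]
    refine Nat.mul_le_mul Finset.card_le_two ?_
    rw [Finset.prod_congr rfl (g := fun _ => 2 * (r + 1) + 1)]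
    · simp
    · intro j hj
      rw [if_neg (Finset.ne_of_mem_erase hj), Int.card_Icc]
      omega
  have hsub : {h : Fin d → ℤ | latDist 0 h = r + 1} ⊆ (Finset.univ.biUnion T : Finset _) := by
    intro h hh
    have hh' : latDist 0 h = r + 1 := hh
    have hle := latDist_le_iff.1 hh'.le
    have hex : ∃ i, r + 1 ≤ (h i).natAbs := by
      by_contra hc
      push Not at hc
      have : latDist 0 h ≤ r := latDist_le_iff.2 fun i => by
        have := hc i
        simp only [Pi.zero_apply, zero_sub, Int.natAbs_neg]
        omega
      omega
    obtain ⟨i, hi⟩ := hex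
    simp only [Finset.coe_biUnion, Set.mem_iUnion, Finset.mem_coe, hT, Fintype.mem_piFinset]
    refine ⟨i, Finset.mem_univ _, fun j => ?_⟩
    have hj := hle j
    simp only [Pi.zero_apply, zero_sub, Int.natAbs_neg] at hj
    split_ifs with hji
    · subst hji
      simp only [Finset.mem_insert, Finset.mem_singleton]
      omega
    · rw [Finset.mem_Icc]
      omega
  calc _ ≤ (Finset.univ.biUnion T : Finset _).card := by
        rw [← Set.ncard_coe_finset]
        exact Set.ncard_le_ncard hsub (Finset.finite_toSet _)
    _ ≤ ∑ i, (T i).card := Finset.card_biUnion_le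
    _ ≤ ∑ _i : Fin d, 2 * (2 * (r + 1) + 1) ^ (d - 1) := Finset.sum_le_sum fun i _ => hcard i
    _ = _ := by simp

theorem finite_latDist_eq (r : ℕ) : {h : Fin d → ℤ | latDist 0 h = r}.Finite :=
  (latBall r (0 : Fin d → ℤ)).finite_toSet.subset fun h (hh : latDist 0 h = r) =>
    mem_latBall.2 hh.le

/-- A radial function is summable over the lattice as soon as it is summable with the weights
`m ^ (d - 1)`. -/
theorem summable_latDist {f : ℕ → ℝ} (hf : ∀ m, 0 ≤ f m)
    (hs : Summable fun m : ℕ => ((m + 1 : ℕ) : ℝ) ^ (d - 1) * f (m + 1)) :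
    Summable fun h : Fin d → ℤ => f (latDist 0 h) := by
  rw [summable_partition (s := fun r => {h : Fin d → ℤ | latDist 0 h = r}) (fun _ => hf _)
    fun h => ⟨latDist 0 h, rfl, fun r hr => (show latDist 0 h = r from hr).symm⟩]
  have hfin := fun r => (finite_latDist_eq (d := d) r).to_subtype
  refine ⟨fun r => ?_, ?_⟩
  · have := hfin r
    exact Summable.of_finite
  · have heq : ∀ r : ℕ, ∑' h : {h : Fin d → ℤ | latDist 0 h = r}, f (latDist 0 (h : Fin d → ℤ)) =
        ({h : Fin d → ℤ | latDist 0 h = r}.ncard : ℝ) * f r := by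
      intro r
      have := hfin r
      rw [tsum_congr fun h : {h : Fin d → ℤ | latDist 0 h = r} =>
        show f (latDist 0 (h : Fin d → ℤ)) = f r from congrArg f h.2]
      rw [tsum_const, Nat.card_coe_set_eq, nsmul_eq_mul]
    simp only [heq]
    rw [← summable_nat_add_iff 1]
    refine Summable.of_nonneg_of_le (fun r => by have := hf (r + 1); positivity) (fun r => ?_)
      (hs.mul_left ((d : ℝ) * (2 * 3 ^ (d - 1))))
    have h1 : {h : Fin d → ℤ | latDist 0 h = r + 1}.ncard ≤
        d * (2 * 3 ^ (d - 1)) * (r + 1) ^ (d - 1) := by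
      refine (ncard_latDist_eq_le r).trans ?_
      rw [mul_assoc, mul_assoc, ← mul_pow]
      gcongr
      omega
    calc _ ≤ ((d * (2 * 3 ^ (d - 1)) * (r + 1) ^ (d - 1) : ℕ) : ℝ) * f (r + 1) :=
          mul_le_mul_of_nonneg_right (by exact_mod_cast h1) (hf _)
      _ = _ := by push_cast; ring

/-- The number of points of `Λ` that leave `Λ` under the translation by `k`. -/
def exitCard (Λ : Finset (Fin d → ℤ)) (k : Fin d → ℤ) : ℕ :=
  (Λ.filter fun h => h + k ∉ Λ).card

theorem exitCard_add_le (Λ : Finset (Fin d → ℤ)) (k l : Fin d → ℤ) :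
    exitCard Λ (k + l) ≤ exitCard Λ k + exitCard Λ l := by
  classical
  have h1 : (Λ.filter fun h => h + (k + l) ∉ Λ) ⊆ (Λ.filter fun h => h + k ∉ Λ) ∪
      (Λ.filter fun h => h + l ∉ Λ).image fun h => h - k := by
    intro h hh
    rw [Finset.mem_filter] at hh
    rw [Finset.mem_union, Finset.mem_filter, Finset.mem_image]
    by_cases hk : h + k ∈ Λ
    · refine Or.inr ⟨h + k, Finset.mem_filter.2 ⟨hk, ?_⟩, by simp⟩
      rw [add_assoc]
      exact hh.2
    · exact Or.inl ⟨hh.1, hk⟩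
  exact (Finset.card_le_card h1).trans ((Finset.card_union_le _ _).trans
    (Nat.add_le_add_left Finset.card_image_le _))

theorem exitCard_le_ncard_latBoundary (Λ : Finset (Fin d → ℤ)) {k : Fin d → ℤ}
    (hk : latDist 0 k = 1) : exitCard Λ k ≤ (latBoundary (Λ : Set (Fin d → ℤ))).ncard := by
  rw [exitCard, ← Set.ncard_coe_finset]
  refine Set.ncard_le_ncard (fun h hh => ?_) (Λ.finite_toSet.subset fun h hh => hh.1)
  rw [Finset.mem_coe, Finset.mem_filter] at hh
  exact ⟨hh.1, h + k, hh.2, by rw [latDist_eq_latDist_zero, add_sub_cancel_left, hk]⟩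

theorem latDist_zero_single (i : Fin d) {z : ℤ} (hz : z.natAbs = 1) :
    latDist 0 (Pi.single i z) = 1 := by
  refine le_antisymm (latDist_le_iff.2 fun j => ?_) ?_
  · rcases eq_or_ne j i with rfl | hj
    · simp [hz]
    · simp [hj]
  · refine le_trans ?_ (Finset.le_sup (f := fun j => ((0 : Fin d → ℤ) j -
      (Pi.single i z : Fin d → ℤ) j).natAbs) (Finset.mem_univ i))
    simp [hz]

theorem tendsto_exitCard_div_card {Λ : ℕ → Finset (Fin d → ℤ)}
    (hΛ : Tendsto (fun n => ((latBoundary (Λ n : Set (Fin d → ℤ))).ncard : ℝ) / (Λ n).card)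
      atTop (𝓝 0)) (k : Fin d → ℤ) :
    Tendsto (fun n => (exitCard (Λ n) k : ℝ) / (Λ n).card) atTop (𝓝 0) := by
  let p : (Fin d → ℤ) → Prop := fun k =>
    Tendsto (fun n => (exitCard (Λ n) k : ℝ) / (Λ n).card) atTop (𝓝 0)
  have hadd : ∀ k l, p k → p l → p (k + l) := fun k l hk hl => by
    refine squeeze_zero (fun n => by positivity) (fun n => ?_) (by simpa using hk.add hl)
    rw [← add_div]
    gcongr
    exact_mod_cast exitCard_add_le (Λ n) k l
  have hzero : p 0 := by
    have h0 : ∀ n, exitCard (Λ n) 0 = 0 := fun n =>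
      Finset.card_eq_zero.2 (Finset.filter_false_of_mem (by simp))
    simp [p, h0]
  have hone : ∀ (i : Fin d) (z : ℤ), z.natAbs = 1 → p (Pi.single i z) := fun i z hz => by
    refine squeeze_zero (fun n => by positivity) (fun n => ?_) hΛ
    gcongr
    exact exitCard_le_ncard_latBoundary (Λ n) (latDist_zero_single i hz)
  have hsingle : ∀ (i : Fin d) (z : ℤ), p (Pi.single i z) := fun i z => by
    induction z using Int.induction_on with
    | zero => simpa using hzero
    | succ z ih =>
      rw [Pi.single_add]
      exact hadd _ _ ih (hone i 1 rfl)
    | pred z ih =>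
      rw [sub_eq_add_neg, Pi.single_add]
      exact hadd _ _ ih (hone i (-1) rfl)
  have := Finset.sum_induction (s := Finset.univ) (fun i => (Pi.single i (k i) : Fin d → ℤ)) p hadd
    hzero fun i _ => hsingle i (k i)
  rwa [Finset.univ_sum_single] at this

theorem tendsto_card_atTop (hd : 0 < d) {Λ : ℕ → Finset (Fin d → ℤ)}
    (hmono : ∀ n, Λ n ⊆ Λ (n + 1)) (hunion : (⋃ n, (Λ n : Set (Fin d → ℤ))) = Set.univ) :
    Tendsto (fun n => (Λ n).card) atTop atTop := by
  have hm : Monotone Λ := monotone_nat_of_le_succ hmono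
  have : Nonempty (Fin d) := ⟨⟨0, hd⟩⟩
  refine tendsto_atTop_atTop_of_monotone (fun a b hab => Finset.card_le_card (hm hab)) fun b => ?_
  obtain ⟨s, hs⟩ := Infinite.exists_subset_card_eq (Fin d → ℤ) b
  have hex : ∀ h, ∃ n, h ∈ Λ n := fun h => by
    have : h ∈ ⋃ n, (Λ n : Set (Fin d → ℤ)) := hunion ▸ Set.mem_univ h
    simpa using this
  choose N hN using hex
  refine ⟨s.sup N, hs ▸ Finset.card_le_card fun h hh => hm (Finset.le_sup hh) (hN h)⟩

end Lattice

section CoreBound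

open Complex (I)

theorem norm_cexp_taylor_le (x : ℝ) :
    ‖Complex.exp (I * (x : ℂ)) - 1 - I * (x : ℂ)‖ ≤ 3 * x ^ 2 := by
  have hn : ‖I * (x : ℂ)‖ = |x| := by simp
  rcases le_total |x| 1 with h | h
  · have := Complex.norm_exp_sub_one_sub_id_le (x := I * (x : ℂ)) (hn.trans_le h)
    rw [hn, sq_abs] at this
    nlinarith [sq_nonneg x]
  · have h1 : ‖Complex.exp (I * (x : ℂ)) - 1‖ ≤ |x| := Real.norm_exp_I_mul_ofReal_sub_one_le
    have h2 := norm_sub_le (Complex.exp (I * (x : ℂ)) - 1) (I * (x : ℂ))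
    rw [hn] at h2
    nlinarith [sq_abs x]

theorem norm_cexp_sub_cexp_sub_le (u v : ℝ) :
    ‖Complex.exp (I * (u : ℂ)) - Complex.exp (I * ((u - v : ℝ) : ℂ)) -
      I * (v : ℂ) * Complex.exp (I * (u : ℂ))‖ ≤ 3 * v ^ 2 := by
  have h : Complex.exp (I * (u : ℂ)) - Complex.exp (I * ((u - v : ℝ) : ℂ)) -
      I * (v : ℂ) * Complex.exp (I * (u : ℂ)) =
      -(Complex.exp (I * (u : ℂ)) * (Complex.exp (I * ((-v : ℝ) : ℂ)) - 1 -
        I * ((-v : ℝ) : ℂ))) := by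
    rw [show I * ((u - v : ℝ) : ℂ) = I * (u : ℂ) + I * ((-v : ℝ) : ℂ) by push_cast; ring,
      Complex.exp_add]
    push_cast
    ring
  rw [h, norm_neg, norm_mul, Complex.norm_exp_I_mul_ofReal, one_mul]
  simpa using norm_cexp_taylor_le (-v)

variable {Ω : Type*} [MeasurableSpace Ω] {P : Measure Ω} [IsProbabilityMeasure P]

theorem integral_abs_le_sqrt {W : Ω → ℝ} (hW : Integrable W P)
    (hW2 : Integrable (fun ω => W ω ^ 2) P) : ∫ ω, |W ω| ∂P ≤ √(∫ ω, W ω ^ 2 ∂P) := by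
  set m := ∫ ω, |W ω| ∂P with hm
  refine Real.le_sqrt_of_sq_le ?_
  have h : 0 ≤ ∫ ω, (|W ω| - m) ^ 2 ∂P := integral_nonneg fun ω => sq_nonneg _
  have h1 : ∫ ω, (|W ω| - m) ^ 2 ∂P = ∫ ω, W ω ^ 2 ∂P - m ^ 2 := by
    have : ∀ ω, (|W ω| - m) ^ 2 = W ω ^ 2 - 2 * m * |W ω| + m ^ 2 := fun ω => by
      rw [← sq_abs (W ω)]
      ring
    have h2 : Integrable (fun ω => 2 * m * |W ω|) P := hW.abs.const_mul _
    have h3 : Integrable (fun ω => W ω ^ 2 - 2 * m * |W ω|) P := hW2.sub h2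
    simp only [this]
    rw [integral_add h3 (integrable_const _), integral_sub hW2 h2, integral_const_mul, ← hm]
    simp
    ring
  linarith

theorem integral_sq_sum_eq {ι : Type*} (Q : Finset ι) {V : ι → Ω → ℝ}
    (hV : ∀ q q', Integrable (fun ω => V q ω * V q' ω) P) :
    ∫ ω, (∑ q ∈ Q, V q ω) ^ 2 ∂P = ∑ q ∈ Q, ∑ q' ∈ Q, ∫ ω, V q ω * V q' ω ∂P := by
  simp only [sq, Finset.sum_mul_sum]
  rw [integral_finsetSum _ fun q _ => integrable_finsetSum _ fun q' _ => hV q q']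
  exact Finset.sum_congr rfl fun q _ => integral_finsetSum _ fun q' _ => hV q q'

theorem cov_eq_integral_centered {U V : Ω → ℝ} (hU : Integrable U P) (hV : Integrable V P)
    (hUV : Integrable (fun ω => U ω * V ω) P) :
    ∫ ω, (U ω - ∫ ω', U ω' ∂P) * (V ω - ∫ ω', V ω' ∂P) ∂P = cov P U V := by
  set u := ∫ ω', U ω' ∂P
  set v := ∫ ω', V ω' ∂P
  have : ∀ ω, (U ω - u) * (V ω - v) = U ω * V ω - v * U ω - u * V ω + u * v := fun ω => by ring
  have h1 : Integrable (fun ω => v * U ω) P := hU.const_mul _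
  have h2 : Integrable (fun ω => u * V ω) P := hV.const_mul _
  have h3 : Integrable (fun ω => U ω * V ω - v * U ω) P := hUV.sub h1
  have h4 : Integrable (fun ω => U ω * V ω - v * U ω - u * V ω) P := h3.sub h2
  simp only [this]
  rw [integral_add h4 (integrable_const _), integral_sub h3 h2, integral_sub hUV h1,
    integral_const_mul, integral_const_mul]
  simp [cov, u, v]
  ring

variable {d : ℕ}

theorem summable_comp_sub_right {f : (Fin d → ℤ) → ℝ} (hs : Summable f) (x : Fin d → ℤ) :
    Summable fun h => f (h - x) :=
  (Equiv.subRight x).summable_iff.2 hs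

theorem sum_comp_sub_le_tsum {f : (Fin d → ℤ) → ℝ} (hf : ∀ h, 0 ≤ f h) (hs : Summable f)
    (T : Finset (Fin d → ℤ)) (x : Fin d → ℤ) : ∑ j ∈ T, f (j - x) ≤ ∑' h, f h := by
  rw [← (Equiv.subRight x).tsum_eq f]
  exact (summable_comp_sub_right hs x).sum_le_tsum T fun j _ => hf _

theorem sum_comp_sub_le_mul_tsum {ι : Type*} {f : (Fin d → ℤ) → ℝ} (hf : ∀ h, 0 ≤ f h)
    (hs : Summable f) (Q : Finset ι) (e : ι → Fin d → ℤ) {M : ℕ}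
    (hM : ∀ y, (Q.filter fun q => e q = y).card ≤ M) (x : Fin d → ℤ) :
    ∑ q ∈ Q, f (e q - x) ≤ M * ∑' h, f h := by
  classical
  rw [← Finset.sum_fiberwise_of_maps_to (t := Q.image e) (g := e)
    fun q hq => Finset.mem_image_of_mem e hq]
  calc _ ≤ ∑ y ∈ Q.image e, M * f (y - x) := by
        refine Finset.sum_le_sum fun y _ => ?_
        rw [Finset.sum_congr rfl fun q hq => by rw [(Finset.mem_filter.1 hq).2], Finset.sum_const,
          nsmul_eq_mul]
        exact mul_le_mul_of_nonneg_right (by exact_mod_cast hM y) (hf _)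
    _ ≤ _ := by
        rw [← Finset.mul_sum]
        exact mul_le_mul_of_nonneg_left (sum_comp_sub_le_tsum hf hs _ x) (Nat.cast_nonneg _)

/-- Second moments of partial sums of a field with summable stationary covariances. -/
theorem integral_sq_sum_le {Y : (Fin d → ℤ) → Ω → ℝ} {c : (Fin d → ℤ) → ℝ}
    (hYY : ∀ h j, Integrable (fun ω => Y h ω * Y j ω) P)
    (hc : ∀ h j, ∫ ω, Y h ω * Y j ω ∂P = c (j - h)) (hs : Summable fun h => |c h|)
    (T : Finset (Fin d → ℤ)) :
    ∫ ω, (∑ h ∈ T, Y h ω) ^ 2 ∂P ≤ T.card * ∑' h, |c h| := by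
  rw [integral_sq_sum_eq T hYY, ← nsmul_eq_mul]
  refine Finset.sum_le_card_nsmul _ _ _ fun h _ => ?_
  simp only [hc]
  exact (Finset.sum_le_sum fun j _ => le_abs_self _).trans
    (sum_comp_sub_le_tsum (fun _ => abs_nonneg _) hs T h)

/-- The pairs of points of `Λ` at distance at most `m`. -/
def closePairs (Λ : Finset (Fin d → ℤ)) (m : ℕ) : Finset ((Fin d → ℤ) × (Fin d → ℤ)) :=
  (Λ ×ˢ Λ).filter fun q => q.2 ∈ latBall m q.1

theorem card_fst_closePairs_le (Λ : Finset (Fin d → ℤ)) (m : ℕ) (y : Fin d → ℤ) :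
    ((closePairs Λ m).filter fun q => q.1 = y).card ≤ (2 * m + 1) ^ d := by
  rw [← card_latBall m y]
  refine Finset.card_le_card_of_injOn Prod.snd (fun q hq => ?_) fun q hq q' hq' h => ?_
  · simp only [closePairs, Finset.coe_filter, Finset.mem_filter, Set.mem_ofPred_eq] at hq
    exact hq.2 ▸ hq.1.2
  · simp only [Finset.coe_filter, Set.mem_ofPred_eq] at hq hq'
    exact Prod.ext (hq.2.trans hq'.2.symm) h

theorem card_snd_closePairs_le (Λ : Finset (Fin d → ℤ)) (m : ℕ) (y : Fin d → ℤ) :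
    ((closePairs Λ m).filter fun q => q.2 = y).card ≤ (2 * m + 1) ^ d := by
  rw [← card_latBall m y]
  refine Finset.card_le_card_of_injOn Prod.fst (fun q hq => ?_) fun q hq q' hq' h => ?_
  · simp only [closePairs, Finset.coe_filter, Finset.mem_filter, Set.mem_ofPred_eq] at hq
    exact mem_latBall_comm.1 (hq.2 ▸ hq.1.2)
  · simp only [Finset.coe_filter, Set.mem_ofPred_eq] at hq hq'
    exact Prod.ext h (hq.2.trans hq'.2.symm)

theorem card_closePairs_le (Λ : Finset (Fin d → ℤ)) (m : ℕ) :
    (closePairs Λ m).card ≤ Λ.card * (2 * m + 1) ^ d := by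
  rw [mul_comm]
  exact Finset.card_le_mul_card_image_of_maps_to (f := Prod.fst)
    (fun q hq => (Finset.mem_product.1 (Finset.mem_filter.1 hq).1).1) _
    fun y _ => card_fst_closePairs_le Λ m y

theorem sum_closePairs (Λ : Finset (Fin d → ℤ)) (m : ℕ) (f : (Fin d → ℤ) → (Fin d → ℤ) → ℝ) :
    ∑ q ∈ closePairs Λ m, f q.1 q.2 = ∑ h ∈ Λ, ∑ j ∈ Λ.filter (· ∈ latBall m h), f h j := by
  rw [closePairs, Finset.sum_filter, Finset.sum_product]
  exact Finset.sum_congr rfl fun h _ => (Finset.sum_filter _ _).symm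

/-- Variance bound for the truncated quadratic form `∑ Y h * Y j` over close pairs. -/
theorem integral_sq_closePairs_le {Y : (Fin d → ℤ) → Ω → ℝ} {b : (Fin d → ℤ) → ℝ} {C : ℝ}
    (hY : ∀ h, Measurable (Y h)) (hYC : ∀ h ω, |Y h ω| ≤ C)
    (hb : ∀ h, 0 ≤ b h) (hbs : Summable b)
    (hcov : ∀ h j h' j', |cov P (fun ω => Y h ω * Y j ω) (fun ω => Y h' ω * Y j' ω)| ≤
      b (h' - h) + b (j' - h) + b (h' - j) + b (j' - j))
    (Λ : Finset (Fin d → ℤ)) (m : ℕ) :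
    ∫ ω, (∑ q ∈ closePairs Λ m, (Y q.1 ω * Y q.2 ω - ∫ ω', Y q.1 ω' * Y q.2 ω' ∂P)) ^ 2 ∂P ≤
      Λ.card * (4 * ∑' h, b h) * ((2 * m + 1 : ℕ) ^ d : ℕ) ^ 2 := by
  set M : ℕ := (2 * m + 1 : ℕ) ^ d with hM
  have hbd : ∀ h j, ∀ ω, |Y h ω * Y j ω| ≤ C * C := fun h j ω => by
    rw [abs_mul]
    exact mul_le_mul (hYC h ω) (hYC j ω) (abs_nonneg _) ((abs_nonneg _).trans (hYC h ω))
  have hYint : ∀ h j, Integrable (fun ω => Y h ω * Y j ω) P := fun h j =>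
    Integrable.of_bound ((hY h).mul (hY j)).aestronglyMeasurable _ (.of_forall (hbd h j))
  have hint2 : ∀ q q' : (Fin d → ℤ) × (Fin d → ℤ), Integrable (fun ω =>
      (Y q.1 ω * Y q.2 ω - ∫ ω', Y q.1 ω' * Y q.2 ω' ∂P) *
      (Y q'.1 ω * Y q'.2 ω - ∫ ω', Y q'.1 ω' * Y q'.2 ω' ∂P)) P := fun q q' => by
    refine Integrable.bdd_mul (c := C * C + |∫ ω', Y q.1 ω' * Y q.2 ω' ∂P|)
      ((hYint q'.1 q'.2).sub (integrable_const _))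
      ((((hY q.1).mul (hY q.2)).sub_const _).aestronglyMeasurable) (.of_forall fun ω => ?_)
    exact (norm_sub_le _ _).trans (add_le_add (hbd _ _ ω) le_rfl)
  have hYint4 : ∀ q q' : (Fin d → ℤ) × (Fin d → ℤ), Integrable (fun ω =>
      (Y q.1 ω * Y q.2 ω) * (Y q'.1 ω * Y q'.2 ω)) P := fun q q' =>
    (hYint q'.1 q'.2).bdd_mul ((hY q.1).mul (hY q.2)).aestronglyMeasurable
      (.of_forall (hbd q.1 q.2))
  rw [integral_sq_sum_eq (closePairs Λ m) hint2]
  have hq : ∀ q ∈ closePairs Λ m, ∑ q' ∈ closePairs Λ m, ∫ ω,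
      (Y q.1 ω * Y q.2 ω - ∫ ω', Y q.1 ω' * Y q.2 ω' ∂P) *
      (Y q'.1 ω * Y q'.2 ω - ∫ ω', Y q'.1 ω' * Y q'.2 ω' ∂P) ∂P ≤ 4 * (M * ∑' h, b h) := by
    intro q _
    have h1 := sum_comp_sub_le_mul_tsum hb hbs (closePairs Λ m) Prod.fst
      (card_fst_closePairs_le Λ m)
    have h2 := sum_comp_sub_le_mul_tsum hb hbs (closePairs Λ m) Prod.snd
      (card_snd_closePairs_le Λ m)
    calc _ ≤ ∑ q' ∈ closePairs Λ m,
          (b (q'.1 - q.1) + b (q'.2 - q.1) + b (q'.1 - q.2) + b (q'.2 - q.2)) := by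
          refine Finset.sum_le_sum fun q' _ => ?_
          rw [cov_eq_integral_centered (hYint _ _) (hYint _ _) (hYint4 q q')]
          exact (le_abs_self _).trans (hcov _ _ _ _)
      _ ≤ _ := by
          simp only [Finset.sum_add_distrib]
          linarith [h1 q.1, h1 q.2, h2 q.1, h2 q.2]
  have hbt : 0 ≤ ∑' h, b h := tsum_nonneg hb
  calc _ ≤ (closePairs Λ m).card • (4 * (M * ∑' h, b h)) := Finset.sum_le_card_nsmul _ _ _ hq
    _ ≤ ((Λ.card * M : ℕ) : ℝ) * (4 * (M * ∑' h, b h)) := by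
        rw [nsmul_eq_mul]
        exact mul_le_mul_of_nonneg_right (by exact_mod_cast card_closePairs_le Λ m)
          (by positivity)
    _ = _ := by
        push_cast
        ring

/-- Quantitative form of Bolthausen's version of Stein's equation for a bounded field. -/
theorem norm_integral_stein_le {Y : (Fin d → ℤ) → Ω → ℝ} {b c : (Fin d → ℤ) → ℝ} {C a : ℝ} {m : ℕ}
    (hY : ∀ h, Measurable (Y h)) (hYC : ∀ h ω, |Y h ω| ≤ C)
    (hc : ∀ h j, ∫ ω, Y h ω * Y j ω ∂P = c (j - h)) (hcs : Summable fun h => |c h|)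
    (hb : ∀ h, 0 ≤ b h) (hbs : Summable b)
    (hcov : ∀ h j h' j', |cov P (fun ω => Y h ω * Y j ω) (fun ω => Y h' ω * Y j' ω)| ≤
      b (h' - h) + b (j' - h) + b (h' - j) + b (j' - j))
    (ha : ∀ (h : Fin d → ℤ) (T : Finset (Fin d → ℤ)), (∀ j ∈ T, m < latDist h j) → ∀ s : ℝ,
      ‖∫ ω, (Y h ω : ℂ) * Complex.exp (I * ((s * ∑ j ∈ T, Y j ω : ℝ) : ℂ)) ∂P‖ ≤ a)
    (Λ : Finset (Fin d → ℤ)) (s : ℝ) :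
    ‖∫ ω, (((∑ h ∈ Λ, Y h ω : ℝ) : ℂ) - I * s * ((∑ q ∈ closePairs Λ m, c (q.2 - q.1) : ℝ) : ℂ)) *
      Complex.exp (I * ((s * ∑ j ∈ Λ, Y j ω : ℝ) : ℂ)) ∂P‖ ≤
      Λ.card * a + |s| * √(Λ.card * (4 * ∑' h, b h) * ((2 * m + 1 : ℕ) ^ d : ℕ) ^ 2) +
        Λ.card * (3 * C * s ^ 2 * (((2 * m + 1 : ℕ) ^ d : ℕ) * ∑' h, |c h|)) := by
  classical
  obtain ⟨ω₀⟩ := P.nonempty_of_neZero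
  have hC : 0 ≤ C := (abs_nonneg _).trans (hYC 0 ω₀)
  set M : ℕ := (2 * m + 1 : ℕ) ^ d with hM
  have hYint : ∀ h j, Integrable (fun ω => Y h ω * Y j ω) P := fun h j => by
    refine Integrable.of_bound ((hY h).mul (hY j)).aestronglyMeasurable (C * C)
      (.of_forall fun ω => ?_)
    rw [norm_mul]
    exact mul_le_mul (hYC h ω) (hYC j ω) (norm_nonneg _) hC
  set near : (Fin d → ℤ) → Finset (Fin d → ℤ) := fun h => Λ.filter (· ∈ latBall m h) with hnear
  set far : (Fin d → ℤ) → Finset (Fin d → ℤ) := fun h => Λ.filter (· ∉ latBall m h) with hfar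
  set W : Ω → ℝ := fun ω => ∑ q ∈ closePairs Λ m,
    (Y q.1 ω * Y q.2 ω - ∫ ω', Y q.1 ω' * Y q.2 ω' ∂P) with hW
  set S : Ω → ℝ := fun ω => ∑ j ∈ Λ, Y j ω with hS
  have hSm : Measurable S := Finset.measurable_fun_sum _ fun j _ => hY j
  set R : (Fin d → ℤ) → Ω → ℂ := fun h ω => (Y h ω : ℂ) *
    (Complex.exp (I * ((s * S ω : ℝ) : ℂ)) - Complex.exp (I * ((s * ∑ j ∈ far h, Y j ω : ℝ) : ℂ)) -
      I * ((s * ∑ j ∈ near h, Y j ω : ℝ) : ℂ) * Complex.exp (I * ((s * S ω : ℝ) : ℂ))) with hR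
  have hsplit : ∀ h ω, s * ∑ j ∈ far h, Y j ω = s * S ω - s * ∑ j ∈ near h, Y j ω := by
    intro h ω
    simp only [hS, hnear, hfar]
    rw [← Finset.sum_filter_add_sum_filter_not Λ (· ∈ latBall m h)]
    ring
  have hRb : ∀ h ω, ‖R h ω‖ ≤ 3 * C * s ^ 2 * (∑ j ∈ near h, Y j ω) ^ 2 := by
    intro h ω
    rw [hR]
    simp only []
    rw [norm_mul, hsplit]
    calc _ ≤ C * (3 * (s * ∑ j ∈ near h, Y j ω) ^ 2) := by
          refine mul_le_mul ?_ (norm_cexp_sub_cexp_sub_le _ _) (norm_nonneg _) hC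
          rw [Complex.norm_real]
          exact hYC h ω
      _ = _ := by ring
  have hpoint : ∀ ω, (((S ω : ℝ) : ℂ) -
      I * s * ((∑ q ∈ closePairs Λ m, c (q.2 - q.1) : ℝ) : ℂ)) *
      Complex.exp (I * ((s * S ω : ℝ) : ℂ)) =
      (∑ h ∈ Λ, (Y h ω : ℂ) * Complex.exp (I * ((s * ∑ j ∈ far h, Y j ω : ℝ) : ℂ))) +
      (I * s * (W ω : ℂ) * Complex.exp (I * ((s * S ω : ℝ) : ℂ)) + ∑ h ∈ Λ, R h ω) := by
    intro ω
    have h1 : W ω = ∑ h ∈ Λ, Y h ω * ∑ j ∈ near h, Y j ω -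
        ∑ q ∈ closePairs Λ m, c (q.2 - q.1) := by
      rw [hW]
      simp only [Finset.sum_sub_distrib, hc]
      rw [sum_closePairs Λ m fun h j => Y h ω * Y j ω]
      simp only [Finset.mul_sum, hnear]
    have h2 : ∀ h, (Y h ω : ℂ) * Complex.exp (I * ((s * S ω : ℝ) : ℂ)) =
        (Y h ω : ℂ) * Complex.exp (I * ((s * ∑ j ∈ far h, Y j ω : ℝ) : ℂ)) +
        I * s * ((Y h ω * ∑ j ∈ near h, Y j ω : ℝ) : ℂ) *
          Complex.exp (I * ((s * S ω : ℝ) : ℂ)) + R h ω := fun h => by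
      simp only [hR]
      push_cast
      ring
    have h3 : ((S ω : ℝ) : ℂ) * Complex.exp (I * ((s * S ω : ℝ) : ℂ)) =
        ∑ h ∈ Λ, (Y h ω : ℂ) * Complex.exp (I * ((s * ∑ j ∈ far h, Y j ω : ℝ) : ℂ)) +
        I * s * ((∑ h ∈ Λ, Y h ω * ∑ j ∈ near h, Y j ω : ℝ) : ℂ) *
          Complex.exp (I * ((s * S ω : ℝ) : ℂ)) + ∑ h ∈ Λ, R h ω := by
      have h4 : ((S ω : ℝ) : ℂ) * Complex.exp (I * ((s * S ω : ℝ) : ℂ)) =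
          ∑ h ∈ Λ, (Y h ω : ℂ) * Complex.exp (I * ((s * S ω : ℝ) : ℂ)) := by
        rw [← Finset.sum_mul, ← Complex.ofReal_sum]
      rw [h4, Finset.sum_congr rfl fun h _ => h2 h, Finset.sum_add_distrib,
        Finset.sum_add_distrib, ← Finset.sum_mul, ← Finset.mul_sum, ← Complex.ofReal_sum]
    rw [sub_mul, h3, h1]
    push_cast
    ring
  have hexp : ∀ x : ℝ, ‖Complex.exp (I * (x : ℂ))‖ = 1 := Complex.norm_exp_I_mul_ofReal
  have hYb : ∀ T : Finset (Fin d → ℤ), ∀ h, Integrable (fun ω =>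
      (Y h ω : ℂ) * Complex.exp (I * ((s * ∑ j ∈ T, Y j ω : ℝ) : ℂ))) P := fun T h => by
    refine Integrable.of_bound (Measurable.aestronglyMeasurable (by fun_prop)) C
      (.of_forall fun ω => ?_)
    rw [norm_mul, hexp, mul_one, Complex.norm_real]
    exact hYC h ω
  have hWi : Integrable W P :=
    integrable_finsetSum _ fun q _ => (hYint q.1 q.2).sub (integrable_const _)
  have hWb : ∃ D, ∀ ω, |W ω| ≤ D := by
    refine ⟨∑ q ∈ closePairs Λ m, (C * C + |∫ ω', Y q.1 ω' * Y q.2 ω' ∂P|), fun ω =>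
      (Finset.abs_sum_le_sum_abs _ _).trans (Finset.sum_le_sum fun q _ => ?_)⟩
    refine (abs_sub _ _).trans (add_le_add ?_ le_rfl)
    rw [abs_mul]
    exact mul_le_mul (hYC _ ω) (hYC _ ω) (abs_nonneg _) hC
  have hW2 : Integrable (fun ω => W ω ^ 2) P := by
    obtain ⟨D, hD⟩ := hWb
    simp only [sq]
    exact hWi.bdd_mul hWi.aestronglyMeasurable (.of_forall hD)
  have hnear2 : ∀ h, Integrable (fun ω => (∑ j ∈ near h, Y j ω) ^ 2) P := fun h => by
    simp only [sq, Finset.sum_mul_sum]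
    exact integrable_finsetSum _ fun q _ => integrable_finsetSum _ fun q' _ => hYint q q'
  have hRm : ∀ h, Measurable (R h) := fun h => by fun_prop
  have hRi : ∀ h, Integrable (R h) P := fun h =>
    ((hnear2 h).const_mul (3 * C * s ^ 2)).mono' (hRm h).aestronglyMeasurable
      (.of_forall (hRb h))
  have hR1 : ∀ h, ‖∫ ω, R h ω ∂P‖ ≤ 3 * C * s ^ 2 * (M * ∑' h, |c h|) := fun h => by
    refine (norm_integral_le_of_norm_le ((hnear2 h).const_mul (3 * C * s ^ 2))
      (.of_forall (hRb h))).trans ?_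
    rw [integral_const_mul]
    refine mul_le_mul_of_nonneg_left ?_ (by positivity)
    refine (integral_sq_sum_le hYint hc hcs _).trans ?_
    refine mul_le_mul_of_nonneg_right ?_ (tsum_nonneg fun _ => abs_nonneg _)
    have : (near h).card ≤ (latBall m h).card :=
      Finset.card_le_card fun j hj => (Finset.mem_filter.1 hj).2
    rw [card_latBall] at this
    exact_mod_cast this
  have hW1 : ‖∫ ω, I * s * (W ω : ℂ) * Complex.exp (I * ((s * S ω : ℝ) : ℂ)) ∂P‖ ≤
      |s| * √(Λ.card * (4 * ∑' h, b h) * (M : ℝ) ^ 2) := by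
    refine (norm_integral_le_of_norm_le (hWi.abs.const_mul |s|) (.of_forall fun ω => ?_)).trans ?_
    · simp only [norm_mul, hexp, Complex.norm_I, Complex.norm_real, Real.norm_eq_abs, one_mul,
        mul_one, le_refl]
    · rw [integral_const_mul]
      refine mul_le_mul_of_nonneg_left ?_ (abs_nonneg _)
      exact (integral_abs_le_sqrt hWi hW2).trans
        (Real.sqrt_le_sqrt (integral_sq_closePairs_le hY hYC hb hbs hcov Λ m))
  have hWe : Integrable (fun ω => I * s * (W ω : ℂ) *
      Complex.exp (I * ((s * S ω : ℝ) : ℂ))) P := by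
    refine (hWi.ofReal.const_mul (I * s)).mul_bdd (c := 1)
      (Measurable.aestronglyMeasurable (by fun_prop)) (.of_forall fun ω => (hexp _).le)
  have hRs : Integrable (fun ω => ∑ h ∈ Λ, R h ω) P := integrable_finsetSum _ fun h _ => hRi h
  rw [integral_congr_ae (.of_forall hpoint)]
  have hWR : Integrable (fun ω => I * s * (W ω : ℂ) * Complex.exp (I * ((s * S ω : ℝ) : ℂ)) +
      ∑ h ∈ Λ, R h ω) P := hWe.add hRs
  rw [integral_add (integrable_finsetSum _ fun h _ => hYb (far h) h) hWR,
    integral_add hWe hRs, integral_finsetSum _ fun h _ => hYb (far h) h,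
    integral_finsetSum _ fun h _ => hRi h, ← add_assoc]
  refine (norm_add₃_le).trans (add_le_add_three ?_ hW1 ?_)
  · rw [← nsmul_eq_mul]
    refine norm_sum_le_of_le _ (fun h _ => ?_) |>.trans (Finset.sum_const a).le
    exact ha h (far h) (fun j hj => not_le.1 fun hle =>
      (Finset.mem_filter.1 hj).2 (mem_latBall.2 hle)) s
  · rw [← nsmul_eq_mul]
    exact (norm_sum_le_of_le _ fun h _ => hR1 h).trans (Finset.sum_const _).le

end CoreBound

section BoundedField

open Complex (I)

variable {d : ℕ}

theorem sum_closePairs_sub_eq (Λ : Finset (Fin d → ℤ)) (m : ℕ) (c : (Fin d → ℤ) → ℝ) :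
    ∑ q ∈ closePairs Λ m, c (q.2 - q.1) =
      ∑ k ∈ latBall m 0, ((Λ.card : ℝ) - exitCard Λ k) * c k := by
  classical
  rw [← Finset.sum_fiberwise_of_maps_to (t := latBall m 0)
    (g := fun q : (Fin d → ℤ) × (Fin d → ℤ) => q.2 - q.1) fun q hq => ?_]
  · refine Finset.sum_congr rfl fun k hk => ?_
    have h1 : ((closePairs Λ m).filter fun q => q.2 - q.1 = k).card =
        (Λ.filter fun h => h + k ∈ Λ).card := by
      refine Finset.card_bij' (fun q _ => q.1) (fun h _ => (h, h + k)) ?_ ?_ ?_ ?_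
      · intro q hq
        simp only [closePairs, Finset.mem_filter, Finset.mem_product] at hq ⊢
        refine ⟨hq.1.1.1, ?_⟩
        rw [← hq.2, add_sub_cancel]
        exact hq.1.1.2
      · intro h hh
        simp only [closePairs, Finset.mem_filter, Finset.mem_product] at hh ⊢
        refine ⟨⟨hh, ?_⟩, by simp⟩
        rw [mem_latBall, latDist_eq_latDist_zero, add_sub_cancel_left]
        exact mem_latBall.1 hk
      · intro q hq
        simp only [closePairs, Finset.mem_filter, Finset.mem_product] at hq
        exact Prod.ext rfl (by simp [← hq.2])
      · intro h _
        rfl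
    have h2 : (Λ.filter fun h => h + k ∈ Λ).card + exitCard Λ k = Λ.card :=
      Finset.card_filter_add_card_filter_not (s := Λ) (fun h => h + k ∈ Λ)
    rw [Finset.sum_congr rfl fun q hq => by rw [(Finset.mem_filter.1 hq).2], Finset.sum_const,
      nsmul_eq_mul, h1, ← h2]
    push_cast
    ring
  · rw [mem_latBall, ← latDist_eq_latDist_zero]
    exact mem_latBall.1 (Finset.mem_filter.1 hq).2

theorem exitCard_le_card (Λ : Finset (Fin d → ℤ)) (k : Fin d → ℤ) : exitCard Λ k ≤ Λ.card :=
  Finset.card_filter_le _ _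

theorem tendsto_sum_closePairs_div {Λ : ℕ → Finset (Fin d → ℤ)} {m : ℕ → ℕ}
    {c : (Fin d → ℤ) → ℝ} (hcs : Summable fun h => |c h|)
    (hΛ : Tendsto (fun n => (Λ n).card) atTop atTop)
    (hexit : ∀ k, Tendsto (fun n => (exitCard (Λ n) k : ℝ) / (Λ n).card) atTop (𝓝 0))
    (hm : Tendsto m atTop atTop) :
    Tendsto (fun n => (∑ q ∈ closePairs (Λ n) (m n), c (q.2 - q.1)) / (Λ n).card) atTop
      (𝓝 (∑' k, c k)) := by
  classical
  set f : ℕ → (Fin d → ℤ) → ℝ := fun n k => if k ∈ latBall (m n) 0 then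
    (1 - (exitCard (Λ n) k : ℝ) / (Λ n).card) * c k else 0 with hf
  have h0 : ∀ᶠ n in atTop, 1 ≤ (Λ n).card := hΛ.eventually_ge_atTop 1
  have h1 : (fun n => ∑' k, f n k) =ᶠ[atTop]
      fun n => (∑ q ∈ closePairs (Λ n) (m n), c (q.2 - q.1)) / (Λ n).card := by
    filter_upwards [h0] with n hn
    have hn' : ((Λ n).card : ℝ) ≠ 0 := by positivity
    rw [sum_closePairs_sub_eq, Finset.sum_div, tsum_eq_sum (s := latBall (m n) 0)
      fun k hk => if_neg hk]
    refine Finset.sum_congr rfl fun k hk => ?_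
    simp only [if_pos hk]
    field_simp
  refine Tendsto.congr' h1 (tendsto_tsum_of_dominated_convergence hcs (fun k => ?_) ?_)
  · have h2 : ∀ᶠ n in atTop, (1 - (exitCard (Λ n) k : ℝ) / (Λ n).card) * c k = f n k := by
      filter_upwards [hm.eventually_ge_atTop (latDist 0 k)] with n hn
      simp only [hf, if_pos (mem_latBall.2 hn)]
    refine Tendsto.congr' h2 ?_
    simpa using ((hexit k).const_sub 1).mul_const (c k)
  · filter_upwards with n k
    simp only [hf]
    split_ifs
    · rw [norm_mul, Real.norm_eq_abs, Real.norm_eq_abs]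
      refine mul_le_of_le_one_left (abs_nonneg _) ?_
      have h3 : (exitCard (Λ n) k : ℝ) / (Λ n).card ≤ 1 :=
        div_le_one_of_le₀ (by exact_mod_cast exitCard_le_card _ _) (Nat.cast_nonneg _)
      have h4 : 0 ≤ (exitCard (Λ n) k : ℝ) / (Λ n).card := by positivity
      rw [abs_of_nonneg (by linarith)]
      linarith
    · simp

theorem exists_tendsto_atTop_pow_le (hd : 0 < d) {x : ℕ → ℝ} (hx0 : ∀ n, 0 ≤ x n)
    (hx : Tendsto x atTop atTop) : ∃ m : ℕ → ℕ, Tendsto m atTop atTop ∧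
      ∀ n, (m n : ℝ) ^ d ≤ x n ∧ x n ≤ ((m n + 1 : ℕ) : ℝ) ^ d := by
  have hd' : (0 : ℝ) < (d : ℝ)⁻¹ := by positivity
  refine ⟨fun n => ⌊x n ^ (d : ℝ)⁻¹⌋₊,
    tendsto_nat_floor_atTop.comp ((tendsto_rpow_atTop hd').comp hx), fun n => ?_⟩
  have h : (x n ^ (d : ℝ)⁻¹) ^ d = x n := Real.rpow_inv_natCast_pow (hx0 n) hd.ne'
  have h0 : 0 ≤ x n ^ (d : ℝ)⁻¹ := Real.rpow_nonneg (hx0 n) _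
  refine ⟨(pow_le_pow_left₀ (Nat.cast_nonneg _) (Nat.floor_le h0) d).trans h.le,
    h.symm.le.trans (pow_le_pow_left₀ h0 ?_ d)⟩
  push_cast
  exact (Nat.lt_floor_add_one _).le

variable {Ω : Type*} [MeasurableSpace Ω] {P : Measure Ω} [IsProbabilityMeasure P]

theorem hasDerivAt_integral_cexp {W : Ω → ℝ} (hW : Measurable W) (hWi : Integrable W P) (t : ℝ) :
    HasDerivAt (fun t : ℝ => ∫ ω, Complex.exp (I * ((t * W ω : ℝ) : ℂ)) ∂P)
      (∫ ω, I * (W ω : ℂ) * Complex.exp (I * ((t * W ω : ℝ) : ℂ)) ∂P) t := by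
  have hexp : ∀ x : ℝ, ‖Complex.exp (I * (x : ℂ))‖ = 1 := Complex.norm_exp_I_mul_ofReal
  refine (hasDerivAt_integral_of_dominated_loc_of_deriv_le (s := Set.univ)
    (F := fun (t : ℝ) ω => Complex.exp (I * ((t * W ω : ℝ) : ℂ)))
    (F' := fun (t : ℝ) ω => I * (W ω : ℂ) * Complex.exp (I * ((t * W ω : ℝ) : ℂ)))
    (bound := fun ω => |W ω|) univ_mem
    (.of_forall fun x => Measurable.aestronglyMeasurable (by fun_prop))
    (Integrable.of_bound (Measurable.aestronglyMeasurable (by fun_prop)) 1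
      (.of_forall fun ω => (hexp _).le))
    (Measurable.aestronglyMeasurable (by fun_prop)) (.of_forall fun ω x _ => ?_) hWi.abs
    (.of_forall fun ω x _ => ?_)).2
  · simp only [norm_mul, hexp, Complex.norm_I, Complex.norm_real, Real.norm_eq_abs, one_mul,
      mul_one, le_refl]
  · have h1 : HasDerivAt (fun x : ℝ => I * ((x * W ω : ℝ) : ℂ)) (I * (W ω : ℂ)) x := by
      simpa using (((hasDerivAt_id x).mul_const (W ω)).ofReal_comp).const_mul I
    simpa [mul_comm] using h1.cexp

theorem continuous_integral_mul_cexp {W : Ω → ℝ} (hW : Measurable W) (hWi : Integrable W P) :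
    Continuous fun t : ℝ => ∫ ω, I * (W ω : ℂ) * Complex.exp (I * ((t * W ω : ℝ) : ℂ)) ∂P := by
  have hexp : ∀ x : ℝ, ‖Complex.exp (I * (x : ℂ))‖ = 1 := Complex.norm_exp_I_mul_ofReal
  refine continuous_of_dominated (bound := fun ω => |W ω|)
    (fun t => Measurable.aestronglyMeasurable (by fun_prop)) (fun t => .of_forall fun ω => ?_)
    hWi.abs (.of_forall fun ω => by fun_prop)
  simp only [norm_mul, hexp, Complex.norm_I, Complex.norm_real, Real.norm_eq_abs, one_mul,
    mul_one, le_refl]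

/-- An asymptotic Stein equation forces the characteristic functions to converge to the Gaussian
one. -/
theorem tendsto_integral_cexp_of_stein {W : ℕ → Ω → ℝ} {B v : ℝ} (hW : ∀ n, Measurable (W n))
    (hWi : ∀ n, Integrable (W n) P) (hWB : ∀ n, ∫ ω, |W n ω| ∂P ≤ B)
    (hst : ∀ t : ℝ, Tendsto (fun n => ∫ ω, ((W n ω : ℂ) - I * t * (v : ℂ)) *
      Complex.exp (I * ((t * W n ω : ℝ) : ℂ)) ∂P) atTop (𝓝 0)) (t : ℝ) :
    Tendsto (fun n => ∫ ω, Complex.exp (I * ((t * W n ω : ℝ) : ℂ)) ∂P) atTop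
      (𝓝 (Complex.exp (-((v * t ^ 2 / 2 : ℝ) : ℂ)))) := by
  have hexp : ∀ x : ℝ, ‖Complex.exp (I * (x : ℂ))‖ = 1 := Complex.norm_exp_I_mul_ofReal
  have hei : ∀ n (t : ℝ), Integrable (fun ω => Complex.exp (I * ((t * W n ω : ℝ) : ℂ))) P :=
    fun n t => Integrable.of_bound (Measurable.aestronglyMeasurable (by fun_prop)) 1
      (.of_forall fun ω => (hexp _).le)
  have hWe : ∀ n (t : ℝ), Integrable (fun ω => (W n ω : ℂ) *
      Complex.exp (I * ((t * W n ω : ℝ) : ℂ))) P := fun n t =>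
    (hWi n).ofReal.mul_bdd (c := 1) (Measurable.aestronglyMeasurable (by fun_prop))
      (.of_forall fun ω => (hexp _).le)
  set φ : ℕ → ℝ → ℂ := fun n t => ∫ ω, Complex.exp (I * ((t * W n ω : ℝ) : ℂ)) ∂P with hφ
  set φ' : ℕ → ℝ → ℂ := fun n t =>
    ∫ ω, I * (W n ω : ℂ) * Complex.exp (I * ((t * W n ω : ℝ) : ℂ)) ∂P with hφ'
  set D : ℕ → ℝ → ℂ := fun n t => ∫ ω, ((W n ω : ℂ) - I * t * (v : ℂ)) *
    Complex.exp (I * ((t * W n ω : ℝ) : ℂ)) ∂P with hD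
  set g : ℝ → ℂ := fun t => Complex.exp ((v * t ^ 2 / 2 : ℝ) : ℂ) with hg
  have hDφ : ∀ n t, I * D n t = φ' n t + t * v * φ n t := by
    intro n t
    have h1 : Integrable (fun ω => I * t * (v : ℂ) *
      Complex.exp (I * ((t * W n ω : ℝ) : ℂ))) P := (hei n t).const_mul _
    simp only [hD, hφ', hφ, sub_mul]
    rw [integral_sub (hWe n t) h1, integral_const_mul]
    simp only [mul_assoc I]
    rw [integral_const_mul, mul_sub, ← mul_assoc I I, Complex.I_mul_I]
    ring
  have hgd : ∀ t, HasDerivAt g (g t * (t * v)) t := by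
    intro t
    have h1 : HasDerivAt (fun t : ℝ => v * t ^ 2 / 2) (v * t) t := by
      have := ((hasDerivAt_pow 2 t).const_mul v).div_const 2
      refine this.congr_deriv ?_
      simp
      ring
    have := h1.ofReal_comp.cexp
    refine this.congr_deriv ?_
    simp only [hg]
    push_cast
    ring
  have hgc : Continuous g := by fun_prop
  have hφc : ∀ n, Continuous (φ n) := fun n => continuous_iff_continuousAt.2 fun t =>
    (hasDerivAt_integral_cexp (hW n) (hWi n) t).continuousAt
  have hφ'c : ∀ n, Continuous (φ' n) := fun n => continuous_integral_mul_cexp (hW n) (hWi n)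
  have hFTC : ∀ n, g t * φ n t - 1 = ∫ s in (0 : ℝ)..t, g s * (I * D n s) := by
    intro n
    rw [intervalIntegral.integral_eq_sub_of_hasDerivAt (f := fun s => g s * φ n s)]
    · simp [hg, hφ]
    · intro s _
      refine ((hgd s).mul (hasDerivAt_integral_cexp (hW n) (hWi n) s)).congr_deriv ?_
      rw [hDφ]
      ring
    · refine Continuous.intervalIntegrable ?_ _ _
      simp only [hDφ]
      exact hgc.mul ((hφ'c n).add ((by fun_prop : Continuous fun s : ℝ => (s : ℂ) * v).mul (hφc n)))
  have hgt : ∀ s, ‖g s‖ = Real.exp (v * s ^ 2 / 2) := fun s => by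
    rw [hg]
    exact Complex.norm_exp_ofReal _
  have hDb : ∀ n s, ‖D n s‖ ≤ B + |s| * |v| := by
    intro n s
    refine (norm_integral_le_of_norm_le (g := fun ω => |W n ω| + |s| * |v|)
      ((hWi n).abs.add (integrable_const _)) (.of_forall fun ω => ?_)).trans ?_
    · rw [norm_mul, hexp, mul_one]
      refine (norm_sub_le _ _).trans (add_le_add (Complex.norm_real _).le ?_)
      simp
    · rw [integral_add (hWi n).abs (integrable_const _)]
      simpa using hWB n
  have hlim : Tendsto (fun n => ∫ s in (0 : ℝ)..t, g s * (I * D n s)) atTop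
      (𝓝 (∫ s in (0 : ℝ)..t, (0 : ℂ))) := by
    refine intervalIntegral.tendsto_integral_filter_of_dominated_convergence
      (fun _ => Real.exp (|v| * |t| ^ 2 / 2) * (B + |t| * |v|)) (.of_forall fun n => ?_)
      (.of_forall fun n => .of_forall fun s hs => ?_) (by simp) (.of_forall fun s _ => ?_)
    · refine Continuous.aestronglyMeasurable ?_
      simp only [hDφ]
      exact hgc.mul ((hφ'c n).add ((by fun_prop : Continuous fun s : ℝ => (s : ℂ) * v).mul (hφc n)))
    · have hst' : |s| ≤ |t| := by
        rcases Set.mem_uIoc.1 hs with h | h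
        · rw [abs_of_pos h.1, abs_of_pos (h.1.trans_le h.2)]
          exact h.2
        · rw [abs_of_nonpos h.2, abs_of_neg (h.1.trans_le h.2)]
          linarith [h.1]
      rw [norm_mul, norm_mul, Complex.norm_I, one_mul, hgt]
      refine mul_le_mul (Real.exp_le_exp.2 ?_) ((hDb n s).trans ?_) (norm_nonneg _)
        (Real.exp_pos _).le
      · rw [← sq_abs s]
        have h1 : |s| ^ 2 ≤ |t| ^ 2 := pow_le_pow_left₀ (abs_nonneg s) hst' 2
        have h2 : v * |s| ^ 2 ≤ |v| * |t| ^ 2 :=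
          mul_le_mul (le_abs_self v) h1 (by positivity) (abs_nonneg v)
        linarith
      · have := mul_le_mul_of_nonneg_right hst' (abs_nonneg v)
        linarith
    · have h := ((hst s).const_mul I).const_mul (g s)
      rw [mul_zero, mul_zero] at h
      exact h
  have hg0 : g t ≠ 0 := Complex.exp_ne_zero _
  have hfin : Tendsto (fun n => (g t)⁻¹ * ((∫ s in (0 : ℝ)..t, g s * (I * D n s)) + 1)) atTop
      (𝓝 ((g t)⁻¹ * ((∫ s in (0 : ℝ)..t, (0 : ℂ)) + 1))) := (hlim.add_const 1).const_mul _
  rw [intervalIntegral.integral_zero, zero_add, mul_one] at hfin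
  have hgi : (g t)⁻¹ = Complex.exp (-((v * t ^ 2 / 2 : ℝ) : ℂ)) := (Complex.exp_neg _).symm
  rw [← hgi]
  refine hfin.congr fun n => ?_
  rw [← hFTC]
  field_simp
  ring

end BoundedField

section BoundedCLT

open Complex (I)

variable {d : ℕ} {Ω : Type*} [MeasurableSpace Ω] {P : Measure Ω} [IsProbabilityMeasure P]

/-- The normalized form of `norm_integral_stein_le`. -/
theorem norm_integral_stein_normalized_le {Y : (Fin d → ℤ) → Ω → ℝ} {b c : (Fin d → ℤ) → ℝ}
    {C a : ℝ} {m : ℕ}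
    (hY : ∀ h, Measurable (Y h)) (hYC : ∀ h ω, |Y h ω| ≤ C)
    (hc : ∀ h j, ∫ ω, Y h ω * Y j ω ∂P = c (j - h)) (hcs : Summable fun h => |c h|)
    (hb : ∀ h, 0 ≤ b h) (hbs : Summable b)
    (hcov : ∀ h j h' j', |cov P (fun ω => Y h ω * Y j ω) (fun ω => Y h' ω * Y j' ω)| ≤
      b (h' - h) + b (j' - h) + b (h' - j) + b (j' - j))
    (ha : ∀ (h : Fin d → ℤ) (T : Finset (Fin d → ℤ)), (∀ j ∈ T, m < latDist h j) → ∀ s : ℝ,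
      ‖∫ ω, (Y h ω : ℂ) * Complex.exp (I * ((s * ∑ j ∈ T, Y j ω : ℝ) : ℂ)) ∂P‖ ≤ a)
    {Λ : Finset (Fin d → ℤ)} (hΛ : 0 < Λ.card) (v t : ℝ) :
    ‖∫ ω, ((((∑ h ∈ Λ, Y h ω) / √Λ.card : ℝ) : ℂ) - I * t * (v : ℂ)) *
      Complex.exp (I * ((t * ((∑ j ∈ Λ, Y j ω) / √Λ.card) : ℝ) : ℂ)) ∂P‖ ≤
      √Λ.card * a + (|t| * √(4 * ∑' h, b h) + 3 * C * t ^ 2 * ∑' h, |c h|) *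
        (((2 * m + 1 : ℕ) ^ d : ℕ) / √Λ.card) +
      |t| * |(∑ q ∈ closePairs Λ m, c (q.2 - q.1)) / Λ.card - v| := by
  set r : ℝ := √Λ.card with hr
  have hN : (0 : ℝ) < Λ.card := by exact_mod_cast hΛ
  have hr0 : 0 < r := Real.sqrt_pos.2 hN
  have hrr : (Λ.card : ℝ) = r ^ 2 := (Real.sq_sqrt hN.le).symm
  set M : ℕ := (2 * m + 1 : ℕ) ^ d with hM
  set A : ℝ := ∑ q ∈ closePairs Λ m, c (q.2 - q.1) with hA
  have hexp : ∀ x : ℝ, ‖Complex.exp (I * (x : ℂ))‖ = 1 := Complex.norm_exp_I_mul_ofReal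
  have hSi : Integrable (fun ω => ∑ h ∈ Λ, Y h ω) P := integrable_finsetSum _ fun h _ =>
    Integrable.of_bound (hY h).aestronglyMeasurable C (.of_forall (hYC h))
  have key := norm_integral_stein_le hY hYC hc hcs hb hbs hcov ha Λ (t / r)
  rw [← hM, ← hA] at key
  have hsplit : ∀ ω, ((((∑ h ∈ Λ, Y h ω) / r : ℝ) : ℂ) - I * t * (v : ℂ)) *
      Complex.exp (I * ((t * ((∑ j ∈ Λ, Y j ω) / r) : ℝ) : ℂ)) =
      (r : ℂ)⁻¹ * ((((∑ h ∈ Λ, Y h ω : ℝ) : ℂ) - I * ((t / r : ℝ) : ℂ) * (A : ℂ)) *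
        Complex.exp (I * ((t / r * ∑ j ∈ Λ, Y j ω : ℝ) : ℂ))) +
      I * t * ((A / Λ.card - v : ℝ) : ℂ) *
        Complex.exp (I * ((t / r * ∑ j ∈ Λ, Y j ω : ℝ) : ℂ)) := by
    intro ω
    have hrc : (r : ℂ) ≠ 0 := by exact_mod_cast hr0.ne'
    rw [show t * ((∑ j ∈ Λ, Y j ω) / r) = t / r * ∑ j ∈ Λ, Y j ω by ring, hrr, ← mul_assoc,
      ← add_mul]
    congr 1
    push_cast
    field_simp
    ring
  have hi1 : Integrable (fun ω => (r : ℂ)⁻¹ * ((((∑ h ∈ Λ, Y h ω : ℝ) : ℂ) -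
      I * ((t / r : ℝ) : ℂ) * (A : ℂ)) *
        Complex.exp (I * ((t / r * ∑ j ∈ Λ, Y j ω : ℝ) : ℂ)))) P :=
    ((hSi.ofReal.sub (integrable_const _)).mul_bdd (c := 1)
      (Measurable.aestronglyMeasurable (by fun_prop)) (.of_forall fun ω => (hexp _).le)).const_mul _
  have hi2 : Integrable (fun ω => I * t * ((A / Λ.card - v : ℝ) : ℂ) *
        Complex.exp (I * ((t / r * ∑ j ∈ Λ, Y j ω : ℝ) : ℂ))) P :=
    (Integrable.of_bound (Measurable.aestronglyMeasurable (by fun_prop)) 1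
      (.of_forall fun ω => (hexp _).le)).const_mul _
  rw [integral_congr_ae (.of_forall hsplit), integral_add hi1 hi2, integral_const_mul]
  refine (norm_add_le _ _).trans (add_le_add ?_ ?_)
  · rw [norm_mul, norm_inv, Complex.norm_real, Real.norm_of_nonneg hr0.le]
    refine (mul_le_mul_of_nonneg_left key (inv_nonneg.2 hr0.le)).trans (le_of_eq ?_)
    have hB : 0 ≤ 4 * ∑' h, b h := mul_nonneg (by norm_num) (tsum_nonneg hb)
    clear_value r M
    rw [hrr, Real.sqrt_mul (mul_nonneg (sq_nonneg r) hB), Real.sqrt_mul (sq_nonneg r),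
      Real.sqrt_sq hr0.le, Real.sqrt_sq (Nat.cast_nonneg M), abs_div, abs_of_pos hr0]
    field_simp
    ring
  · refine (norm_integral_le_of_norm_le_const (C := |t| * |A / Λ.card - v|)
      (.of_forall fun ω => ?_)).trans (by simp)
    rw [norm_mul, norm_mul, norm_mul, hexp, Complex.norm_I, Complex.norm_real, Complex.norm_real,
      one_mul, mul_one, Real.norm_eq_abs, Real.norm_eq_abs]

theorem integral_abs_sum_div_sqrt_le {Y : (Fin d → ℤ) → Ω → ℝ} {c : (Fin d → ℤ) → ℝ}
    (hY : ∀ h, Integrable (Y h) P) (hYY : ∀ h j, Integrable (fun ω => Y h ω * Y j ω) P)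
    (hc : ∀ h j, ∫ ω, Y h ω * Y j ω ∂P = c (j - h)) (hcs : Summable fun h => |c h|)
    (Λ : Finset (Fin d → ℤ)) :
    ∫ ω, |(∑ h ∈ Λ, Y h ω) / √Λ.card| ∂P ≤ √(∑' h, |c h|) := by
  have hA : 0 ≤ ∑' h, |c h| := tsum_nonneg fun _ => abs_nonneg _
  have hi : Integrable (fun ω => ∑ h ∈ Λ, Y h ω) P := integrable_finsetSum _ fun h _ => hY h
  have hi2 : Integrable (fun ω => (∑ h ∈ Λ, Y h ω) ^ 2) P := by
    simp only [sq, Finset.sum_mul_sum]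
    exact integrable_finsetSum _ fun q _ => integrable_finsetSum _ fun q' _ => hYY q q'
  simp only [abs_div, abs_of_nonneg (Real.sqrt_nonneg _)]
  rw [integral_div]
  refine div_le_of_le_mul₀ (Real.sqrt_nonneg _) (Real.sqrt_nonneg _) ?_
  rw [← Real.sqrt_mul hA, mul_comm]
  exact (integral_abs_le_sqrt hi hi2).trans (Real.sqrt_le_sqrt (integral_sq_sum_le hYY hc hcs Λ))

/-- The central limit theorem, in terms of characteristic functions, for bounded fields. -/
theorem tendsto_integral_cexp_of_bounded (hd : 0 < d) {Y : (Fin d → ℤ) → Ω → ℝ}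
    {b c : (Fin d → ℤ) → ℝ} {C : ℝ} {a : ℕ → ℝ}
    (hY : ∀ h, Measurable (Y h)) (hYC : ∀ h ω, |Y h ω| ≤ C)
    (hc : ∀ h j, ∫ ω, Y h ω * Y j ω ∂P = c (j - h)) (hcs : Summable fun h => |c h|)
    (hb : ∀ h, 0 ≤ b h) (hbs : Summable b)
    (hcov : ∀ h j h' j', |cov P (fun ω => Y h ω * Y j ω) (fun ω => Y h' ω * Y j' ω)| ≤
      b (h' - h) + b (j' - h) + b (h' - j) + b (j' - j))
    (ha : ∀ (m : ℕ) (h : Fin d → ℤ) (T : Finset (Fin d → ℤ)), (∀ j ∈ T, m < latDist h j) →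
      ∀ s : ℝ,
      ‖∫ ω, (Y h ω : ℂ) * Complex.exp (I * ((s * ∑ j ∈ T, Y j ω : ℝ) : ℂ)) ∂P‖ ≤ a m)
    (ha0 : Tendsto (fun m : ℕ => ((m + 1 : ℕ) : ℝ) ^ d * a m) atTop (𝓝 0))
    {Λ : ℕ → Finset (Fin d → ℤ)} (hΛ : Tendsto (fun n => (Λ n).card) atTop atTop)
    (hexit : ∀ k, Tendsto (fun n => (exitCard (Λ n) k : ℝ) / (Λ n).card) atTop (𝓝 0)) (t : ℝ) :
    Tendsto (fun n => ∫ ω,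
        Complex.exp (I * ((t * ((∑ h ∈ Λ n, Y h ω) / √(Λ n).card) : ℝ) : ℂ)) ∂P) atTop
      (𝓝 (Complex.exp (-(((∑' k, c k) * t ^ 2 / 2 : ℝ) : ℂ)))) := by
  obtain ⟨ω₀⟩ := P.nonempty_of_neZero
  have hC : 0 ≤ C := (abs_nonneg _).trans (hYC 0 ω₀)
  have hYi : ∀ h, Integrable (Y h) P := fun h =>
    Integrable.of_bound (hY h).aestronglyMeasurable C (.of_forall (hYC h))
  have hYY : ∀ h j, Integrable (fun ω => Y h ω * Y j ω) P := fun h j =>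
    (hYi j).bdd_mul (hY h).aestronglyMeasurable (.of_forall (hYC h))
  refine tendsto_integral_cexp_of_stein (W := fun n ω => (∑ h ∈ Λ n, Y h ω) / √(Λ n).card)
    (fun n => (Finset.measurable_fun_sum _ fun j _ => hY j).div_const _)
    (fun n => (integrable_finsetSum _ fun h _ => hYi h).div_const _)
    (fun n => integral_abs_sum_div_sqrt_le hYi hYY hc hcs (Λ n)) (fun t => ?_) t
  rw [NormedAddGroup.tendsto_nhds_zero]
  intro ε hε
  set K : ℝ := 3 ^ d * (|t| * √(4 * ∑' h, b h) + 3 * C * t ^ 2 * ∑' h, |c h|) with hK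
  have hA : 0 ≤ ∑' h, |c h| := tsum_nonneg fun _ => abs_nonneg _
  have hK0 : 0 ≤ K := by positivity
  set η : ℝ := ε / (2 * (K + 1)) with hη
  have hη0 : 0 < η := by positivity
  have hsq : Tendsto (fun n => √((Λ n).card : ℝ)) atTop atTop :=
    Real.tendsto_sqrt_atTop.comp (tendsto_natCast_atTop_atTop.comp hΛ)
  obtain ⟨m, hm, hmb⟩ := exists_tendsto_atTop_pow_le hd (x := fun n => η * √((Λ n).card : ℝ))
    (fun n => by positivity) (hsq.const_mul_atTop hη0)
  have h1 : ∀ᶠ n in atTop, ((m n + 1 : ℕ) : ℝ) ^ d * a (m n) < η * (ε / 4) :=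
    (ha0.comp hm).eventually_lt_const (by positivity)
  have h2 : Tendsto (fun n => |t| * |(∑ q ∈ closePairs (Λ n) (m n), c (q.2 - q.1)) / (Λ n).card -
      ∑' k, c k|) atTop (𝓝 0) := by
    have := (((tendsto_sum_closePairs_div hcs hΛ hexit hm).sub_const (∑' k, c k)).abs).const_mul |t|
    simpa using this
  filter_upwards [h1, h2.eventually_lt_const (by positivity : (0 : ℝ) < ε / 4),
    hΛ.eventually_ge_atTop 1, hm.eventually_ge_atTop 1] with n hn1 hn2 hn3 hn4
  refine (norm_integral_stein_normalized_le hY hYC hc hcs hb hbs hcov (ha (m n)) hn3 _ t).trans_lt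
    ?_
  have hr : 0 < √((Λ n).card : ℝ) := Real.sqrt_pos.2 (by exact_mod_cast hn3)
  have ha' : 0 ≤ a (m n) := (norm_nonneg _).trans (ha (m n) 0 ∅ (by simp) 0)
  have h3 : √((Λ n).card : ℝ) * a (m n) < ε / 4 := by
    refine lt_of_mul_lt_mul_left ?_ hη0.le
    rw [← mul_assoc]
    exact (mul_le_mul_of_nonneg_right (hmb n).2 ha').trans_lt hn1
  have h4 : (((2 * m n + 1 : ℕ) ^ d : ℕ) : ℝ) / √((Λ n).card : ℝ) ≤ 3 ^ d * η := by
    rw [div_le_iff₀ hr, mul_assoc]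
    refine le_trans ?_ (mul_le_mul_of_nonneg_left (hmb n).1 (by positivity))
    rw [← mul_pow]
    push_cast
    refine pow_le_pow_left₀ (by positivity) ?_ d
    have : (1 : ℝ) ≤ m n := by exact_mod_cast hn4
    linarith
  have h5 : (|t| * √(4 * ∑' h, b h) + 3 * C * t ^ 2 * ∑' h, |c h|) *
      ((((2 * m n + 1 : ℕ) ^ d : ℕ) : ℝ) / √((Λ n).card : ℝ)) ≤ K * η := by
    refine (mul_le_mul_of_nonneg_left h4 (by positivity)).trans (le_of_eq ?_)
    rw [hK]
    ring
  have h6 : K * η ≤ ε / 2 := by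
    rw [hη, ← mul_div_assoc, div_le_div_iff₀ (by positivity) two_pos]
    nlinarith
  linarith

end BoundedCLT

section MixingCLT

open Complex (I)

variable {d : ℕ} {Ω : Type*} [MeasurableSpace Ω] {P : Measure Ω} [IsProbabilityMeasure P]

theorem abs_cov_mul_mul_le {Y : (Fin d → ℤ) → Ω → ℝ} {C : ℝ} (hY : ∀ h, Measurable (Y h))
    (hYC : ∀ h ω, |Y h ω| ≤ C) (h j h' j' : Fin d → ℤ) :
    |cov P (fun ω => Y h ω * Y j ω) (fun ω => Y h' ω * Y j' ω)| ≤
      4 * (C * C) * (C * C) * alphaKL P Y 2 2 (latDist 0 (h' - h)) +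
      4 * (C * C) * (C * C) * alphaKL P Y 2 2 (latDist 0 (j' - h)) +
      4 * (C * C) * (C * C) * alphaKL P Y 2 2 (latDist 0 (h' - j)) +
      4 * (C * C) * (C * C) * alphaKL P Y 2 2 (latDist 0 (j' - j)) := by
  simp only [← latDist_eq_latDist_zero]
  have hbd : ∀ h j, ∀ ω, |Y h ω * Y j ω| ≤ C * C := fun h j ω => by
    rw [abs_mul]
    exact mul_le_mul (hYC h ω) (hYC j ω) (abs_nonneg _) ((abs_nonneg _).trans (hYC h ω))
  have hpair : ∀ x y : Fin d → ℤ, ({x, y} : Set (Fin d → ℤ)).encard ≤ 2 := fun x y => by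
    refine (Set.encard_insert_le _ _).trans ?_
    rw [Set.encard_singleton, one_add_one_eq_two]
  have key : ∀ m, m ≤ latDist h h' → m ≤ latDist h j' → m ≤ latDist j h' → m ≤ latDist j j' →
      |cov P (fun ω => Y h ω * Y j ω) (fun ω => Y h' ω * Y j' ω)| ≤
        4 * (C * C) * (C * C) * alphaKL P Y 2 2 m := by
    intro m h1 h2 h3 h4
    refine abs_cov_le_alphaKL hY (S₁ := {h, j}) (S₂ := {h', j'}) (hpair h j) (hpair h' j') ?_ ?_ ?_ (hbd h j) (hbd h' j')
    · rintro x (rfl | rfl) y (rfl | rfl) <;> assumption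
    · exact (measurable_sigmaGen Y (by simp)).mul (measurable_sigmaGen Y (by simp))
    · exact (measurable_sigmaGen Y (by simp)).mul (measurable_sigmaGen Y (by simp))
  have h0 : ∀ m, 0 ≤ 4 * (C * C) * (C * C) * alphaKL P Y 2 2 m := fun m =>
    mul_nonneg (mul_nonneg (mul_nonneg (by norm_num) (mul_self_nonneg C)) (mul_self_nonneg C))
      (alphaKL_nonneg _ _ _ _)
  have g1 := h0 (latDist h h')
  have g2 := h0 (latDist h j')
  have g3 := h0 (latDist j h')
  have g4 := h0 (latDist j j')
  rcases le_total (latDist h h') (latDist h j') with a1 | a1 <;>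
  rcases le_total (latDist j h') (latDist j j') with a2 | a2
  · rcases le_total (latDist h h') (latDist j h') with a3 | a3
    · linarith [key _ le_rfl a1 a3 (a3.trans a2)]
    · linarith [key _ a3 (a3.trans a1) le_rfl a2]
  · rcases le_total (latDist h h') (latDist j j') with a3 | a3
    · linarith [key _ le_rfl a1 (a3.trans a2) a3]
    · linarith [key _ a3 (a3.trans a1) a2 le_rfl]
  · rcases le_total (latDist h j') (latDist j h') with a3 | a3
    · linarith [key _ a1 le_rfl a3 (a3.trans a2)]
    · linarith [key _ (a3.trans a1) a3 le_rfl a2]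
  · rcases le_total (latDist h j') (latDist j j') with a3 | a3
    · linarith [key _ a1 le_rfl (a3.trans a2) a3]
    · linarith [key _ (a3.trans a1) a3 a2 le_rfl]

theorem norm_integral_mul_cexp_far_le {Y : (Fin d → ℤ) → Ω → ℝ} {C : ℝ}
    (hY : ∀ h, Measurable (Y h)) (hYC : ∀ h ω, |Y h ω| ≤ C) (hmean : ∀ h, ∫ ω, Y h ω ∂P = 0)
    {m : ℕ} {h : Fin d → ℤ} {T : Finset (Fin d → ℤ)} (hT : ∀ j ∈ T, m ≤ latDist h j) (s : ℝ) :
    ‖∫ ω, (Y h ω : ℂ) * Complex.exp (I * ((s * ∑ j ∈ T, Y j ω : ℝ) : ℂ)) ∂P‖ ≤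
      8 * C * alphaKL P Y 1 ⊤ m := by
  have hYi : Integrable (Y h) P :=
    Integrable.of_bound (hY h).aestronglyMeasurable C (.of_forall (hYC h))
  have key : ∀ g : ℝ → ℝ, Measurable g → (∀ x, |g x| ≤ 1) →
      |∫ ω, Y h ω * g (s * ∑ j ∈ T, Y j ω) ∂P| ≤ 4 * C * 1 * alphaKL P Y 1 ⊤ m := by
    intro g hg hg1
    have hS : Measurable[sigmaGen Y (T : Set (Fin d → ℤ))]
        (fun ω => g (s * ∑ j ∈ T, Y j ω)) :=
      hg.comp (Measurable.const_mul (Finset.measurable_fun_sum T fun j hj =>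
        measurable_sigmaGen Y (Finset.mem_coe.2 hj)) s)
    have := abs_cov_le_alphaKL (P := P) hY (k := 1) (l := ⊤) (m := m) (S₁ := {h})
      (S₂ := (T : Set (Fin d → ℤ))) (by simp) le_top
      (fun x hx y hy => by
        rw [Set.mem_singleton_iff.1 hx]
        exact hT y hy)
      (measurable_sigmaGen Y (Set.mem_singleton h)) hS (hYC h) fun ω => hg1 _
    rwa [cov, hmean, zero_mul, sub_zero] at this
  have hi : ∀ g : ℝ → ℝ, Measurable g → (∀ x, |g x| ≤ 1) →
      Integrable (fun ω => Y h ω * g (s * ∑ j ∈ T, Y j ω)) P := fun g hg hg1 =>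
    hYi.mul_bdd (c := 1) (hg.comp ((Finset.measurable_fun_sum T fun j _ =>
      hY j).const_mul s)).aestronglyMeasurable (.of_forall fun ω => hg1 _)
  have hpt : ∀ ω, (Y h ω : ℂ) * Complex.exp (I * ((s * ∑ j ∈ T, Y j ω : ℝ) : ℂ)) =
      ((Y h ω * Real.cos (s * ∑ j ∈ T, Y j ω) : ℝ) : ℂ) +
      I * ((Y h ω * Real.sin (s * ∑ j ∈ T, Y j ω) : ℝ) : ℂ) := by
    intro ω
    rw [mul_comm I, Complex.exp_mul_I, ← Complex.ofReal_cos, ← Complex.ofReal_sin]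
    push_cast
    ring
  have i1 := hi _ Real.measurable_cos Real.abs_cos_le_one
  have i2 := hi _ Real.measurable_sin Real.abs_sin_le_one
  have j1 : Integrable (fun ω => ((Y h ω * Real.cos (s * ∑ j ∈ T, Y j ω) : ℝ) : ℂ)) P := i1.ofReal
  have j2 : Integrable (fun ω => I * ((Y h ω * Real.sin (s * ∑ j ∈ T, Y j ω) : ℝ) : ℂ)) P :=
    i2.ofReal.const_mul I
  rw [integral_congr_ae (.of_forall hpt), integral_add j1 j2, integral_const_mul,
    integral_complex_ofReal, integral_complex_ofReal]
  refine (norm_add_le _ _).trans ?_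
  rw [norm_mul, Complex.norm_I, one_mul, Complex.norm_real, Complex.norm_real, Real.norm_eq_abs,
    Real.norm_eq_abs]
  linarith [key _ Real.measurable_cos Real.abs_cos_le_one,
    key _ Real.measurable_sin Real.abs_sin_le_one]

/-- The central limit theorem for bounded mixing fields, in terms of characteristic functions. -/
theorem tendsto_integral_cexp_of_mixing (hd : 0 < d) {Y : (Fin d → ℤ) → Ω → ℝ}
    {c : (Fin d → ℤ) → ℝ} {C : ℝ} (hY : ∀ h, Measurable (Y h)) (hYC : ∀ h ω, |Y h ω| ≤ C)
    (hmean : ∀ h, ∫ ω, Y h ω ∂P = 0)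
    (hc : ∀ h j, ∫ ω, Y h ω * Y j ω ∂P = c (j - h)) (hcs : Summable fun h => |c h|)
    (h22 : Summable fun m : ℕ => ((m + 1 : ℕ) : ℝ) ^ (d - 1) * alphaKL P Y 2 2 (m + 1))
    (htop : Tendsto (fun m : ℕ => (m : ℝ) ^ d * alphaKL P Y 1 ⊤ m) atTop (𝓝 0))
    {Λ : ℕ → Finset (Fin d → ℤ)} (hΛ : Tendsto (fun n => (Λ n).card) atTop atTop)
    (hexit : ∀ k, Tendsto (fun n => (exitCard (Λ n) k : ℝ) / (Λ n).card) atTop (𝓝 0)) (t : ℝ) :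
    Tendsto (fun n => ∫ ω,
        Complex.exp (I * ((t * ((∑ h ∈ Λ n, Y h ω) / √(Λ n).card) : ℝ) : ℂ)) ∂P) atTop
      (𝓝 (Complex.exp (-(((∑' k, c k) * t ^ 2 / 2 : ℝ) : ℂ)))) := by
  refine tendsto_integral_cexp_of_bounded hd (C := C)
    (b := fun k => 4 * (C * C) * (C * C) * alphaKL P Y 2 2 (latDist 0 k))
    (a := fun m => 8 * C * alphaKL P Y 1 ⊤ (m + 1)) hY hYC hc hcs
    (fun k => mul_nonneg (mul_nonneg (mul_nonneg (by norm_num) (mul_self_nonneg C))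
      (mul_self_nonneg C)) (alphaKL_nonneg _ _ _ _))
    ((summable_latDist (f := fun m => alphaKL P Y 2 2 m) (fun m => alphaKL_nonneg _ _ _ _) h22).mul_left _)
    (abs_cov_mul_mul_le hY hYC)
    (fun m h T hT s => norm_integral_mul_cexp_far_le hY hYC hmean hT s) ?_ hΛ hexit t
  have := ((tendsto_add_atTop_iff_nat 1).2 htop).const_mul (8 * C)
  rw [mul_zero] at this
  refine this.congr fun m => ?_
  ring

end MixingCLT

section StationaryField

open Complex (I)

variable {d : ℕ} {Ω : Type*} [MeasurableSpace Ω] {P : Measure Ω} [IsProbabilityMeasure P]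
  {X : (Fin d → ℤ) → Ω → ℝ}

theorem identDistrib_pair (hmeas : ∀ h, Measurable (X h))
    (hstat : ∀ (h₀ : Fin d → ℤ) (n : ℕ) (x : Fin n → (Fin d → ℤ)),
      Measure.map (fun ω i => X (x i + h₀) ω) P = Measure.map (fun ω i => X (x i) ω) P)
    (h j : Fin d → ℤ) :
    IdentDistrib (fun ω => (X h ω, X j ω)) (fun ω => (X 0 ω, X (j - h) ω)) P P := by
  have h1 : IdentDistrib (fun ω (i : Fin 2) => X (![0, j - h] i + h) ω)
      (fun ω i => X (![0, j - h] i) ω) P P :=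
    ⟨(measurable_pi_lambda _ fun i => hmeas _).aemeasurable,
      (measurable_pi_lambda _ fun i => hmeas _).aemeasurable, hstat h 2 ![0, j - h]⟩
  have h2 := h1.comp ((measurable_pi_apply (0 : Fin 2)).prodMk (measurable_pi_apply (1 : Fin 2)))
  simpa [Function.comp_def] using h2

theorem identDistrib_zero (hmeas : ∀ h, Measurable (X h))
    (hstat : ∀ (h₀ : Fin d → ℤ) (n : ℕ) (x : Fin n → (Fin d → ℤ)),
      Measure.map (fun ω i => X (x i + h₀) ω) P = Measure.map (fun ω i => X (x i) ω) P)
    (h : Fin d → ℤ) : IdentDistrib (X h) (X 0) P P :=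
  (identDistrib_pair hmeas hstat h h).comp measurable_fst

theorem integral_comp_eq_zero (hmeas : ∀ h, Measurable (X h))
    (hstat : ∀ (h₀ : Fin d → ℤ) (n : ℕ) (x : Fin n → (Fin d → ℤ)),
      Measure.map (fun ω i => X (x i + h₀) ω) P = Measure.map (fun ω i => X (x i) ω) P)
    {g : ℝ → ℝ} (hg : Measurable g) (h : Fin d → ℤ) :
    ∫ ω, g (X h ω) ∂P = ∫ ω, g (X 0 ω) ∂P :=
  ((identDistrib_zero hmeas hstat h).comp hg).integral_eq

theorem cov_comp_eq_zero_sub (hmeas : ∀ h, Measurable (X h))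
    (hstat : ∀ (h₀ : Fin d → ℤ) (n : ℕ) (x : Fin n → (Fin d → ℤ)),
      Measure.map (fun ω i => X (x i + h₀) ω) P = Measure.map (fun ω i => X (x i) ω) P)
    {g : ℝ → ℝ} (hg : Measurable g) (h j : Fin d → ℤ) :
    cov P (fun ω => g (X h ω)) (fun ω => g (X j ω)) =
      cov P (fun ω => g (X 0 ω)) (fun ω => g (X (j - h) ω)) := by
  have h1 := ((identDistrib_pair hmeas hstat h j).comp
    ((hg.comp measurable_fst).mul (hg.comp measurable_snd))).integral_eq
  simp only [cov]
  rw [integral_comp_eq_zero hmeas hstat hg h, integral_comp_eq_zero hmeas hstat hg j,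
    integral_comp_eq_zero hmeas hstat hg (j - h)]
  exact congrArg (· - _) h1

variable {δ : ℝ}

theorem integrable_rpow_comp (hmeas : ∀ h, Measurable (X h))
    (hstat : ∀ (h₀ : Fin d → ℤ) (n : ℕ) (x : Fin n → (Fin d → ℤ)),
      Measure.map (fun ω i => X (x i + h₀) ω) P = Measure.map (fun ω i => X (x i) ω) P)
    (hδ : 0 < δ) (hmom : Integrable (fun ω => |X 0 ω| ^ (2 + δ)) P)
    {g : ℝ → ℝ} (hg : Measurable g) (hgx : ∀ x, |g x| ≤ |x|) (h : Fin d → ℤ) :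
    Integrable (fun ω => |g (X h ω)| ^ (2 + δ)) P ∧
      ∫ ω, |g (X h ω)| ^ (2 + δ) ∂P ≤ ∫ ω, |X 0 ω| ^ (2 + δ) ∂P := by
  have hid := (identDistrib_zero hmeas hstat h).comp
    (by fun_prop : Measurable fun x : ℝ => |x| ^ (2 + δ))
  have h1 : Integrable (fun ω => |X h ω| ^ (2 + δ)) P := hid.integrable_iff.2 hmom
  have h2 : ∀ ω, |g (X h ω)| ^ (2 + δ) ≤ |X h ω| ^ (2 + δ) := fun ω =>
    Real.rpow_le_rpow (abs_nonneg _) (hgx _) (by linarith)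
  have h3 : Integrable (fun ω => |g (X h ω)| ^ (2 + δ)) P := by
    refine h1.mono' (Measurable.aestronglyMeasurable ?_) (.of_forall fun ω => ?_)
    · exact (by fun_prop : Measurable fun x : ℝ => |x| ^ (2 + δ)).comp (hg.comp (hmeas h))
    · rw [Real.norm_of_nonneg (Real.rpow_nonneg (abs_nonneg _) _)]
      exact h2 ω
  exact ⟨h3, (integral_mono h3 h1 h2).trans hid.integral_eq.le⟩

/-- Davydov's covariance inequality for functions of a stationary mixing field. -/
theorem abs_cov_comp_le (hmeas : ∀ h, Measurable (X h))
    (hstat : ∀ (h₀ : Fin d → ℤ) (n : ℕ) (x : Fin n → (Fin d → ℤ)),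
      Measure.map (fun ω i => X (x i + h₀) ω) P = Measure.map (fun ω i => X (x i) ω) P)
    (hδ : 0 < δ) (hmom : Integrable (fun ω => |X 0 ω| ^ (2 + δ)) P)
    {g : ℝ → ℝ} (hg : Measurable g) (hgx : ∀ x, |g x| ≤ |x|) (k : Fin d → ℤ) :
    |cov P (fun ω => g (X 0 ω)) (fun ω => g (X k ω))| ≤
      4 * (1 + ∫ ω, |X 0 ω| ^ (2 + δ) ∂P) * alphaKL P X 1 1 (latDist 0 k) ^ (δ / (2 + δ)) := by
  have h0 := integrable_rpow_comp hmeas hstat hδ hmom hg hgx 0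
  have hk := integrable_rpow_comp hmeas hstat hδ hmom hg hgx k
  refine abs_cov_le_rpow hδ (alphaKL_nonneg _ _ _ _) (hg.comp (hmeas 0)) (hg.comp (hmeas k))
    h0.1 hk.1 h0.2 hk.2 fun M hM => ?_
  refine abs_cov_le_alphaKL hmeas (S₁ := {0}) (S₂ := {k}) (by simp) (by simp) (by simp) ?_ ?_
    (fun ω => abs_trunc_le hM.le _) (fun ω => abs_trunc_le hM.le _)
  · exact ((measurable_trunc M).comp hg).comp (measurable_sigmaGen X (Set.mem_singleton _))
  · exact ((measurable_trunc M).comp hg).comp (measurable_sigmaGen X (Set.mem_singleton _))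

theorem summable_alphaKL_rpow (hiii : Summable (fun m : ℕ =>
      ((m + 1 : ℕ) : ℝ) ^ (d - 1) * alphaKL P X 1 1 (m + 1) ^ (δ / (2 + δ)))) :
    Summable fun k : Fin d → ℤ => alphaKL P X 1 1 (latDist 0 k) ^ (δ / (2 + δ)) :=
  summable_latDist (f := fun m => alphaKL P X 1 1 m ^ (δ / (2 + δ)))
    (fun _ => Real.rpow_nonneg (alphaKL_nonneg _ _ _ _) _) hiii

theorem summable_abs_cov_comp (hmeas : ∀ h, Measurable (X h))
    (hstat : ∀ (h₀ : Fin d → ℤ) (n : ℕ) (x : Fin n → (Fin d → ℤ)),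
      Measure.map (fun ω i => X (x i + h₀) ω) P = Measure.map (fun ω i => X (x i) ω) P)
    (hδ : 0 < δ) (hmom : Integrable (fun ω => |X 0 ω| ^ (2 + δ)) P)
    (hiii : Summable (fun m : ℕ =>
      ((m + 1 : ℕ) : ℝ) ^ (d - 1) * alphaKL P X 1 1 (m + 1) ^ (δ / (2 + δ))))
    {g : ℝ → ℝ} (hg : Measurable g) (hgx : ∀ x, |g x| ≤ |x|) :
    Summable fun k => |cov P (fun ω => g (X 0 ω)) (fun ω => g (X k ω))| :=
  Summable.of_nonneg_of_le (fun _ => abs_nonneg _)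
    (abs_cov_comp_le hmeas hstat hδ hmom hg hgx) ((summable_alphaKL_rpow hiii).mul_left _)

theorem integrable_comp_mul_comp (hmeas : ∀ h, Measurable (X h))
    (hstat : ∀ (h₀ : Fin d → ℤ) (n : ℕ) (x : Fin n → (Fin d → ℤ)),
      Measure.map (fun ω i => X (x i + h₀) ω) P = Measure.map (fun ω i => X (x i) ω) P)
    (hδ : 0 < δ) (hmom : Integrable (fun ω => |X 0 ω| ^ (2 + δ)) P)
    {g : ℝ → ℝ} (hg : Measurable g) (hgx : ∀ x, |g x| ≤ |x|) (h j : Fin d → ℤ) :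
    Integrable (fun ω => g (X h ω) * g (X j ω)) P :=
  integrable_mul_of_rpow (p := 2 + δ) (by linarith) (hg.comp (hmeas h)) (hg.comp (hmeas j))
    (integrable_rpow_comp hmeas hstat hδ hmom hg hgx h).1
    (integrable_rpow_comp hmeas hstat hδ hmom hg hgx j).1

theorem integrable_comp (hmeas : ∀ h, Measurable (X h))
    (hstat : ∀ (h₀ : Fin d → ℤ) (n : ℕ) (x : Fin n → (Fin d → ℤ)),
      Measure.map (fun ω i => X (x i + h₀) ω) P = Measure.map (fun ω i => X (x i) ω) P)
    (hδ : 0 < δ) (hmom : Integrable (fun ω => |X 0 ω| ^ (2 + δ)) P)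
    {g : ℝ → ℝ} (hg : Measurable g) (hgx : ∀ x, |g x| ≤ |x|) (h : Fin d → ℤ) :
    Integrable (fun ω => g (X h ω)) P :=
  integrable_of_rpow (p := 2 + δ) (by linarith) (hg.comp (hmeas h))
    (integrable_rpow_comp hmeas hstat hδ hmom hg hgx h).1

theorem integral_centered_comp_mul (hmeas : ∀ h, Measurable (X h))
    (hstat : ∀ (h₀ : Fin d → ℤ) (n : ℕ) (x : Fin n → (Fin d → ℤ)),
      Measure.map (fun ω i => X (x i + h₀) ω) P = Measure.map (fun ω i => X (x i) ω) P)
    (hδ : 0 < δ) (hmom : Integrable (fun ω => |X 0 ω| ^ (2 + δ)) P)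
    {g : ℝ → ℝ} (hg : Measurable g) (hgx : ∀ x, |g x| ≤ |x|) (h j : Fin d → ℤ) :
    Integrable (fun ω => (g (X h ω) - ∫ ω', g (X 0 ω') ∂P) *
      (g (X j ω) - ∫ ω', g (X 0 ω') ∂P)) P ∧
    ∫ ω, (g (X h ω) - ∫ ω', g (X 0 ω') ∂P) * (g (X j ω) - ∫ ω', g (X 0 ω') ∂P) ∂P =
      cov P (fun ω => g (X 0 ω)) (fun ω => g (X (j - h) ω)) := by
  have hi := integrable_comp hmeas hstat hδ hmom hg hgx
  have hij := integrable_comp_mul_comp hmeas hstat hδ hmom hg hgx h j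
  set u := ∫ ω', g (X 0 ω') ∂P with hu
  constructor
  · have : ∀ ω, (g (X h ω) - u) * (g (X j ω) - u) =
        g (X h ω) * g (X j ω) - u * g (X h ω) - u * g (X j ω) + u * u := fun ω => by ring
    simp only [this]
    exact ((hij.sub ((hi h).const_mul u)).sub ((hi j).const_mul u)).add (integrable_const _)
  · rw [← cov_comp_eq_zero_sub hmeas hstat hg h j, ← cov_eq_integral_centered (hi h) (hi j) hij,
      integral_comp_eq_zero hmeas hstat hg h, integral_comp_eq_zero hmeas hstat hg j]

theorem tendsto_cov_comp (hmeas : ∀ h, Measurable (X h))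
    (hstat : ∀ (h₀ : Fin d → ℤ) (n : ℕ) (x : Fin n → (Fin d → ℤ)),
      Measure.map (fun ω i => X (x i + h₀) ω) P = Measure.map (fun ω i => X (x i) ω) P)
    (hδ : 0 < δ) (hmom : Integrable (fun ω => |X 0 ω| ^ (2 + δ)) P)
    {g : ℕ → ℝ → ℝ} {f : ℝ → ℝ} (hg : ∀ n, Measurable (g n)) (hgx : ∀ n x, |g n x| ≤ |x|)
    (hgf : ∀ x, Tendsto (fun n => g n x) atTop (𝓝 (f x))) (k : Fin d → ℤ) :
    Tendsto (fun n => cov P (fun ω => g n (X 0 ω)) (fun ω => g n (X k ω))) atTop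
      (𝓝 (cov P (fun ω => f (X 0 ω)) (fun ω => f (X k ω)))) := by
  have hi := integrable_comp hmeas hstat hδ hmom measurable_id (fun _ => le_rfl)
  have hij := integrable_comp_mul_comp hmeas hstat hδ hmom measurable_id (fun _ => le_rfl) 0 k
  have h1 : ∀ h, Tendsto (fun n => ∫ ω, g n (X h ω) ∂P) atTop (𝓝 (∫ ω, f (X h ω) ∂P)) :=
    fun h => tendsto_integral_of_dominated_convergence (fun ω => |X h ω|)
      (fun n => ((hg n).comp (hmeas h)).aestronglyMeasurable) (hi h).abs
      (fun n => .of_forall fun ω => hgx n _) (.of_forall fun ω => hgf _)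
  refine Tendsto.sub ?_ ((h1 0).mul (h1 k))
  refine tendsto_integral_of_dominated_convergence (fun ω => |X 0 ω * X k ω|)
    (fun n => (((hg n).comp (hmeas 0)).mul ((hg n).comp (hmeas k))).aestronglyMeasurable) hij.abs
    (fun n => .of_forall fun ω => ?_) (.of_forall fun ω => (hgf _).mul (hgf _))
  rw [norm_mul, abs_mul]
  exact mul_le_mul (hgx n _) (hgx n _) (abs_nonneg _) (abs_nonneg _)

/-- The central limit theorem for the truncated field, in terms of characteristic functions. -/
theorem tendsto_integral_cexp_comp_of_bounded (hd : 0 < d) (hmeas : ∀ h, Measurable (X h))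
    (hstat : ∀ (h₀ : Fin d → ℤ) (n : ℕ) (x : Fin n → (Fin d → ℤ)),
      Measure.map (fun ω i => X (x i + h₀) ω) P = Measure.map (fun ω i => X (x i) ω) P)
    (h22 : Summable fun m : ℕ => ((m + 1 : ℕ) : ℝ) ^ (d - 1) * alphaKL P X 2 2 (m + 1))
    (htop : Tendsto (fun m : ℕ => (m : ℝ) ^ d * alphaKL P X 1 ⊤ m) atTop (𝓝 0))
    (hδ : 0 < δ) (hmom : Integrable (fun ω => |X 0 ω| ^ (2 + δ)) P)
    (hiii : Summable (fun m : ℕ =>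
      ((m + 1 : ℕ) : ℝ) ^ (d - 1) * alphaKL P X 1 1 (m + 1) ^ (δ / (2 + δ))))
    {Λ : ℕ → Finset (Fin d → ℤ)} (hΛ : Tendsto (fun n => (Λ n).card) atTop atTop)
    (hexit : ∀ k, Tendsto (fun n => (exitCard (Λ n) k : ℝ) / (Λ n).card) atTop (𝓝 0))
    {g : ℝ → ℝ} {C : ℝ} (hg : Measurable g) (hgx : ∀ x, |g x| ≤ |x|) (hgC : ∀ x, |g x| ≤ C)
    (t : ℝ) :
    Tendsto (fun n => ∫ ω, Complex.exp (I * ((t * ((∑ h ∈ Λ n,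
        (g (X h ω) - ∫ ω', g (X 0 ω') ∂P)) / √(Λ n).card) : ℝ) : ℂ)) ∂P) atTop
      (𝓝 (Complex.exp (-(((∑' k, cov P (fun ω => g (X 0 ω)) (fun ω => g (X k ω))) *
        t ^ 2 / 2 : ℝ) : ℂ)))) := by
  set u := ∫ ω', g (X 0 ω') ∂P with hu
  have hg' : Measurable fun x => g x - u := hg.sub_const u
  refine tendsto_integral_cexp_of_mixing hd (Y := fun h ω => g (X h ω) - u) (C := C + |u|)
    (fun h => hg'.comp (hmeas h)) (fun h ω => (abs_sub _ _).trans (add_le_add (hgC _) le_rfl))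
    (fun h => ?_) (fun h j => (integral_centered_comp_mul hmeas hstat hδ hmom hg hgx h j).2)
    (summable_abs_cov_comp hmeas hstat hδ hmom hiii hg hgx) ?_ ?_ hΛ hexit t
  · rw [integral_sub (integrable_comp hmeas hstat hδ hmom hg hgx h) (integrable_const _),
      integral_comp_eq_zero hmeas hstat hg h]
    simp [hu]
  · exact Summable.of_nonneg_of_le
      (fun m => mul_nonneg (by positivity) (alphaKL_nonneg _ _ _ _))
      (fun m => mul_le_mul_of_nonneg_left (alphaKL_comp_le X hg' 2 2 (m + 1)) (by positivity)) h22
  · exact squeeze_zero (fun m => mul_nonneg (by positivity) (alphaKL_nonneg _ _ _ _))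
      (fun m => mul_le_mul_of_nonneg_left (alphaKL_comp_le X hg' 1 ⊤ m) (by positivity)) htop

theorem tendsto_trunc_natCast (x : ℝ) : Tendsto (fun M : ℕ => trunc M x) atTop (𝓝 x) := by
  refine tendsto_const_nhds.congr' ?_
  filter_upwards [eventually_ge_atTop ⌈|x|⌉₊] with M hM
  exact (trunc_of_le (Nat.ceil_le.1 hM)).symm

theorem norm_integral_cexp_sub_le {U V : Ω → ℝ} (hU : Measurable U) (hV : Measurable V)
    (hi : Integrable (fun ω => U ω - V ω) P) (t : ℝ) :
    ‖∫ ω, Complex.exp (I * ((t * U ω : ℝ) : ℂ)) ∂P - ∫ ω, Complex.exp (I * ((t * V ω : ℝ) : ℂ)) ∂P‖ ≤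
      |t| * ∫ ω, |U ω - V ω| ∂P := by
  have hexp : ∀ x : ℝ, ‖Complex.exp (I * (x : ℂ))‖ = 1 := Complex.norm_exp_I_mul_ofReal
  have hei : ∀ W : Ω → ℝ, Measurable W →
      Integrable (fun ω => Complex.exp (I * ((t * W ω : ℝ) : ℂ))) P := fun W hW =>
    Integrable.of_bound (Measurable.aestronglyMeasurable (by fun_prop)) 1
      (.of_forall fun ω => (hexp _).le)
  rw [← integral_sub (hei U hU) (hei V hV), ← integral_const_mul]
  refine norm_integral_le_of_norm_le (hi.abs.const_mul _) (.of_forall fun ω => ?_)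
  have h1 : Complex.exp (I * ((t * U ω : ℝ) : ℂ)) - Complex.exp (I * ((t * V ω : ℝ) : ℂ)) =
      Complex.exp (I * ((t * V ω : ℝ) : ℂ)) *
        (Complex.exp (I * ((t * (U ω - V ω) : ℝ) : ℂ)) - 1) := by
    rw [mul_sub, ← Complex.exp_add, mul_one]
    congr 2
    push_cast
    ring
  rw [h1, norm_mul, hexp, one_mul, ← abs_mul]
  exact Real.norm_exp_I_mul_ofReal_sub_one_le

/-- Bolthausen's central limit theorem, in terms of characteristic functions. -/
theorem tendsto_integral_cexp_of_rpow (hd : 0 < d) (hmeas : ∀ h, Measurable (X h))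
    (hstat : ∀ (h₀ : Fin d → ℤ) (n : ℕ) (x : Fin n → (Fin d → ℤ)),
      Measure.map (fun ω i => X (x i + h₀) ω) P = Measure.map (fun ω i => X (x i) ω) P)
    (h22 : Summable fun m : ℕ => ((m + 1 : ℕ) : ℝ) ^ (d - 1) * alphaKL P X 2 2 (m + 1))
    (htop : Tendsto (fun m : ℕ => (m : ℝ) ^ d * alphaKL P X 1 ⊤ m) atTop (𝓝 0))
    (hδ : 0 < δ) (hmom : Integrable (fun ω => |X 0 ω| ^ (2 + δ)) P)
    (hiii : Summable (fun m : ℕ =>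
      ((m + 1 : ℕ) : ℝ) ^ (d - 1) * alphaKL P X 1 1 (m + 1) ^ (δ / (2 + δ))))
    {Λ : ℕ → Finset (Fin d → ℤ)} (hΛ : Tendsto (fun n => (Λ n).card) atTop atTop)
    (hexit : ∀ k, Tendsto (fun n => (exitCard (Λ n) k : ℝ) / (Λ n).card) atTop (𝓝 0)) (t : ℝ) :
    Tendsto (fun n => ∫ ω, Complex.exp (I * ((t * ((∑ h ∈ Λ n,
        (X h ω - ∫ ω', X 0 ω' ∂P)) / √(Λ n).card) : ℝ) : ℂ)) ∂P) atTop
      (𝓝 (Complex.exp (-(((∑' k, cov P (X 0) (X k)) * t ^ 2 / 2 : ℝ) : ℂ)))) := by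
  set r : ℕ → ℝ → ℝ := fun M x => x - trunc M x with hr
  have hrm : ∀ M, Measurable (r M) := fun M => measurable_id.sub (measurable_trunc M)
  have hrx : ∀ M x, |r M x| ≤ |x| := fun M => abs_sub_trunc_le_abs M
  have hgm : ∀ M : ℕ, Measurable (trunc M) := fun M => measurable_trunc M
  have hgx : ∀ (M : ℕ) x, |trunc M x| ≤ |x| := fun M => abs_trunc_le_abs M
  have hr0 : ∀ x, Tendsto (fun M => r M x) atTop (𝓝 0) := fun x => by
    simpa using (tendsto_trunc_natCast x).const_sub x
  have hdom := (summable_alphaKL_rpow hiii).mul_left (4 * (1 + ∫ ω, |X 0 ω| ^ (2 + δ) ∂P))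
  have hlim1 : Tendsto (fun M : ℕ => Complex.exp (-(((∑' k, cov P (fun ω => trunc M (X 0 ω))
      (fun ω => trunc M (X k ω))) * t ^ 2 / 2 : ℝ) : ℂ))) atTop
      (𝓝 (Complex.exp (-(((∑' k, cov P (X 0) (X k)) * t ^ 2 / 2 : ℝ) : ℂ)))) := by
    have h1 : Tendsto (fun M : ℕ => ∑' k, cov P (fun ω => trunc M (X 0 ω))
        (fun ω => trunc M (X k ω))) atTop (𝓝 (∑' k, cov P (X 0) (X k))) :=
      tendsto_tsum_of_dominated_convergence hdom
        (tendsto_cov_comp hmeas hstat hδ hmom hgm hgx tendsto_trunc_natCast)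
        (.of_forall fun M => abs_cov_comp_le hmeas hstat hδ hmom (hgm M) (hgx M))
    have hcont : Continuous fun v : ℝ => Complex.exp (-((v * t ^ 2 / 2 : ℝ) : ℂ)) := by fun_prop
    exact (hcont.tendsto _).comp h1
  have hlim2 : Tendsto (fun M : ℕ => |t| * √(∑' k, |cov P (fun ω => r M (X 0 ω))
      (fun ω => r M (X k ω))|)) atTop (𝓝 0) := by
    have h1 : Tendsto (fun M : ℕ => ∑' k, |cov P (fun ω => r M (X 0 ω))
        (fun ω => r M (X k ω))|) atTop (𝓝 (∑' _ : Fin d → ℤ, (0 : ℝ))) := by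
      refine tendsto_tsum_of_dominated_convergence hdom (fun k => ?_)
        (.of_forall fun M k => ?_)
      · simpa [cov] using (tendsto_cov_comp (f := fun _ => 0) hmeas hstat hδ hmom hrm hrx hr0 k).abs
      · rw [Real.norm_eq_abs, abs_abs]
        exact abs_cov_comp_le hmeas hstat hδ hmom (hrm M) (hrx M) k
    rw [tsum_zero] at h1
    simpa using (h1.sqrt).const_mul |t|
  have hid := integrable_comp hmeas hstat hδ hmom measurable_id (fun _ => le_rfl)
  have happrox : ∀ M n : ℕ, ‖∫ ω, Complex.exp (I * ((t * ((∑ h ∈ Λ n,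
        (X h ω - ∫ ω', X 0 ω' ∂P)) / √(Λ n).card) : ℝ) : ℂ)) ∂P -
      ∫ ω, Complex.exp (I * ((t * ((∑ h ∈ Λ n,
        (trunc M (X h ω) - ∫ ω', trunc M (X 0 ω') ∂P)) / √(Λ n).card) : ℝ) : ℂ)) ∂P‖ ≤
      |t| * √(∑' k, |cov P (fun ω => r M (X 0 ω)) (fun ω => r M (X k ω))|) := by
    intro M n
    have hig := integrable_comp hmeas hstat hδ hmom (hgm M) (hgx M)
    have hir := integrable_comp hmeas hstat hδ hmom (hrm M) (hrx M)
    have hmean : ∫ ω, r M (X 0 ω) ∂P = ∫ ω, X 0 ω ∂P - ∫ ω, trunc M (X 0 ω) ∂P :=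
      integral_sub (hid 0) (hig 0)
    have hdiff : ∀ ω, (∑ h ∈ Λ n, (X h ω - ∫ ω', X 0 ω' ∂P)) / √(Λ n).card -
        (∑ h ∈ Λ n, (trunc M (X h ω) - ∫ ω', trunc M (X 0 ω') ∂P)) / √(Λ n).card =
        (∑ h ∈ Λ n, (r M (X h ω) - ∫ ω', r M (X 0 ω') ∂P)) / √(Λ n).card := by
      intro ω
      rw [← sub_div, ← Finset.sum_sub_distrib, hmean]
      congr 1
      refine Finset.sum_congr rfl fun h _ => ?_
      simp only [hr]
      ring
    refine (norm_integral_cexp_sub_le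
      (U := fun ω => (∑ h ∈ Λ n, (X h ω - ∫ ω', X 0 ω' ∂P)) / √(Λ n).card)
      (V := fun ω => (∑ h ∈ Λ n, (trunc M (X h ω) - ∫ ω', trunc M (X 0 ω') ∂P)) / √(Λ n).card)
      ((Finset.measurable_fun_sum _ fun h _ => (hmeas h).sub_const _).div_const _)
      ((Finset.measurable_fun_sum _ fun h _ => ((hgm M).comp (hmeas h)).sub_const _).div_const _)
      ?_ t).trans (mul_le_mul_of_nonneg_left ?_ (abs_nonneg t))
    · refine (integrable_congr (.of_forall hdiff)).2 ?_
      exact (integrable_finsetSum _ fun h _ => (hir h).sub (integrable_const _)).div_const _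
    · refine (integral_congr_ae (.of_forall fun ω => congrArg abs (hdiff ω))).trans_le ?_
      exact integral_abs_sum_div_sqrt_le (Y := fun h ω => r M (X h ω) - ∫ ω', r M (X 0 ω') ∂P)
        (fun h => (hir h).sub (integrable_const _))
        (fun h j => (integral_centered_comp_mul hmeas hstat hδ hmom (hrm M) (hrx M) h j).1)
        (fun h j => (integral_centered_comp_mul hmeas hstat hδ hmom (hrm M) (hrx M) h j).2)
        (summable_abs_cov_comp hmeas hstat hδ hmom hiii (hrm M) (hrx M)) (Λ n)
  rw [Metric.tendsto_nhds]
  intro ε hε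
  have hε3 : 0 < ε / 3 := by positivity
  obtain ⟨M, hM1, hM2⟩ := ((Metric.tendsto_nhds.1 hlim1 _ hε3).and
    (hlim2.eventually_lt_const hε3)).exists
  have hM3 := Metric.tendsto_nhds.1 (tendsto_integral_cexp_comp_of_bounded hd hmeas hstat h22 htop
    hδ hmom hiii hΛ hexit (hgm M) (hgx M) (abs_trunc_le (Nat.cast_nonneg M)) t) _ hε3
  filter_upwards [hM3] with n hn
  refine (dist_triangle4 _ _ _ _).trans_lt (lt_of_lt_of_eq (add_lt_add (add_lt_add
    (((dist_eq_norm _ _).trans_le (happrox M n)).trans_lt hM2) hn) hM1) (by ring))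

end StationaryField

theorem tendstoInDistribution_gaussianReal {Ω : Type*} [MeasurableSpace Ω] {P : Measure Ω}
    [IsProbabilityMeasure P] {S : ℕ → Ω → ℝ} (hS : ∀ n, Measurable (S n)) (v : ℝ≥0)
    (h : ∀ t : ℝ, Tendsto (fun n => ∫ ω, Complex.exp (Complex.I * ((t * S n ω : ℝ) : ℂ)) ∂P) atTop
      (𝓝 (Complex.exp (-((v * t ^ 2 / 2 : ℝ) : ℂ))))) :
    _root_.TendstoInDistribution P S (gaussianReal 0 v) := by
  let μ : ℕ → ProbabilityMeasure ℝ := fun n =>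
    ⟨P.map (S n), Measure.isProbabilityMeasure_map (hS n).aemeasurable⟩
  let ν : ProbabilityMeasure ℝ := ⟨gaussianReal 0 v, inferInstance⟩
  have hμν : Tendsto μ atTop (𝓝 ν) := by
    refine ProbabilityMeasure.tendsto_iff_tendsto_charFun.2 fun t => ?_
    have hl : ∀ n, charFun (μ n : Measure ℝ) t =
        ∫ ω, Complex.exp (Complex.I * ((t * S n ω : ℝ) : ℂ)) ∂P := fun n => by
      rw [charFun_apply_real]
      refine (integral_map (hS n).aemeasurable
        (Measurable.aestronglyMeasurable (by fun_prop))).trans ?_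
      simp [mul_comm]
    have hr : charFun (ν : Measure ℝ) t = Complex.exp (-((v * t ^ 2 / 2 : ℝ) : ℂ)) := by
      refine (charFun_gaussianReal t).trans ?_
      simp
    simpa only [hl, hr] using h t
  intro f
  have hf := (ProbabilityMeasure.tendsto_iff_forall_integral_tendsto.1 hμν) f
  refine hf.congr fun n => integral_map (hS n).aemeasurable
    (f.continuous.measurable.aestronglyMeasurable)

/-- **Bolthausen's central limit theorem for stationary random fields on `ℤ^d`.**
Under the mixing conditions (i)–(iii), the covariances of a strictly stationary field `X`
are absolutely summable and, if `σ² = Σ_h Cov(X(0), X(h)) > 0`, the normalized sums of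
`X − E[X]` over finite sets `Λ_n ↑ ℤ^d` with `|∂Λ_n|/|Λ_n| → 0` converge in distribution
to `N(0, σ²)`. -/
theorem bolthausen_clt
    {d : ℕ} (hd : 0 < d) {Ω : Type*} [MeasurableSpace Ω]
    (P : Measure Ω) [IsProbabilityMeasure P]
    (X : (Fin d → ℤ) → Ω → ℝ)
    (hmeas : ∀ h, Measurable (X h))
    -- strict stationarity
    (hstat : ∀ (h₀ : Fin d → ℤ) (n : ℕ) (x : Fin n → (Fin d → ℤ)),
      Measure.map (fun ω i => X (x i + h₀) ω) P = Measure.map (fun ω i => X (x i) ω) P)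
    -- condition (i)
    (hi : ∀ k l : ℕ, 1 ≤ k → 1 ≤ l → k + l ≤ 4 →
      Summable (fun m : ℕ =>
        ((m + 1 : ℕ) : ℝ) ^ (d - 1) * alphaKL P X (k : ℕ∞) (l : ℕ∞) (m + 1)))
    -- condition (ii): α_{1∞}(m) = o(m^{-d})
    (hii : Tendsto (fun m : ℕ => (m : ℝ) ^ d * alphaKL P X 1 ⊤ m) atTop (𝓝 0))
    -- condition (iii)
    (δ : ℝ) (hδ : 0 < δ)
    (hmom : Integrable (fun ω => |X 0 ω| ^ ((2 : ℝ) + δ)) P)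
    (hiii : Summable (fun m : ℕ =>
      ((m + 1 : ℕ) : ℝ) ^ (d - 1) * alphaKL P X 1 1 (m + 1) ^ (δ / (2 + δ))))
    -- the sequence of finite subsets of ℤ^d
    (Λ : ℕ → Finset (Fin d → ℤ))
    (hΛmono : ∀ n, Λ n ⊆ Λ (n + 1))
    (hΛunion : (⋃ n, (Λ n : Set (Fin d → ℤ))) = Set.univ)
    (hΛbdry : Tendsto
      (fun n => ((latBoundary (Λ n : Set (Fin d → ℤ))).ncard : ℝ) / (Λ n).card)
      atTop (𝓝 0)) :
    Summable (fun h : Fin d → ℤ => |cov P (X 0) (X h)|) ∧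
    (0 < ∑' h : Fin d → ℤ, cov P (X 0) (X h) →
      TendstoInDistribution P
        (fun n ω => (∑ h ∈ Λ n, (X h ω - ∫ ω', X h ω' ∂P)) / Real.sqrt (Λ n).card)
        (gaussianReal 0 (Real.toNNReal (∑' h : Fin d → ℤ, cov P (X 0) (X h))))) := by
  have h22 : Summable fun m : ℕ => ((m + 1 : ℕ) : ℝ) ^ (d - 1) * alphaKL P X 2 2 (m + 1) := by
    simpa only [Nat.cast_ofNat] using hi 2 2 (by norm_num) (by norm_num) (by norm_num)
  have hcov : Summable fun h => |cov P (fun ω => id (X 0 ω)) (fun ω => id (X h ω))| :=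
    summable_abs_cov_comp hmeas hstat hδ hmom hiii measurable_id (fun _ => le_rfl)
  have hmean : ∀ h, ∫ ω, X h ω ∂P = ∫ ω, X 0 ω ∂P := fun h =>
    integral_comp_eq_zero hmeas hstat measurable_id h
  refine ⟨hcov, fun hσ => tendstoInDistribution_gaussianReal (fun n =>
    (Finset.measurable_fun_sum _ fun h _ => (hmeas h).sub_const _).div_const _) _ fun t => ?_⟩
  simp only [hmean]
  rw [Real.coe_toNNReal _ hσ.le]
  exact tendsto_integral_cexp_of_rpow hd hmeas hstat h22 hii hδ hmom hiii
    (tendsto_card_atTop hd hΛmono hΛunion) (tendsto_exitCard_div_card hΛbdry) t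

end
end

section
/- Let {Z(x)}_{x∈ℝ^d} be a simple, strictly stationary, sample-continuous and jointly measurable max-stable random field. Let δ > 0 and let F : (0,∞) → ℝ be Borel measurable, non-decreasing and non-constant, with E[|F(Z(0))|^{2+δ}] < ∞. Then for every x ∈ ℝ^d, Cov(F(Z(0)), F(Z(x))) ≥ 0, there exist c > 0 and ξ > 0 such that Cov(F(Z(0)), F(Z(x))) ≥ c whenever ‖x‖ ≤ ξ, and consequently the (possibly infinite) integral σ² = ∫_{ℝ^d} Cov(F(Z(0)), F(Z(x))) λ(dx) of this nonnegative function is strictly positive. -/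
open MeasureTheory ProbabilityTheory Filter Topology
open scoped ENNReal NNReal

noncomputable section

section Association

variable {Ω : Type*} [MeasurableSpace Ω] {P : Measure Ω} {U V : Ω → ℝ}

theorem lintegral_mul_lintegral_le_of_tail [IsProbabilityMeasure P]
    (hU : Measurable U) (hV : Measurable V) (hU0 : ∀ ω, 0 ≤ U ω) (hV0 : ∀ ω, 0 ≤ V ω)
    (h : ∀ s t : ℝ, 0 < s → 0 < t →
      P {ω | s < U ω} * P {ω | t < V ω} ≤ P ({ω | s < U ω} ∩ {ω | t < V ω})) :
    (∫⁻ ω, ENNReal.ofReal (U ω) ∂P) * (∫⁻ ω, ENNReal.ofReal (V ω) ∂P) ≤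
      ∫⁻ ω, ENNReal.ofReal (U ω * V ω) ∂P := by
  have hUs : ∀ s, MeasurableSet {ω | s < U ω} := fun s => measurableSet_lt measurable_const hU
  have hVt : ∀ t, MeasurableSet {ω | t < V ω} := fun t => measurableSet_lt measurable_const hV
  have tail : ∀ s : ℝ, 0 < s → P {ω | s < U ω} * ∫⁻ ω, ENNReal.ofReal (V ω) ∂P ≤
      (P.withDensity fun ω => ENNReal.ofReal (V ω)) {ω | s < U ω} := by
    intro s hs
    rw [withDensity_apply _ (hUs s),
      lintegral_eq_lintegral_meas_lt _ (ae_of_all _ hV0) hV.aemeasurable,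
      lintegral_eq_lintegral_meas_lt _ (ae_of_all _ hV0) hV.aemeasurable,
      ← lintegral_const_mul' _ _ (measure_ne_top _ _)]
    refine setLIntegral_mono' measurableSet_Ioi fun t ht => ?_
    rw [Measure.restrict_apply (hVt t), Set.inter_comm]
    exact h s t hs ht
  calc (∫⁻ ω, ENNReal.ofReal (U ω) ∂P) * (∫⁻ ω, ENNReal.ofReal (V ω) ∂P)
      = ∫⁻ s in Set.Ioi 0, P {ω | s < U ω} * ∫⁻ ω, ENNReal.ofReal (V ω) ∂P := by
        rw [lintegral_eq_lintegral_meas_lt _ (ae_of_all _ hU0) hU.aemeasurable, lintegral_mul_const]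
        refine Antitone.measurable fun s t hst => measure_mono fun ω hω => ?_
        exact lt_of_le_of_lt hst hω
    _ ≤ ∫⁻ s in Set.Ioi 0, (P.withDensity fun ω => ENNReal.ofReal (V ω)) {ω | s < U ω} :=
        setLIntegral_mono' measurableSet_Ioi tail
    _ = ∫⁻ ω, ENNReal.ofReal (U ω) ∂(P.withDensity fun ω => ENNReal.ofReal (V ω)) :=
        (lintegral_eq_lintegral_meas_lt _ (ae_of_all _ hU0) hU.aemeasurable).symm
    _ = ∫⁻ ω, ENNReal.ofReal (U ω * V ω) ∂P := by
        rw [lintegral_withDensity_eq_lintegral_mul _ hV.ennreal_ofReal hU.ennreal_ofReal]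
        refine lintegral_congr fun ω => ?_
        rw [Pi.mul_apply, mul_comm, ENNReal.ofReal_mul (hU0 ω)]

theorem measure_tail_mul_le [IsProbabilityMeasure P] (hU : Measurable U) (hV : Measurable V)
    {s t : ℝ} (h : P {ω | U ω ≤ s} * P {ω | V ω ≤ t} ≤ P ({ω | U ω ≤ s} ∩ {ω | V ω ≤ t})) :
    P {ω | s < U ω} * P {ω | t < V ω} ≤ P ({ω | s < U ω} ∩ {ω | t < V ω}) := by
  have hA : MeasurableSet {ω | U ω ≤ s} := measurableSet_le hU measurable_const
  have hB : MeasurableSet {ω | V ω ≤ t} := measurableSet_le hV measurable_const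
  have hAc : {ω | s < U ω} = {ω | U ω ≤ s}ᶜ := by ext; simp
  have hBc : {ω | t < V ω} = {ω | V ω ≤ t}ᶜ := by ext; simp
  rw [hAc, hBc]
  have h' := ENNReal.toReal_mono (measure_ne_top _ _) h
  rw [← ENNReal.toReal_le_toReal (ENNReal.mul_ne_top (measure_ne_top _ _) (measure_ne_top _ _))
    (measure_ne_top _ _)]
  rw [ENNReal.toReal_mul] at h' ⊢
  simp only [← measureReal_def] at h' ⊢
  rw [← Set.compl_union, probReal_compl_eq_one_sub hA, probReal_compl_eq_one_sub hB,
    probReal_compl_eq_one_sub (hA.union hB)]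
  have := measureReal_union_add_inter (μ := P) (s := {ω | U ω ≤ s}) hB
  nlinarith

theorem covariance_nonneg_of_tail_of_bddBelow [IsProbabilityMeasure P]
    (hU : Measurable U) (hV : Measurable V) (hU2 : MemLp U 2 P) (hV2 : MemLp V 2 P) (m : ℝ)
    (hUm : ∀ ω, m ≤ U ω) (hVm : ∀ ω, m ≤ V ω)
    (h : ∀ s t : ℝ, m < s → m < t →
      P {ω | s < U ω} * P {ω | t < V ω} ≤ P ({ω | s < U ω} ∩ {ω | t < V ω})) :
    0 ≤ cov[U, V; P] := by
  have hU' : MemLp (fun ω => U ω - m) 2 P := hU2.sub (memLp_const m)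
  have hV' : MemLp (fun ω => V ω - m) 2 P := hV2.sub (memLp_const m)
  have key := lintegral_mul_lintegral_le_of_tail (P := P) (hU.sub_const m) (hV.sub_const m)
    (fun ω => sub_nonneg.2 (hUm ω)) (fun ω => sub_nonneg.2 (hVm ω)) (fun s t hs ht => by
      simpa only [lt_sub_iff_add_lt] using h (s + m) (t + m) (by linarith) (by linarith))
  rw [← covariance_sub_const_left (hU2.integrable one_le_two) m,
    ← covariance_sub_const_right (hV2.integrable one_le_two) m, covariance_eq_sub hU' hV',
    sub_nonneg]
  have hUi := hU'.integrable one_le_two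
  have hVi := hV'.integrable one_le_two
  have hU0 : ∀ ω, 0 ≤ U ω - m := fun ω => sub_nonneg.2 (hUm ω)
  have hV0 : ∀ ω, 0 ≤ V ω - m := fun ω => sub_nonneg.2 (hVm ω)
  rw [← ofReal_integral_eq_lintegral_ofReal hUi (ae_of_all _ hU0),
    ← ofReal_integral_eq_lintegral_ofReal hVi (ae_of_all _ hV0),
    ← ofReal_integral_eq_lintegral_ofReal (f := fun ω => (U ω - m) * (V ω - m))
      (hU'.integrable_mul hV')
      (ae_of_all _ fun ω => mul_nonneg (hU0 ω) (hV0 ω)),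
    ← ENNReal.ofReal_mul (integral_nonneg hU0), ENNReal.ofReal_le_ofReal_iff
      (integral_nonneg fun ω => mul_nonneg (hU0 ω) (hV0 ω))] at key
  exact key

/-- Positively quadrant dependent square-integrable variables have nonnegative covariance. -/
theorem covariance_nonneg_of_quadrant [IsProbabilityMeasure P]
    (hU : Measurable U) (hV : Measurable V) (hU2 : MemLp U 2 P) (hV2 : MemLp V 2 P)
    (h : ∀ s t : ℝ, P {ω | U ω ≤ s} * P {ω | V ω ≤ t} ≤ P ({ω | U ω ≤ s} ∩ {ω | V ω ≤ t})) :
    0 ≤ cov[U, V; P] := by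
  have hmax : ∀ {W : Ω → ℝ}, MemLp W 2 P → ∀ n : ℕ,
      MemLp (fun ω => max (W ω) (-(n : ℝ))) 2 P := fun hW2 n => hW2.sup (memLp_const _)
  have habs : ∀ (x : ℝ) (n : ℕ), |max x (-(n : ℝ))| ≤ |x| := by
    intro x n
    have : (0 : ℝ) ≤ n := n.cast_nonneg
    rcases max_cases x (-(n : ℝ)) with ⟨h, _⟩ | ⟨h, h'⟩
    · rw [h]
    · rw [h, abs_of_nonpos (by linarith), abs_of_neg (by linarith)]; linarith
  have hlim : ∀ x : ℝ, Tendsto (fun n : ℕ => max x (-(n : ℝ))) atTop (𝓝 x) := by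
    intro x
    refine tendsto_const_nhds.congr' ?_
    filter_upwards [eventually_ge_atTop ⌈-x⌉₊] with n hn
    rw [max_eq_left]
    linarith [Nat.ceil_le.1 hn]
  have hint : ∀ {W : Ω → ℝ}, MemLp W 2 P →
      Tendsto (fun n : ℕ => ∫ ω, max (W ω) (-(n : ℝ)) ∂P) atTop (𝓝 (∫ ω, W ω ∂P)) := by
    intro W hW2
    exact tendsto_integral_of_dominated_convergence (fun ω => |W ω|)
      (fun n => (hmax hW2 n).1) (hW2.integrable one_le_two).abs
      (fun n => ae_of_all _ fun ω => habs _ n) (ae_of_all _ fun ω => hlim _)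
  have hprod : Tendsto (fun n : ℕ => ∫ ω, max (U ω) (-(n : ℝ)) * max (V ω) (-(n : ℝ)) ∂P) atTop
      (𝓝 (∫ ω, U ω * V ω ∂P)) := by
    refine tendsto_integral_of_dominated_convergence (fun ω => |U ω * V ω|)
      (fun n => (hmax hU2 n).1.mul (hmax hV2 n).1) (hU2.integrable_mul hV2).abs
      (fun n => ae_of_all _ fun ω => ?_) (ae_of_all _ fun ω => (hlim _).mul (hlim _))
    rw [Real.norm_eq_abs, abs_mul, abs_mul]
    exact mul_le_mul (habs _ n) (habs _ n) (abs_nonneg _) (abs_nonneg _)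
  rw [covariance_eq_sub hU2 hV2]
  refine ge_of_tendsto' (hprod.sub ((hint hU2).mul (hint hV2))) fun n => ?_
  have := covariance_nonneg_of_tail_of_bddBelow (hU.max measurable_const)
    (hV.max measurable_const) (hmax hU2 n) (hmax hV2 n) (-(n : ℝ))
    (fun ω => le_max_right _ _) (fun ω => le_max_right _ _) (fun s t hs ht => by
      have hs' := not_lt.2 hs.le
      have ht' := not_lt.2 ht.le
      simpa only [lt_max_iff, hs', ht', or_false] using measure_tail_mul_le hU hV (h s t))
  rwa [covariance_eq_sub (hmax hU2 n) (hmax hV2 n)] at this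

end Association

section Frechet

variable {Ω : Type*} [MeasurableSpace Ω] {P : Measure Ω} {X Y : Ω → ℝ}

theorem ae_pos_of_frechet
    (hXf : ∀ z : ℝ, 0 < z → P {ω | X ω ≤ z} = ENNReal.ofReal (Real.exp (-1 / z))) :
    ∀ᵐ ω ∂P, 0 < X ω := by
  have hlim : Tendsto (fun z : ℝ => ENNReal.ofReal (Real.exp (-1 / z))) (𝓝[>] 0) (𝓝 0) := by
    have hinv : Tendsto (fun z : ℝ => -1 / z) (𝓝[>] 0) atBot := by
      simpa [Function.comp_def, neg_div] using
        tendsto_neg_atTop_atBot.comp (tendsto_inv_nhdsGT_zero (𝕜 := ℝ))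
    simpa [Function.comp_def] using
      (ENNReal.continuous_ofReal.tendsto 0).comp (Real.tendsto_exp_atBot.comp hinv)
  have hz : P {ω | X ω ≤ 0} ≤ 0 := by
    refine ge_of_tendsto hlim ?_
    filter_upwards [self_mem_nhdsWithin] with z hz
    rw [← hXf z hz]
    exact measure_mono fun ω (hω : X ω ≤ 0) => hω.trans (le_of_lt hz)
  simpa [ae_iff] using hz

variable [IsProbabilityMeasure P]

theorem quadrant_of_maxStable (hY : Measurable Y)
    (hXf : ∀ z : ℝ, 0 < z → P {ω | X ω ≤ z} = ENNReal.ofReal (Real.exp (-1 / z)))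
    (hYf : ∀ z : ℝ, 0 < z → P {ω | Y ω ≤ z} = ENNReal.ofReal (Real.exp (-1 / z)))
    {a b : ℝ} (ha : 0 < a) (hb : 0 < b)
    (hmax : ∀ T : ℕ, 1 ≤ T → P ({ω | X ω ≤ T * a} ∩ {ω | Y ω ≤ T * b}) ^ T =
      P ({ω | X ω ≤ a} ∩ {ω | Y ω ≤ b})) :
    P {ω | X ω ≤ a} * P {ω | Y ω ≤ b} ≤ P ({ω | X ω ≤ a} ∩ {ω | Y ω ≤ b}) := by
  have hlow : ∀ T : ℕ, 1 ≤ T →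
      1 + (-1 / a + -1 / b) / T ≤ P.real ({ω | X ω ≤ T * a} ∩ {ω | Y ω ≤ T * b}) := by
    intro T hT
    have hT0 : (0 : ℝ) < T := by exact_mod_cast hT
    have hB : MeasurableSet {ω | Y ω ≤ T * b} := measurableSet_le hY measurable_const
    have h1 := measureReal_union_add_inter (μ := P) (s := {ω | X ω ≤ T * a}) hB
    have h2 : P.real ({ω | X ω ≤ T * a} ∪ {ω | Y ω ≤ T * b}) ≤ 1 := measureReal_le_one
    have h3 : P.real {ω | X ω ≤ T * a} = Real.exp (-1 / (T * a)) := by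
      rw [measureReal_def, hXf _ (by positivity), ENNReal.toReal_ofReal (Real.exp_nonneg _)]
    have h4 : P.real {ω | Y ω ≤ T * b} = Real.exp (-1 / (T * b)) := by
      rw [measureReal_def, hYf _ (by positivity), ENNReal.toReal_ofReal (Real.exp_nonneg _)]
    have h5 := Real.add_one_le_exp (-1 / (T * a))
    have h6 := Real.add_one_le_exp (-1 / (T * b))
    have h7 : (-1 / a + -1 / b) / T = -1 / (T * a) + -1 / (T * b) := by field_simp
    linarith
  have hpow : ∀ᶠ T : ℕ in atTop, (1 + (-1 / a + -1 / b) / T) ^ T ≤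
      P.real ({ω | X ω ≤ a} ∩ {ω | Y ω ≤ b}) := by
    have hpos : ∀ᶠ T : ℕ in atTop, 0 < 1 + (-1 / a + -1 / b) / (T : ℝ) := by
      have : Tendsto (fun T : ℕ => 1 + (-1 / a + -1 / b) / (T : ℝ)) atTop (𝓝 (1 + 0)) :=
        (tendsto_const_div_atTop_nhds_zero_nat _).const_add 1
      exact this.eventually (lt_mem_nhds (by norm_num))
    filter_upwards [hpos, eventually_ge_atTop 1] with T hT0 hT
    rw [measureReal_def, ← hmax T hT, ENNReal.toReal_pow]
    exact pow_le_pow_left₀ hT0.le (hlow T hT) T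
  have hlim := le_of_tendsto (Real.tendsto_one_add_div_pow_exp (-1 / a + -1 / b)) hpow
  rw [hXf a ha, hYf b hb, ← ENNReal.ofReal_mul (Real.exp_nonneg _), ← Real.exp_add]
  exact (ENNReal.ofReal_le_ofReal hlim).trans_eq (ofReal_measureReal (measure_ne_top _ _))

theorem measure_eq_zero_of_frechet (hX : Measurable X)
    (hXf : ∀ z : ℝ, 0 < z → P {ω | X ω ≤ z} = ENNReal.ofReal (Real.exp (-1 / z)))
    {u : ℝ} (hu : 0 < u) : P {ω | X ω = u} = 0 := by
  have hcont : ContinuousAt (fun z : ℝ => Real.exp (-1 / z)) u :=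
    (continuousAt_const.div continuousAt_id hu.ne').rexp
  have hlim : Tendsto (fun z : ℝ => Real.exp (-1 / u) - Real.exp (-1 / z)) (𝓝[<] u) (𝓝 0) := by
    rw [← sub_self (Real.exp (-1 / u))]
    exact tendsto_const_nhds.sub (hcont.tendsto.mono_left nhdsWithin_le_nhds)
  have hreal : ∀ z : ℝ, 0 < z → P.real {ω | X ω ≤ z} = Real.exp (-1 / z) := fun z hz => by
    rw [measureReal_def, hXf z hz, ENNReal.toReal_ofReal (Real.exp_nonneg _)]
  have hle : P.real {ω | X ω = u} ≤ 0 := by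
    refine ge_of_tendsto hlim ?_
    filter_upwards [Ioo_mem_nhdsLT hu] with z hz
    have hdisj : Disjoint {ω | X ω = u} {ω | X ω ≤ z} := by
      refine Set.disjoint_left.2 fun ω hω hω' => ?_
      have h1 : X ω = u := hω
      have h2 : X ω ≤ z := hω'
      linarith [hz.2]
    rw [← hreal u hu, ← hreal z hz.1, le_sub_iff_add_le,
      ← measureReal_union hdisj (measurableSet_le hX measurable_const)]
    refine measureReal_mono ?_
    rintro ω (hω | hω)
    · exact le_of_eq hω
    · exact le_trans hω hz.2.le
  exact (measureReal_eq_zero_iff).1 (le_antisymm hle measureReal_nonneg)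

/-- Up to null sets, a sublevel set of a monotone function of a Fréchet variable is trivial or a
sublevel set of the variable itself. -/
theorem sublevel_ae_eq (hX : Measurable X)
    (hXf : ∀ z : ℝ, 0 < z → P {ω | X ω ≤ z} = ENNReal.ofReal (Real.exp (-1 / z)))
    {f : ℝ → ℝ} (hf : MonotoneOn f (Set.Ioi 0)) (s : ℝ) :
    {ω | f (X ω) ≤ s} =ᵐ[P] (∅ : Set Ω) ∨ {ω | f (X ω) ≤ s} =ᵐ[P] Set.univ ∨
      ∃ u, 0 < u ∧ {ω | f (X ω) ≤ s} =ᵐ[P] {ω | X ω ≤ u} := by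
  have hpos := ae_pos_of_frechet hXf
  by_cases hne : ∃ z, 0 < z ∧ f z ≤ s
  swap
  · left
    push Not at hne
    filter_upwards [hpos] with ω hω
    exact propext ⟨fun h => absurd h (not_le.2 (hne _ hω)), False.elim⟩
  obtain ⟨z₀, hz₀, hfz₀⟩ := hne
  by_cases hbdd : ∃ w, 0 < w ∧ s < f w
  swap
  · right; left
    push Not at hbdd
    filter_upwards [hpos] with ω hω
    exact propext ⟨fun _ => trivial, fun _ => hbdd _ hω⟩
  obtain ⟨w, hw, hfw⟩ := hbdd
  right; right
  set L : Set ℝ := {z | 0 < z ∧ f z ≤ s} with hL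
  have hLb : BddAbove L := ⟨w, fun z hz => by
    by_contra! hlt
    exact absurd (hf hw hz.1 hlt.le) (not_le.2 (hz.2.trans_lt hfw))⟩
  have hu : 0 < sSup L := hz₀.trans_le (le_csSup hLb ⟨hz₀, hfz₀⟩)
  refine ⟨sSup L, hu, ?_⟩
  have hatom : ∀ᵐ ω ∂P, X ω ≠ sSup L := by
    simpa [ae_iff] using measure_eq_zero_of_frechet hX hXf hu
  filter_upwards [hpos, hatom] with ω hω hne
  refine propext ⟨fun h => le_csSup hLb ⟨hω, h⟩, fun h => ?_⟩
  have hL0 : L.Nonempty := ⟨z₀, hz₀, hfz₀⟩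
  obtain ⟨z, hz, hlt⟩ := exists_lt_of_lt_csSup hL0 (lt_of_le_of_ne h hne)
  exact (hf hω hz.1 hlt.le).trans hz.2

theorem covariance_comp_nonneg (hX : Measurable X) (hY : Measurable Y)
    (hXf : ∀ z : ℝ, 0 < z → P {ω | X ω ≤ z} = ENNReal.ofReal (Real.exp (-1 / z)))
    (hYf : ∀ z : ℝ, 0 < z → P {ω | Y ω ≤ z} = ENNReal.ofReal (Real.exp (-1 / z)))
    (hmax : ∀ T : ℕ, 1 ≤ T → ∀ a b : ℝ, 0 < a → 0 < b →
      P ({ω | X ω ≤ T * a} ∩ {ω | Y ω ≤ T * b}) ^ T = P ({ω | X ω ≤ a} ∩ {ω | Y ω ≤ b}))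
    {f g : ℝ → ℝ} (hf : Measurable f) (hg : Measurable g)
    (hfm : MonotoneOn f (Set.Ioi 0)) (hgm : MonotoneOn g (Set.Ioi 0))
    (hf2 : MemLp (fun ω => f (X ω)) 2 P) (hg2 : MemLp (fun ω => g (Y ω)) 2 P) :
    0 ≤ cov[fun ω => f (X ω), fun ω => g (Y ω); P] := by
  refine covariance_nonneg_of_quadrant (hf.comp hX) (hg.comp hY) hf2 hg2 fun s t => ?_
  rcases sublevel_ae_eq hX hXf hfm s with hA | hA | ⟨u, hu, hA⟩
  · rw [measure_congr hA]; simp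
  · rw [measure_congr hA, measure_congr (inter_ae_eq_right_of_ae_eq_univ hA)]; simp
  rcases sublevel_ae_eq hY hYf hgm t with hB | hB | ⟨v, hv, hB⟩
  · rw [measure_congr hB]; simp
  · rw [measure_congr hB, measure_congr (inter_ae_eq_left_of_ae_eq_univ hB)]; simp
  · rw [measure_congr hA, measure_congr hB, measure_congr (ae_eq_set_inter hA hB)]
    exact quadrant_of_maxStable hY hXf hYf hu hv fun T hT => hmax T hT u v hu hv

theorem identDistrib_of_frechet (hX : Measurable X) (hY : Measurable Y)
    (hXf : ∀ z : ℝ, 0 < z → P {ω | X ω ≤ z} = ENNReal.ofReal (Real.exp (-1 / z)))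
    (hYf : ∀ z : ℝ, 0 < z → P {ω | Y ω ≤ z} = ENNReal.ofReal (Real.exp (-1 / z))) :
    IdentDistrib X Y P P := by
  refine ⟨hX.aemeasurable, hY.aemeasurable, ?_⟩
  have := Measure.isProbabilityMeasure_map (μ := P) hX.aemeasurable
  refine Measure.ext_of_Iic _ _ fun a => ?_
  rw [Measure.map_apply hX measurableSet_Iic, Measure.map_apply hY measurableSet_Iic]
  rcases lt_or_ge 0 a with ha | ha
  · exact (hXf a ha).trans (hYf a ha).symm
  · have hzero : ∀ {W : Ω → ℝ}, (∀ᵐ ω ∂P, 0 < W ω) → P (W ⁻¹' Set.Iic a) = 0 := fun hW =>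
      measure_mono_null (fun ω hω => not_lt.2 (le_trans hω ha)) (ae_iff.1 hW)
    rw [hzero (ae_pos_of_frechet hXf), hzero (ae_pos_of_frechet hYf)]

/-- A monotone function that takes different values at two positive points is nondegenerate
under the Fréchet law. -/
theorem variance_comp_pos (hX : Measurable X)
    (hXf : ∀ z : ℝ, 0 < z → P {ω | X ω ≤ z} = ENNReal.ofReal (Real.exp (-1 / z)))
    {f : ℝ → ℝ} (hfm : MonotoneOn f (Set.Ioi 0)) (hf2 : MemLp (fun ω => f (X ω)) 2 P)
    {a b : ℝ} (ha : 0 < a) (hb : 0 < b) (hab : f a < f b) :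
    0 < Var[fun ω => f (X ω); P] := by
  refine lt_of_le_of_ne (variance_nonneg _ _) fun h => ?_
  have hconst := ae_eq_integral_of_variance_eq_zero hf2 h.symm
  have hpos := ae_pos_of_frechet hXf
  have hle : ∃ᵐ ω ∂P, X ω ≤ a := by
    rw [frequently_ae_iff, hXf a ha]
    exact (ENNReal.ofReal_pos.2 (Real.exp_pos _)).ne'
  have hgt : ∃ᵐ ω ∂P, b < X ω := by
    rw [frequently_ae_iff]
    intro h0
    have h1 : {ω | b < X ω} = {ω | X ω ≤ b}ᶜ := by ext; simp
    have hlt : Real.exp (-1 / b) < 1 :=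
      Real.exp_lt_one_iff.mpr (div_neg_of_neg_of_pos (by norm_num) hb)
    rw [h1, prob_compl_eq_zero_iff (measurableSet_le hX measurable_const), hXf b hb,
      ENNReal.ofReal_eq_one] at h0
    exact hlt.ne h0
  obtain ⟨ω₁, h₁, hc₁, hp₁⟩ := (hle.and_eventually (hconst.and hpos)).exists
  obtain ⟨ω₂, h₂, hc₂, hp₂⟩ := (hgt.and_eventually (hconst.and hpos)).exists
  have h3 := hfm hp₁ ha h₁
  have h4 := hfm hb hp₂ h₂.le
  linarith

end Frechet

/-- **Positivity of the asymptotic variance.**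
For a simple, strictly stationary, sample-continuous, jointly measurable max-stable random
field `Z` and a Borel measurable, non-decreasing and non-constant `F : (0,∞) → ℝ` with a
`(2+δ)`-moment, the covariance `Cov(F(Z(0)), F(Z(x)))` is nonnegative for every `x`, is
bounded below by some `c > 0` on a ball `‖x‖ ≤ ξ`, and consequently the (possibly infinite)
integral `σ² = ∫_{ℝ^d} Cov(F(Z(0)), F(Z(x))) dx` of this nonnegative function is
strictly positive. -/
theorem sigma2_pos_of_maxStable
    {d : ℕ} (hd : 0 < d) {Ω : Type*} [MeasurableSpace Ω]
    (P : Measure Ω) [IsProbabilityMeasure P]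
    (Z : EuclideanSpace ℝ (Fin d) → Ω → ℝ)
    -- joint measurability
    (hjm : Measurable fun p : EuclideanSpace ℝ (Fin d) × Ω => Z p.1 p.2)
    -- sample continuity
    (hcont : ∀ᵐ ω ∂P, Continuous fun x => Z x ω)
    -- simple: standard Fréchet margins
    (hfrechet : ∀ x, ∀ z : ℝ, 0 < z →
      P {ω | Z x ω ≤ z} = ENNReal.ofReal (Real.exp (-1 / z)))
    -- max-stability of the finite-dimensional distributions
    (hmaxstable : ∀ T : ℕ, 1 ≤ T → ∀ (n : ℕ) (x : Fin n → EuclideanSpace ℝ (Fin d))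
      (z : Fin n → ℝ), (∀ i, 0 < z i) →
      (P {ω | ∀ i, Z (x i) ω ≤ (T : ℝ) * z i}) ^ T = P {ω | ∀ i, Z (x i) ω ≤ z i})
    -- strict stationarity
    (hstat : ∀ (x₀ : EuclideanSpace ℝ (Fin d)) (n : ℕ)
      (x : Fin n → EuclideanSpace ℝ (Fin d)),
      Measure.map (fun ω i => Z (x i + x₀) ω) P = Measure.map (fun ω i => Z (x i) ω) P)
    (δ : ℝ) (hδ : 0 < δ)
    (F : ℝ → ℝ) (hF : Measurable F)
    -- F is non-decreasing on (0,∞)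
    (hFmono : ∀ a b : ℝ, 0 < a → a ≤ b → F a ≤ F b)
    -- F is non-constant on (0,∞)
    (hFnc : ∃ a b : ℝ, 0 < a ∧ 0 < b ∧ F a ≠ F b)
    -- moment condition
    (hmom : Integrable (fun ω => |F (Z 0 ω)| ^ ((2 : ℝ) + δ)) P) :
    (∀ x : EuclideanSpace ℝ (Fin d),
        0 ≤ cov P (fun ω => F (Z 0 ω)) (fun ω => F (Z x ω))) ∧
    (∃ c > 0, ∃ ξ > 0, ∀ x : EuclideanSpace ℝ (Fin d), ‖x‖ ≤ ξ →
        c ≤ cov P (fun ω => F (Z 0 ω)) (fun ω => F (Z x ω))) ∧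
    0 < ∫⁻ x, ENNReal.ofReal (cov P (fun ω => F (Z 0 ω)) (fun ω => F (Z x ω))) ∂volume := by
  have hZ : ∀ x, Measurable (Z x) := fun x =>
    hjm.comp (measurable_const.prodMk measurable_id)
  have hdist : ∀ x, IdentDistrib (Z 0) (Z x) P P := fun x =>
    identDistrib_of_frechet (hZ 0) (hZ x) (hfrechet 0) (hfrechet x)
  have hmax : ∀ x, ∀ T : ℕ, 1 ≤ T → ∀ a b : ℝ, 0 < a → 0 < b →
      P ({ω | Z 0 ω ≤ T * a} ∩ {ω | Z x ω ≤ T * b}) ^ T =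
        P ({ω | Z 0 ω ≤ a} ∩ {ω | Z x ω ≤ b}) := by
    intro x T hT a b ha hb
    have := hmaxstable T hT 2 ![0, x] ![a, b] (by simp [Fin.forall_fin_two, ha, hb])
    simpa [Fin.forall_fin_two, Set.ofPred_and] using this
  have hFm : MonotoneOn F (Set.Ioi 0) := fun a ha b _ hab => hFmono a b ha hab
  have hF0 : MemLp (fun ω => F (Z 0 ω)) 2 P := by
    have hp : MemLp (fun ω => F (Z 0 ω)) (ENNReal.ofReal (2 + δ)) P := by
      have hFZ : AEStronglyMeasurable (fun ω => F (Z 0 ω)) P :=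
        (hF.comp (hZ 0)).aestronglyMeasurable
      rw [← integrable_norm_rpow_iff hFZ (ENNReal.ofReal_pos.2 (by linarith)).ne'
        ENNReal.ofReal_ne_top, ENNReal.toReal_ofReal (by linarith)]
      exact hmom
    refine hp.mono_exponent ?_
    rw [← ENNReal.ofReal_ofNat 2]
    exact ENNReal.ofReal_le_ofReal (by linarith)
  have hF2 : ∀ x, MemLp (fun ω => F (Z x ω)) 2 P := fun x =>
    ((hdist x).comp hF).memLp_iff.1 hF0
  have hcov : ∀ x, cov P (fun ω => F (Z 0 ω)) (fun ω => F (Z x ω)) =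
      cov[fun ω => F (Z 0 ω), fun ω => F (Z x ω); P] := fun x =>
    (covariance_eq_sub hF0 (hF2 x)).symm
  have hnonneg : ∀ x, ∀ {f g : ℝ → ℝ}, Measurable f → Measurable g →
      MonotoneOn f (Set.Ioi 0) → MonotoneOn g (Set.Ioi 0) →
      MemLp (fun ω => f (Z 0 ω)) 2 P → MemLp (fun ω => g (Z x ω)) 2 P →
      0 ≤ cov[fun ω => f (Z 0 ω), fun ω => g (Z x ω); P] := fun x _ _ =>
    covariance_comp_nonneg (hZ 0) (hZ x) (hfrechet 0) (hfrechet x) (hmax x)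
  obtain ⟨a, b, ha, hb, hab⟩ : ∃ a b : ℝ, 0 < a ∧ 0 < b ∧ F a < F b := by
    obtain ⟨a, b, ha, hb, hne⟩ := hFnc
    rcases lt_or_gt_of_ne hne with h | h
    exacts [⟨a, b, ha, hb, h⟩, ⟨b, a, hb, ha, h⟩]
  set C : ℝ → ℝ := fun z => max (F a) (min (F z) (F b)) with hC
  have hCmeas : Measurable C := measurable_const.max (hF.min measurable_const)
  have hCm : MonotoneOn C (Set.Ioi 0) := fun u hu v hv huv =>
    max_le_max_left _ (min_le_min_right _ (hFm hu hv huv))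
  have hRmeas : Measurable fun z => F z - C z := hF.sub hCmeas
  have hRm : MonotoneOn (fun z => F z - C z) (Set.Ioi 0) := by
    intro u hu v hv huv
    have := hFm hu hv huv
    simp only [hC]
    grind
  have hCbdd : ∀ z, |C z| ≤ max |F a| |F b| := fun z =>
    abs_le_max_abs_abs (le_max_left _ _) (max_le hab.le (min_le_right _ _))
  have hC2 : ∀ x, MemLp (fun ω => C (Z x ω)) 2 P := fun x =>
    MemLp.of_bound (hCmeas.comp (hZ x)).aestronglyMeasurable _ (ae_of_all _ fun ω => hCbdd _)
  have hR2 : ∀ x, MemLp (fun ω => F (Z x ω) - C (Z x ω)) 2 P := fun x => (hF2 x).sub (hC2 x)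
  have htrunc : ∀ x, cov[fun ω => C (Z 0 ω), fun ω => C (Z x ω); P] ≤
      cov[fun ω => F (Z 0 ω), fun ω => F (Z x ω); P] := by
    intro x
    have h1 := hnonneg x hRmeas hF hRm hFm (hR2 0) (hF2 x)
    have h2 := hnonneg x hCmeas hRmeas hCm hRm (hC2 0) (hR2 x)
    rw [covariance_fun_sub_left hF0 (hC2 0) (hF2 x)] at h1
    rw [covariance_fun_sub_right (hC2 0) (hF2 x) (hC2 x)] at h2
    linarith
  have hvar : 0 < Var[fun ω => C (Z 0 ω); P] :=
    variance_comp_pos (hZ 0) (hfrechet 0) hCm (hC2 0) ha hb (by simp [hC, hab, hab.le])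
  have hCcont : ∀ᵐ ω ∂P, ContinuousAt C (Z 0 ω) := by
    have hnull : ∀ u, 0 < u → ∀ᵐ ω ∂P, Z 0 ω ≠ u := fun u hu => by
      simpa [ae_iff] using measure_eq_zero_of_frechet (hZ 0) (hfrechet 0) hu
    have := (ae_ball_iff hCm.countable_not_continuousWithinAt).2 fun u hu => hnull u hu.1
    filter_upwards [this, ae_pos_of_frechet (hfrechet 0)] with ω hω hpos
    by_contra hcon
    exact hω _ ⟨hpos, fun h => hcon (h.continuousAt (Ioi_mem_nhds hpos))⟩ rfl
  have hlim : Tendsto (fun x => cov[fun ω => C (Z 0 ω), fun ω => C (Z x ω); P]) (𝓝 0)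
      (𝓝 Var[fun ω => C (Z 0 ω); P]) := by
    rw [← covariance_self (hC2 0).1.aemeasurable, covariance_eq_sub (hC2 0) (hC2 0)]
    have hmean : ∀ x, ∫ ω, C (Z x ω) ∂P = ∫ ω, C (Z 0 ω) ∂P := fun x =>
      ((hdist x).comp hCmeas).integral_eq.symm
    have hsub : ∀ x, cov[fun ω => C (Z 0 ω), fun ω => C (Z x ω); P] =
        ∫ ω, C (Z 0 ω) * C (Z x ω) ∂P - (∫ ω, C (Z 0 ω) ∂P) * ∫ ω, C (Z 0 ω) ∂P := fun x => by
      rw [covariance_eq_sub (hC2 0) (hC2 x), hmean x]; rfl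
    rw [funext hsub]
    refine Tendsto.sub_const ?_ _
    refine tendsto_integral_filter_of_dominated_convergence
      (fun _ => max |F a| |F b| * max |F a| |F b|)
      (Eventually.of_forall fun x => (hC2 0).1.mul (hC2 x).1)
      (Eventually.of_forall fun x => ae_of_all _ fun ω => ?_) (integrable_const _) ?_
    · rw [Real.norm_eq_abs, abs_mul]
      exact mul_le_mul (hCbdd _) (hCbdd _) (abs_nonneg _) ((abs_nonneg _).trans (hCbdd 0))
    · filter_upwards [hCcont, hcont] with ω hω hc
      exact tendsto_const_nhds.mul (hω.tendsto.comp (hc.tendsto 0))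
  have hlower : ∃ c > 0, ∃ ξ > 0, ∀ x : EuclideanSpace ℝ (Fin d), ‖x‖ ≤ ξ →
      c ≤ cov P (fun ω => F (Z 0 ω)) (fun ω => F (Z x ω)) := by
    obtain ⟨ξ, hξ, hball⟩ := Metric.nhds_basis_closedBall.eventually_iff.1
      (hlim.eventually (lt_mem_nhds (half_lt_self hvar)))
    refine ⟨_, half_pos hvar, ξ, hξ, fun x hx => ?_⟩
    rw [hcov]
    exact (hball (mem_closedBall_zero_iff.2 hx)).le.trans (htrunc x)
  refine ⟨fun x => ?_, hlower, ?_⟩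
  · rw [hcov]
    exact hnonneg x hF hF hFm hFm hF0 (hF2 x)
  obtain ⟨c, hc, ξ, hξ, hle⟩ := hlower
  calc (0 : ℝ≥0∞)
      < ENNReal.ofReal c * volume (Metric.closedBall (0 : EuclideanSpace ℝ (Fin d)) ξ) :=
        ENNReal.mul_pos (ENNReal.ofReal_pos.2 hc).ne'
          (Metric.measure_closedBall_pos volume _ hξ).ne'
    _ = ∫⁻ _ in Metric.closedBall (0 : EuclideanSpace ℝ (Fin d)) ξ, ENNReal.ofReal c :=
        (setLIntegral_const _ _).symm
    _ ≤ ∫⁻ x in Metric.closedBall (0 : EuclideanSpace ℝ (Fin d)) ξ,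
          ENNReal.ofReal (cov P (fun ω => F (Z 0 ω)) (fun ω => F (Z x ω))) :=
        setLIntegral_mono' Metric.isClosed_closedBall.measurableSet fun x hx =>
          ENNReal.ofReal_le_ofReal (hle x (mem_closedBall_zero_iff.1 hx))
    _ ≤ _ := setLIntegral_le_lintegral _ _

end
end

section
/- Let {W(x)}_{x∈ℝ^d} be a centred Gaussian random field with stationary increments, sample-continuous, with W(0) = 0 almost surely, and set σ²_W(x) = E[W(x)²]. Assume: (i) for every ε > 0 there is M > 0 such that for all h ∈ ℤ^d with ‖h‖ ≥ M, sup_{x∈[0,1]^d}(σ²_W(h) − σ²_W(x+h)) ≤ ε·σ²_W(h); and (ii) for every C > 0 there is M > 0 such that σ²_W(h) ≥ C·ln(‖h‖) for all h ∈ ℤ^d with ‖h‖ ≥ M. Define Y(x) = exp(W(x) − σ²_W(x)/2). Then for every b > 0 there exists K > 0 such that for all nonzero h ∈ ℤ^d, E[min{ sup_{x∈[0,1]^d} Y(x), sup_{x∈[h,h+1]} Y(x) }] ≤ K‖h‖^{−b}. -/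
open MeasureTheory ProbabilityTheory Filter Topology
open scoped ENNReal NNReal

noncomputable section

/-- The lattice point `h ∈ ℤ^d` viewed as a point of Euclidean space `ℝ^d`. -/
def toE {d : ℕ} (h : Fin d → ℤ) : EuclideanSpace ℝ (Fin d) :=
  (EuclideanSpace.equiv (Fin d) ℝ).symm fun i => (h i : ℝ)

/-- The unit cube `[h, h+1] ⊆ ℝ^d` based at a lattice point `h ∈ ℤ^d`. -/
def cube {d : ℕ} (h : Fin d → ℤ) : Set (EuclideanSpace ℝ (Fin d)) :=
  {x | ∀ i, (h i : ℝ) ≤ x i ∧ x i ≤ (h i : ℝ) + 1}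


/-- Uniform exponential moment for finite-dimensional centred Gaussian measures. -/
theorem exists_lintegral_exp_two_mul_norm_le {a : ℝ} (ha : 0 < a) :
    ∃ K : ℝ≥0∞, K ≠ ∞ ∧ ∀ (N : ℕ) (μ : Measure (Fin N → ℝ)), IsGaussian μ →
      (∀ L : StrongDual ℝ (Fin N → ℝ), μ[L] = 0) → 3 / 4 ≤ μ {x | ‖x‖ ≤ a} →
      ∫⁻ x, ENNReal.ofReal (Real.exp (2 * ‖x‖)) ∂μ ≤ K := by
  have hc : (2 : ℝ≥0∞)⁻¹ < 3 / 4 := by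
    rw [← ENNReal.toReal_lt_toReal (by simp) (ENNReal.div_ne_top (by simp) (by simp))]
    simp only [ENNReal.toReal_inv, ENNReal.toReal_div, ENNReal.toReal_ofNat]
    norm_num
  have hc1 : (3 / 4 : ℝ≥0∞) < 1 := by
    rw [← ENNReal.toReal_lt_toReal (ENNReal.div_ne_top (by simp) (by simp)) (by simp)]
    simp only [ENNReal.toReal_div, ENNReal.toReal_ofNat, ENNReal.toReal_one]
    norm_num
  have hlog : 0 < Real.log ((3 / 4 : ℝ≥0∞) / (1 - 3 / 4)).toReal := by
    apply Real.log_pos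
    rw [ENNReal.toReal_div, ENNReal.toReal_sub_of_le hc1.le (by simp)]
    simp only [ENNReal.toReal_div, ENNReal.toReal_ofNat, ENNReal.toReal_one]
    norm_num
  have hD : 0 < Fernique.logRatio (3 / 4) * a⁻¹ ^ 2 :=
    mul_pos (Fernique.logRatio_pos hc hc1) (by positivity)
  set D := Fernique.logRatio (3 / 4) * a⁻¹ ^ 2
  set R : ℝ≥0∞ := ENNReal.ofReal (Real.exp (Fernique.logRatio (3 / 4)))
        + ∑' n : ℕ, ENNReal.ofReal (Real.exp
          (-2⁻¹ * Real.log ((3 / 4 : ℝ≥0∞) / (1 - 3 / 4)).toReal * 2 ^ n))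
  have hRtop : R ≠ ∞ := by
    refine ENNReal.add_ne_top.2 ⟨ENNReal.ofReal_ne_top, ?_⟩
    exact Summable.tsum_ofReal_ne_top <| Real.summable_exp_nat_mul_of_ge (by linarith)
      fun i => mod_cast (Nat.lt_pow_self (by simp)).le
  refine ⟨ENNReal.ofReal (Real.exp D⁻¹) * R, ENNReal.mul_ne_top ENNReal.ofReal_ne_top hRtop, ?_⟩
  intro N μ hμ hL hmass
  have h1 := lintegral_exp_mul_sq_norm_le_of_map_rotation_eq_self
    (IsGaussian.map_rotation_eq_self_of_forall_strongDual_eq_zero hL _) hmass hc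
  calc ∫⁻ x, ENNReal.ofReal (Real.exp (2 * ‖x‖)) ∂μ
      ≤ ∫⁻ x, ENNReal.ofReal (Real.exp D⁻¹) * ENNReal.ofReal (Real.exp (D * ‖x‖ ^ 2)) ∂μ := by
        refine lintegral_mono fun x => ?_
        rw [← ENNReal.ofReal_mul (Real.exp_pos _).le, ← Real.exp_add]
        refine ENNReal.ofReal_le_ofReal (Real.exp_le_exp.2 ?_)
        have h : D⁻¹ + D * ‖x‖ ^ 2 - 2 * ‖x‖ = D⁻¹ * (D * ‖x‖ - 1) ^ 2 := by
          field_simp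
          ring
        have : 0 ≤ D⁻¹ * (D * ‖x‖ - 1) ^ 2 := by positivity
        linarith
    _ = ENNReal.ofReal (Real.exp D⁻¹) * ∫⁻ x, ENNReal.ofReal (Real.exp (D * ‖x‖ ^ 2)) ∂μ :=
        lintegral_const_mul _ (by fun_prop)
    _ ≤ _ := by gcongr

/-- For an almost surely bounded centred Gaussian sequence, the exponential moments of the finite
sections are uniformly bounded. -/
theorem exists_forall_lintegral_exp_two_mul_norm_le {Ω : Type*} [MeasurableSpace Ω]
    (P : Measure Ω) [IsProbabilityMeasure P] (V : ℕ → Ω → ℝ) (hV : ∀ n, Measurable (V n))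
    (hgauss : ∀ (n : ℕ) (c : Fin n → ℝ),
      ∃ v : ℝ≥0, Measure.map (fun ω => ∑ i, c i * V i ω) P = gaussianReal 0 v)
    (hbdd : ∀ᵐ ω ∂P, ∃ C : ℝ, ∀ n, |V n ω| ≤ C) :
    ∃ K : ℝ≥0∞, K ≠ ∞ ∧ ∀ N : ℕ,
      ∫⁻ ω, ENNReal.ofReal (Real.exp (2 * ‖fun i : Fin N => V i ω‖)) ∂P ≤ K := by
  let S : ℕ → Set Ω := fun n => {ω | ∀ k, |V k ω| ≤ n}
  have hS : Monotone S := fun m n hmn ω hω k => (hω k).trans (by exact_mod_cast hmn)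
  have hU : P (⋃ n, S n) = 1 := by
    rw [← measure_univ (μ := P)]
    refine measure_congr (eventuallyEq_univ.2 ?_)
    filter_upwards [hbdd] with ω ⟨C, hC⟩
    obtain ⟨n, hn⟩ := exists_nat_ge C
    exact Set.mem_iUnion.2 ⟨n, fun k => (hC k).trans hn⟩
  have ht := tendsto_measure_iUnion_atTop (μ := P) hS
  rw [hU] at ht
  have hc1 : (3 / 4 : ℝ≥0∞) < 1 := by
    rw [← ENNReal.toReal_lt_toReal (ENNReal.div_ne_top (by simp) (by simp)) (by simp)]
    simp only [ENNReal.toReal_div, ENNReal.toReal_ofNat, ENNReal.toReal_one]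
    norm_num
  obtain ⟨n, hn, hn0⟩ := ((ht.eventually (lt_mem_nhds hc1)).and (eventually_gt_atTop 0)).exists
  obtain ⟨K, hK, hKb⟩ := exists_lintegral_exp_two_mul_norm_le (a := n) (by exact_mod_cast hn0)
  refine ⟨K, hK, fun N => ?_⟩
  have hm : Measurable fun ω => fun i : Fin N => V i ω := measurable_pi_lambda _ fun i => hV i
  have hlaw : ∀ L : StrongDual ℝ (Fin N → ℝ), ∃ v : ℝ≥0,
      (P.map fun ω => fun i : Fin N => V i ω).map L = gaussianReal 0 v := by
    intro L
    obtain ⟨v, hv⟩ := hgauss N fun i => L (Pi.single i 1)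
    refine ⟨v, ?_⟩
    rw [Measure.map_map (by fun_prop) hm, ← hv]
    congr 1
    ext ω
    simp only [Function.comp_apply]
    conv_lhs => rw [pi_eq_sum_univ' (fun i : Fin N => V i ω)]
    simp only [map_sum, map_smul, smul_eq_mul]
    refine Finset.sum_congr rfl fun i _ => ?_
    rw [mul_comm]
  have hG : IsGaussian (P.map fun ω => fun i : Fin N => V i ω) :=
    isGaussian_of_map_eq_gaussianReal fun L => ⟨0, hlaw L⟩
  have := hKb N _ hG (fun L => ?_) ?_
  · rwa [lintegral_map (by fun_prop) hm] at this
  · obtain ⟨v, hv⟩ := hlaw L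
    have := integral_map (μ := P.map fun ω => fun i : Fin N => V i ω) (φ := L) (by fun_prop)
      (f := id) (by fun_prop)
    simpa [hv, eq_comm] using this
  · rw [Measure.map_apply hm (measurableSet_le (by fun_prop) (by fun_prop))]
    refine hn.le.trans (measure_mono fun ω hω => ?_)
    exact (pi_norm_le_iff_of_nonneg (Nat.cast_nonneg n)).2 fun i => hω i

/-- The supremum `sup_n exp (2 |v n|)`, as an extended nonnegative real. -/
def supExp (v : ℕ → ℝ) : ℝ≥0∞ := ⨆ N : ℕ, ENNReal.ofReal (Real.exp (2 * ‖fun i : Fin N => v i‖))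

theorem norm_fin_le_norm_fin (v : ℕ → ℝ) {m n : ℕ} (hmn : m ≤ n) :
    ‖fun i : Fin m => v i‖ ≤ ‖fun i : Fin n => v i‖ :=
  (pi_norm_le_iff_of_nonneg (norm_nonneg _)).2 fun i =>
    norm_le_pi_norm (fun i : Fin n => v i) (i.castLE hmn)

theorem measurable_supExp {Ω : Type*} [MeasurableSpace Ω] {V : ℕ → Ω → ℝ}
    (hV : ∀ n, Measurable (V n)) : Measurable fun ω => supExp fun n => V n ω := by
  unfold supExp
  refine Measurable.iSup fun N => ?_
  have hm : Measurable fun ω => fun i : Fin N => V i ω := measurable_pi_lambda _ fun i => hV i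
  fun_prop

theorem lintegral_supExp_le {Ω : Type*} [MeasurableSpace Ω] {P : Measure Ω} {V : ℕ → Ω → ℝ}
    (hV : ∀ n, Measurable (V n)) {K : ℝ≥0∞}
    (hK : ∀ N : ℕ, ∫⁻ ω, ENNReal.ofReal (Real.exp (2 * ‖fun i : Fin N => V i ω‖)) ∂P ≤ K) :
    ∫⁻ ω, supExp (fun n => V n ω) ∂P ≤ K := by
  unfold supExp
  rw [lintegral_iSup]
  · exact iSup_le hK
  · intro N
    have hm : Measurable fun ω => fun i : Fin N => V i ω := measurable_pi_lambda _ fun i => hV i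
    fun_prop
  · intro m n hmn ω
    have := norm_fin_le_norm_fin (fun n => V n ω) hmn
    dsimp only
    gcongr

theorem exp_two_mul_abs_le_toReal_supExp {X : Type*} [TopologicalSpace X] {q : ℕ → X}
    (hq : DenseRange q) {f : X → ℝ} (hf : Continuous f)
    (hfin : supExp (fun n => f (q n)) ≠ ∞) (x : X) :
    Real.exp (2 * |f x|) ≤ (supExp fun n => f (q n)).toReal := by
  refine hq.induction_on (p := fun x => Real.exp (2 * |f x|) ≤ _) x
    (isClosed_le (by fun_prop) continuous_const) fun n => ?_
  refine (ENNReal.ofReal_le_iff_le_toReal hfin).1 (le_trans ?_ (le_iSup _ (n + 1)))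
  refine ENNReal.ofReal_le_ofReal (Real.exp_le_exp.2 ?_)
  have := norm_le_pi_norm (fun i : Fin (n + 1) => f (q i)) (Fin.last n)
  simp only [Fin.val_last, Real.norm_eq_abs] at this
  linarith

theorem min_exp_le_half_add (m₀ m w s : ℝ) :
    min (Real.exp m₀) (Real.exp (m + w - 3 / 8 * s)) ≤
      (Real.exp (-s / 32) * (Real.exp (2 * m₀) + Real.exp (2 * m))
        + Real.exp (1 / 2 * w) * Real.exp (-5 * s / 32)) / 2 := by
  rw [← Real.exp_add, ← Real.exp_monotone.map_min]
  set A := 3 / 2 * m₀ + 1 / 2 * m - s / 32 with hA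
  set B := 1 / 2 * w + -5 * s / 32 with hB
  have h1 : min m₀ (m + w - 3 / 8 * s) ≤ A / 2 + B / 2 := by
    have h₁ := min_le_left m₀ (m + w - 3 / 8 * s)
    have h₂ := min_le_right m₀ (m + w - 3 / 8 * s)
    linarith
  have h2 : Real.exp A ≤ Real.exp (-s / 32) * (Real.exp (2 * m₀) + Real.exp (2 * m)) := by
    rw [mul_add, ← Real.exp_add, ← Real.exp_add]
    rcases le_total m₀ m with h | h
    · have : Real.exp A ≤ Real.exp (-s / 32 + 2 * m) := Real.exp_le_exp.2 (by linarith)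
      linarith [Real.exp_pos (-s / 32 + 2 * m₀)]
    · have : Real.exp A ≤ Real.exp (-s / 32 + 2 * m₀) := Real.exp_le_exp.2 (by linarith)
      linarith [Real.exp_pos (-s / 32 + 2 * m)]
  have h3 : Real.exp (A / 2 + B / 2) ≤ (Real.exp A + Real.exp B) / 2 := by
    have hA' : Real.exp A = Real.exp (A / 2) ^ 2 := by
      rw [← Real.exp_nat_mul]
      congr 1
      push_cast
      ring
    have hB' : Real.exp B = Real.exp (B / 2) ^ 2 := by
      rw [← Real.exp_nat_mul]
      congr 1
      push_cast
      ring
    rw [Real.exp_add, hA', hB']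
    nlinarith [sq_nonneg (Real.exp (A / 2) - Real.exp (B / 2))]
  have h4 := Real.exp_le_exp.2 h1
  linarith

theorem isCompact_cube {d : ℕ} (h : Fin d → ℤ) : IsCompact (cube h) := by
  have : cube h = (EuclideanSpace.equiv (Fin d) ℝ).toHomeomorph ⁻¹'
      Set.Icc (fun i => (h i : ℝ)) (fun i => (h i : ℝ) + 1) := by
    ext x
    simp only [cube, Set.mem_preimage, Set.mem_Icc, Pi.le_def]
    exact ⟨fun H => ⟨fun i => (H i).1, fun i => (H i).2⟩, fun H i => ⟨H.1 i, H.2 i⟩⟩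
  rw [this]
  exact (Homeomorph.isCompact_preimage _).2 isCompact_Icc

theorem toE_apply {d : ℕ} (h : Fin d → ℤ) (i : Fin d) : toE h i = h i := rfl

theorem toE_mem_cube {d : ℕ} (h : Fin d → ℤ) : toE h ∈ cube h := fun i => by
  simp [toE_apply]

theorem sub_toE_mem_cube_zero {d : ℕ} {h : Fin d → ℤ} {x : EuclideanSpace ℝ (Fin d)}
    (hx : x ∈ cube h) : x - toE h ∈ cube (0 : Fin d → ℤ) := fun i => by
  have := hx i
  simp only [PiLp.sub_apply, toE_apply, Pi.zero_apply, Int.cast_zero]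
  constructor <;> linarith

theorem norm_toE_pos {d : ℕ} {h : Fin d → ℤ} (hh : h ≠ 0) : 0 < ‖toE h‖ := by
  refine norm_pos_iff.2 fun H => hh ?_
  ext i
  have := congrArg (fun x : EuclideanSpace ℝ (Fin d) => x i) H
  simpa [toE_apply] using this

theorem exists_exp_two_mul_eq_and_abs_le {X : Type*} {S : Set X} [Nonempty S] {f : X → ℝ} {c : ℝ}
    (h : ∀ x : S, Real.exp (2 * |f x|) ≤ c) :
    ∃ m, 0 ≤ m ∧ Real.exp (2 * m) = c ∧ ∀ x ∈ S, |f x| ≤ m := by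
  obtain ⟨x₀⟩ := ‹Nonempty S›
  have hc : 0 < c := (Real.exp_pos _).trans_le (h x₀)
  have hm (x) (hx : x ∈ S) : |f x| ≤ Real.log c / 2 := by
    have := (Real.le_log_iff_exp_le hc).2 (h ⟨x, hx⟩)
    linarith
  refine ⟨Real.log c / 2, (abs_nonneg _).trans (hm x₀ x₀.2), ?_, hm⟩
  rw [mul_div_cancel₀ _ two_ne_zero, Real.exp_log hc]

/-- **Decay of the joint spectral tail of the Brown–Resnick spectral field.**
Let `W` be a centred Gaussian random field with stationary increments, sample-continuous,
with `W(0) = 0` a.s., and `σ²_W(x) = E[W(x)²]`. Under conditions (i) (the supremum of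
`σ²_W(h) − σ²_W(x+h)` over `x ∈ [0,1]^d` is `o(σ²_W(h))`) and (ii) (`σ²_W(h)/ln‖h‖ → ∞`),
the spectral field `Y(x) = exp(W(x) − σ²_W(x)/2)` satisfies: for every `b > 0` there is
`K > 0` with `E[min{sup_{[0,1]^d} Y, sup_{[h,h+1]} Y}] ≤ K‖h‖^{−b}` for all nonzero
`h ∈ ℤ^d`. -/
theorem brownResnick_spectral_decay
    {d : ℕ} (hd : 0 < d) {Ω : Type*} [MeasurableSpace Ω]
    (P : Measure Ω) [IsProbabilityMeasure P]
    (W : EuclideanSpace ℝ (Fin d) → Ω → ℝ)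
    (hmeas : ∀ x, Measurable (W x))
    -- centred Gaussian random field: every finite linear combination is centred Gaussian
    (hgauss : ∀ (n : ℕ) (x : Fin n → EuclideanSpace ℝ (Fin d)) (c : Fin n → ℝ),
      ∃ v : ℝ≥0, Measure.map (fun ω => ∑ i, c i * W (x i) ω) P = gaussianReal 0 v)
    -- stationary increments
    (hinc : ∀ (x₀ : EuclideanSpace ℝ (Fin d)) (n : ℕ)
      (x : Fin n → EuclideanSpace ℝ (Fin d)),
      Measure.map (fun ω i => W (x i + x₀) ω - W x₀ ω) P
        = Measure.map (fun ω i => W (x i) ω - W 0 ω) P)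
    -- sample continuity
    (hcont : ∀ᵐ ω ∂P, Continuous fun x => W x ω)
    -- W(0) = 0 almost surely
    (hW0 : ∀ᵐ ω ∂P, W 0 ω = 0)
    -- the variance function
    (sW2 : EuclideanSpace ℝ (Fin d) → ℝ)
    (hsW2 : ∀ x, sW2 x = ∫ ω, (W x ω) ^ 2 ∂P)
    -- condition (i)
    (hi : ∀ ε > (0 : ℝ), ∃ M > (0 : ℝ), ∀ h : Fin d → ℤ, M ≤ ‖toE h‖ →
      ∀ x ∈ cube (0 : Fin d → ℤ), sW2 (toE h) - sW2 (x + toE h) ≤ ε * sW2 (toE h))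
    -- condition (ii)
    (hii : ∀ C > (0 : ℝ), ∃ M > (0 : ℝ), ∀ h : Fin d → ℤ, M ≤ ‖toE h‖ →
      C * Real.log ‖toE h‖ ≤ sW2 (toE h))
    -- the spectral field
    (Y : EuclideanSpace ℝ (Fin d) → Ω → ℝ)
    (hY : ∀ x ω, Y x ω = Real.exp (W x ω - sW2 x / 2)) :
    ∀ b > (0 : ℝ), ∃ K > (0 : ℝ), ∀ h : Fin d → ℤ, h ≠ 0 →
      ∫ ω, min (sSup ((fun x => Y x ω) '' cube (0 : Fin d → ℤ)))
               (sSup ((fun x => Y x ω) '' cube h)) ∂P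
        ≤ K * ‖toE h‖ ^ (-b) := by
  have hne : Nonempty (cube (0 : Fin d → ℤ)) := ⟨⟨_, toE_mem_cube 0⟩⟩
  have hcpt : CompactSpace (cube (0 : Fin d → ℤ)) :=
    isCompact_iff_compactSpace.1 (isCompact_cube 0)
  obtain ⟨q, hq⟩ := TopologicalSpace.exists_dense_seq (cube (0 : Fin d → ℤ))
  have hlaw (x) : ∃ v : ℝ≥0, P.map (W x) = gaussianReal 0 v ∧ sW2 x = v := by
    obtain ⟨v, hv⟩ := hgauss 1 (fun _ => x) (fun _ => 1)
    simp only [one_mul, Finset.univ_unique, Finset.sum_const, Finset.card_singleton,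
      one_smul] at hv
    refine ⟨v, hv, ?_⟩
    have h1 := variance_fun_id_gaussianReal (μ := 0) (v := v)
    rw [variance_eq_integral measurable_id'.aemeasurable, integral_id_gaussianReal, ← hv,
      integral_map (hmeas x).aemeasurable (by fun_prop)] at h1
    simpa [hsW2] using h1
  have hs0 (x) : 0 ≤ sW2 x := by
    rw [hsW2]
    positivity
  let V (h : Fin d → ℤ) (n : ℕ) (ω : Ω) : ℝ := W (q n + toE h) ω - W (toE h) ω
  have hVm (h) (n) : Measurable (V h n) := (hmeas _).sub (hmeas _)
  have hV0m (n) : Measurable (W (q n)) := hmeas _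
  obtain ⟨K, hK, hKb⟩ := exists_forall_lintegral_exp_two_mul_norm_le P (fun n => W (q n)) hV0m
    (fun n c => hgauss n (fun i => q i) c) (by
      filter_upwards [hcont] with ω hω
      have hc : Continuous fun x : cube (0 : Fin d → ℤ) => |W x ω| := by fun_prop
      obtain ⟨C, hC⟩ := (isCompact_range hc).bddAbove
      exact ⟨C, fun n => hC ⟨q n, rfl⟩⟩)
  have hKV (h) (N : ℕ) :
      ∫⁻ ω, ENNReal.ofReal (Real.exp (2 * ‖fun i : Fin N => V h i ω‖)) ∂P ≤ K := by
    have hm : Measurable fun ω => fun i : Fin N => V h i ω :=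
      measurable_pi_lambda _ fun i => hVm h i
    have hm0 : Measurable fun ω => fun i : Fin N => W (q i) ω - W 0 ω :=
      measurable_pi_lambda _ fun i => (hmeas _).sub (hmeas _)
    calc ∫⁻ ω, ENNReal.ofReal (Real.exp (2 * ‖fun i : Fin N => V h i ω‖)) ∂P
        = ∫⁻ x, ENNReal.ofReal (Real.exp (2 * ‖x‖)) ∂(P.map fun ω => fun i : Fin N => V h i ω) :=
          by rw [lintegral_map (by fun_prop) hm]
      _ = ∫⁻ ω, ENNReal.ofReal (Real.exp (2 * ‖fun i : Fin N => W (q i) ω - W 0 ω‖)) ∂P := by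
          rw [hinc (toE h) N fun i => q i, lintegral_map (by fun_prop) hm0]
      _ = ∫⁻ ω, ENNReal.ofReal (Real.exp (2 * ‖fun i : Fin N => W (q i) ω‖)) ∂P := by
          refine lintegral_congr_ae ?_
          filter_upwards [hW0] with ω hω
          simp [hω]
      _ ≤ K := hKb N
  let g₀ (ω : Ω) : ℝ≥0∞ := supExp fun n => W (q n) ω
  let g (h : Fin d → ℤ) (ω : Ω) : ℝ≥0∞ := supExp fun n => V h n ω
  have hg₀m : Measurable g₀ := measurable_supExp hV0m
  have hgm (h) : Measurable (g h) := measurable_supExp (hVm h)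
  have hg₀ : ∫⁻ ω, g₀ ω ∂P ≤ K := lintegral_supExp_le hV0m hKb
  have hg (h) : ∫⁻ ω, g h ω ∂P ≤ K := lintegral_supExp_le (hVm h) (hKV h)
  have hg₀top : ∫⁻ ω, g₀ ω ∂P ≠ ∞ := ne_top_of_le_ne_top hK hg₀
  have hgtop (h) : ∫⁻ ω, g h ω ∂P ≠ ∞ := ne_top_of_le_ne_top hK (hg h)
  have hg₀fin : ∀ᵐ ω ∂P, g₀ ω < ∞ := ae_lt_top hg₀m hg₀top
  have hgfin (h) : ∀ᵐ ω ∂P, g h ω < ∞ := ae_lt_top (hgm h) (hgtop h)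
  have hg₀i : Integrable (fun ω => (g₀ ω).toReal) P :=
    integrable_toReal_of_lintegral_ne_top hg₀m.aemeasurable hg₀top
  have hgi (h) : Integrable (fun ω => (g h ω).toReal) P :=
    integrable_toReal_of_lintegral_ne_top (hgm h).aemeasurable (hgtop h)
  have hg₀K : ∫ ω, (g₀ ω).toReal ∂P ≤ K.toReal := by
    rw [integral_toReal hg₀m.aemeasurable hg₀fin]
    exact ENNReal.toReal_mono hK hg₀
  have hgK (h) : ∫ ω, (g h ω).toReal ∂P ≤ K.toReal := by
    rw [integral_toReal (hgm h).aemeasurable (hgfin h)]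
    exact ENNReal.toReal_mono hK (hg h)
  have hbound₀ : ∀ᵐ ω ∂P, ∃ m, 0 ≤ m ∧ Real.exp (2 * m) = (g₀ ω).toReal ∧
      ∀ x ∈ cube (0 : Fin d → ℤ), |W x ω| ≤ m := by
    filter_upwards [hcont, hg₀fin] with ω hω hfin
    have H (x : cube (0 : Fin d → ℤ)) := exp_two_mul_abs_le_toReal_supExp hq
      (f := fun x : cube (0 : Fin d → ℤ) => W x ω) (by fun_prop) hfin.ne x
    exact exists_exp_two_mul_eq_and_abs_le H
  have hbound (h) : ∀ᵐ ω ∂P, ∃ m, 0 ≤ m ∧ Real.exp (2 * m) = (g h ω).toReal ∧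
      ∀ x ∈ cube (0 : Fin d → ℤ), |W (x + toE h) ω - W (toE h) ω| ≤ m := by
    filter_upwards [hcont, hgfin h] with ω hω hfin
    have H (x : cube (0 : Fin d → ℤ)) := exp_two_mul_abs_le_toReal_supExp hq
      (f := fun x : cube (0 : Fin d → ℤ) => W (x + toE h) ω - W (toE h) ω) (by fun_prop) hfin.ne x
    exact exists_exp_two_mul_eq_and_abs_le H
  have hsup₀ {ω m} (hm : ∀ x ∈ cube (0 : Fin d → ℤ), |W x ω| ≤ m) :
      sSup ((fun x => Y x ω) '' cube (0 : Fin d → ℤ)) ≤ Real.exp m := by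
    refine csSup_le (Set.Nonempty.image _ ⟨_, toE_mem_cube 0⟩) ?_
    rintro _ ⟨x, hx, rfl⟩
    simp only [hY]
    refine Real.exp_le_exp.2 ?_
    have := (le_abs_self _).trans (hm x hx)
    linarith [hs0 x]
  have hnonneg (h : Fin d → ℤ) (ω) : 0 ≤ sSup ((fun x => Y x ω) '' cube h) := by
    refine Real.sSup_nonneg ?_
    rintro _ ⟨x, -, rfl⟩
    simp only [hY]
    positivity
  intro b hb
  obtain ⟨M₁, -, hM₁⟩ := hi (1 / 4) (by norm_num)
  obtain ⟨M₂, -, hM₂⟩ := hii (32 * b) (by positivity)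
  set M := max 1 (max M₁ M₂)
  have hMpos : 0 < M := lt_of_lt_of_le one_pos (le_max_left _ _)
  have hK0 : 0 ≤ K.toReal := ENNReal.toReal_nonneg
  have hMb : 0 < M ^ b := Real.rpow_pos_of_pos hMpos b
  refine ⟨(K.toReal + 1) * (1 + M ^ b), by positivity, fun h hh => ?_⟩
  have hpos := norm_toE_pos hh
  have hpow : 0 < ‖toE h‖ ^ (-b) := Real.rpow_pos_of_pos hpos _
  rcases lt_or_ge ‖toE h‖ M with hlt | hge
  · have h1 : 1 ≤ M ^ b * ‖toE h‖ ^ (-b) := by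
      rw [Real.rpow_neg hpos.le, ← div_eq_mul_inv, one_le_div (Real.rpow_pos_of_pos hpos _)]
      exact Real.rpow_le_rpow hpos.le hlt.le hb.le
    calc _ ≤ ∫ ω, (g₀ ω).toReal ∂P := by
          refine integral_mono_of_nonneg
            (ae_of_all _ fun ω => le_min (hnonneg 0 ω) (hnonneg h ω)) hg₀i ?_
          filter_upwards [hbound₀] with ω ⟨m, hm0, hme, hm⟩
          rw [← hme]
          refine (min_le_left _ _).trans ((hsup₀ hm).trans (Real.exp_le_exp.2 (by linarith)))
      _ ≤ K.toReal := hg₀K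
      _ ≤ (K.toReal + 1) * (1 + M ^ b) * ‖toE h‖ ^ (-b) := by nlinarith
  · set s := sW2 (toE h) with hs
    have hge₁ : M₁ ≤ ‖toE h‖ := (le_max_left _ _).trans ((le_max_right _ _).trans hge)
    have hge₂ : M₂ ≤ ‖toE h‖ := (le_max_right _ _).trans ((le_max_right _ _).trans hge)
    have hexp : Real.exp (-s / 32) ≤ ‖toE h‖ ^ (-b) := by
      rw [Real.rpow_def_of_pos hpos]
      refine Real.exp_le_exp.2 ?_
      have := hM₂ h hge₂
      linarith
    have hsup {ω m} (hm : ∀ x ∈ cube (0 : Fin d → ℤ), |W (x + toE h) ω - W (toE h) ω| ≤ m) :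
        sSup ((fun x => Y x ω) '' cube h) ≤ Real.exp (m + W (toE h) ω - 3 / 8 * s) := by
      refine csSup_le (Set.Nonempty.image _ ⟨_, toE_mem_cube h⟩) ?_
      rintro _ ⟨x, hx, rfl⟩
      have hx' := sub_toE_mem_cube_zero hx
      have h1 := (le_abs_self _).trans (hm _ hx')
      have h2 := hM₁ h hge₁ _ hx'
      rw [sub_add_cancel] at h1 h2
      simp only [hY]
      refine Real.exp_le_exp.2 ?_
      linarith
    obtain ⟨v, hv, hsv⟩ := hlaw (toE h)
    have hWi : Integrable (fun ω => Real.exp (1 / 2 * W (toE h) ω)) P := by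
      have := integrable_exp_mul_gaussianReal (μ := 0) (v := v) (1 / 2)
      rw [← hv] at this
      exact this.comp_measurable (hmeas _)
    have hWe : ∫ ω, Real.exp (1 / 2 * W (toE h) ω) ∂P = Real.exp (s / 8) := by
      have := mgf_gaussianReal hv (1 / 2)
      rw [mgf] at this
      rw [this, hs, hsv]
      congr 1
      ring
    have hsum : Integrable
        (fun ω => Real.exp (-s / 32) * ((g₀ ω).toReal + (g h ω).toReal)) P :=
      (hg₀i.add (hgi h)).const_mul _
    calc _ ≤ ∫ ω, (Real.exp (-s / 32) * ((g₀ ω).toReal + (g h ω).toReal)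
            + Real.exp (1 / 2 * W (toE h) ω) * Real.exp (-5 * s / 32)) / 2 ∂P := by
          refine integral_mono_of_nonneg
            (ae_of_all _ fun ω => le_min (hnonneg 0 ω) (hnonneg h ω))
            ((hsum.add (hWi.mul_const _)).div_const _) ?_
          filter_upwards [hbound₀, hbound h] with ω ⟨m₀, _, hme₀, hm₀⟩ ⟨m, _, hme, hm⟩
          rw [← hme, ← hme₀]
          exact (min_le_min (hsup₀ hm₀) (hsup hm)).trans (min_exp_le_half_add _ _ _ _)
      _ = (Real.exp (-s / 32) * (∫ ω, (g₀ ω).toReal ∂P + ∫ ω, (g h ω).toReal ∂P)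
            + Real.exp (s / 8) * Real.exp (-5 * s / 32)) / 2 := by
          rw [integral_div, integral_add hsum (hWi.mul_const _),
            integral_const_mul, integral_add hg₀i (hgi h), integral_mul_const, hWe]
      _ = Real.exp (-s / 32) * ((∫ ω, (g₀ ω).toReal ∂P + ∫ ω, (g h ω).toReal ∂P) + 1) / 2 := by
          rw [← Real.exp_add, show s / 8 + -5 * s / 32 = -s / 32 by ring]
          ring
      _ ≤ Real.exp (-s / 32) * (K.toReal + 1) := by
          have := hgK h
          nlinarith [Real.exp_pos (-s / 32)]
      _ ≤ ‖toE h‖ ^ (-b) * (K.toReal + 1) := by gcongr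
      _ ≤ (K.toReal + 1) * (1 + M ^ b) * ‖toE h‖ ^ (-b) := by
          nlinarith [mul_pos (mul_pos hMb hpow) (by linarith : 0 < K.toReal + 1)]

end
end
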